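/- Every measurable pseudo-Anosov homeomorphism F : Σ → Σ has dense periodic points: for every non-empty open subset U of Σ there exist a point x ∈ U and n ≥ 1 with F^n(x) = x. -/

import Mathlib

open MeasureTheory Set Function Topology Filter
open scoped ENNReal

noncomputable section

variable {S : Type} [TopologicalSpace S] [MeasurableSpace S]

/-- `d` is (the distance function of) a metric on `S` compatible with its topology. -/
def IsCompatibleMetric (S : Type) [TopologicalSpace S] (d : S → S → ℝ) : Prop :=
  (∀ x y, d x y = d y x) ∧ (∀ x y, d x y = 0 ↔ x = y) ∧
  (∀ x y z, d x z ≤ d x y + d y z) ∧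
  (∀ s : Set S, IsOpen s ↔ ∀ x ∈ s, ∃ ε > (0 : ℝ), ∀ y, d x y < ε → y ∈ s)

/-- An immersed line: a continuous injective image of `ℝ`. -/
def IsImmersedLine (ℓ : Set S) : Prop :=
  ∃ f : ℝ → S, Continuous f ∧ Function.Injective f ∧ Set.range f = ℓ

/-- `A` is a closed stream arc of the immersed line `ℓ` with endpoints `x` and `y`. -/
def IsArcIn (ℓ A : Set S) (x y : S) : Prop :=
  ∃ f : ℝ → S, Continuous f ∧ Function.Injective f ∧ Set.range f = ℓ ∧
    ∃ a b : ℝ, a ≤ b ∧ f a = x ∧ f b = y ∧ A = f '' Set.Icc a b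

/-- `A` is a closed stream arc of the immersed line `ℓ`. -/
def IsArc (ℓ A : Set S) : Prop := ∃ x y, IsArcIn ℓ A x y

/-- Topological transversality of two immersed lines at a point `x`: local pieces (arcs) of the
two lines through `x` are, in some chart around `x`, the two coordinate axes. -/
def TransverseAt (ℓ ℓ' : Set S) (x : S) : Prop :=
  ∃ α β : Set S, x ∈ α ∧ x ∈ β ∧ IsArc ℓ α ∧ IsArc ℓ' β ∧
    ∃ U : Set S, IsOpen U ∧ x ∈ U ∧ ∃ e : U ≃ₜ ℝ × ℝ,
      Subtype.val '' (⇑e ⁻¹' {p : ℝ × ℝ | p.2 = 0}) = α ∩ U ∧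
      Subtype.val '' (⇑e ⁻¹' {p : ℝ × ℝ | p.1 = 0}) = β ∩ U

/-- The (manifold) boundary of the surface `S`: points having no neighbourhood
homeomorphic to the plane. -/
def ManifoldBdry (S : Type) [TopologicalSpace S] : Set S :=
  {x : S | ¬ ∃ U : Set S, IsOpen U ∧ x ∈ U ∧ Nonempty (U ≃ₜ ℝ × ℝ)}

/-- An Oxtoby–Ulam (OU) measure on the compact surface `S`: Borel (via the ambient
`BorelSpace` assumption), non-atomic, positive on non-empty open sets, and vanishing on
the boundary of `S`. -/
structure IsOUMeasure (μ : Measure S) : Prop where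
  noAtoms : ∀ x : S, μ {x} = 0
  openPos : ∀ U : Set S, IsOpen U → U.Nonempty → 0 < μ U
  boundaryNull : μ (ManifoldBdry S) = 0

/-- A measured turbulation on `S` (with ambient measure `μ`): a partition of a full
`μ`-measure Borel subset of `S` into streamlines (immersed lines), together with an
OU measure on each streamline which is finite on closed stream arcs. -/
structure MeasuredTurbulation (μ : Measure S) where
  lines : Set (Set S)
  lines_immersed : ∀ ℓ ∈ lines, IsImmersedLine ℓ
  lines_disjoint : lines.PairwiseDisjoint id
  domain_borel : MeasurableSet (⋃₀ lines)
  domain_full : μ (⋃₀ lines) = 1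
  ν : Set S → Measure S
  ν_supported : ∀ ℓ ∈ lines, ν ℓ ℓᶜ = 0
  ν_nonatomic : ∀ ℓ ∈ lines, ∀ x : S, ν ℓ {x} = 0
  ν_arc_pos : ∀ ℓ ∈ lines, ∀ A : Set S, ∀ x y : S, IsArcIn ℓ A x y → x ≠ y → 0 < ν ℓ A
  ν_arc_finite : ∀ ℓ ∈ lines, ∀ A : Set S, ∀ x y : S, IsArcIn ℓ A x y → ν ℓ A < ⊤

namespace MeasuredTurbulation

variable {μ : Measure S}

/-- Tameness with respect to a given metric `d`: stream arcs of small stream measure are small. -/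
def TameWith (T : MeasuredTurbulation μ) (d : S → S → ℝ) : Prop :=
  ∀ ε : ℝ, 0 < ε → ∃ δ : ℝ, 0 < δ ∧
    ∀ ℓ ∈ T.lines, ∀ A : Set S, ∀ x y : S,
      IsArcIn ℓ A x y → T.ν ℓ A < ENNReal.ofReal δ → d x y < ε

/-- A measured turbulation is tame if it is tame with respect to (every, equivalently some)
metric on `S` compatible with its topology. -/
def Tame (T : MeasuredTurbulation μ) : Prop :=
  ∀ d : S → S → ℝ, IsCompatibleMetric S d → T.TameWith d

/-- Every streamline is dense in `S`. -/
def DenseStreamlines (T : MeasuredTurbulation μ) : Prop := ∀ ℓ ∈ T.lines, Dense ℓ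

/-- Two measured turbulations are transverse if almost every point lies on streamlines of both
which intersect transversely there. -/
def TransversePair (Ts Tu : MeasuredTurbulation μ) : Prop :=
  ∃ W : Set S, MeasurableSet W ∧ μ W = 1 ∧
    ∀ x ∈ W, ∃ ℓ ∈ Ts.lines, ∃ ℓ' ∈ Tu.lines, x ∈ ℓ ∧ x ∈ ℓ' ∧ TransverseAt ℓ ℓ' x

end MeasuredTurbulation

/-- A tartan for the (stable, unstable) pair of measured turbulations `(Ts, Tu)`. -/
structure Tartan {μ : Measure S} (Ts Tu : MeasuredTurbulation μ) where
  Rs : Set S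
  Ru : Set S
  borel_s : MeasurableSet Rs
  borel_u : MeasurableSet Ru
  fibs : Set (Set S)
  fibu : Set (Set S)
  fibs_disjoint : fibs.PairwiseDisjoint id
  fibu_disjoint : fibu.PairwiseDisjoint id
  fibs_cover : ⋃₀ fibs = Rs
  fibu_cover : ⋃₀ fibu = Ru
  /-- (a) every stable fiber meets every unstable fiber in exactly one point. -/
  inter_unique : ∀ A ∈ fibs, ∀ B ∈ fibu, ∃! z : S, z ∈ A ∩ B
  /-- The fibers are stream arcs of the corresponding turbulations, and (b) they can be
  oriented consistently: every stable fiber crosses the unstable fibers in the same order,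
  and vice versa. -/
  oriented : ∃ ords ordu : Set S → S → S → Prop,
    (∀ A ∈ fibs, ∃ ℓ ∈ Ts.lines, ∃ f : ℝ → S, Continuous f ∧ Function.Injective f ∧
        Set.range f = ℓ ∧ ∃ a b : ℝ, a ≤ b ∧ A = f '' Set.Icc a b ∧
        ∀ s ∈ Set.Icc a b, ∀ t ∈ Set.Icc a b, (ords A (f s) (f t) ↔ s ≤ t)) ∧
    (∀ B ∈ fibu, ∃ ℓ ∈ Tu.lines, ∃ f : ℝ → S, Continuous f ∧ Function.Injective f ∧
        Set.range f = ℓ ∧ ∃ a b : ℝ, a ≤ b ∧ B = f '' Set.Icc a b ∧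
        ∀ s ∈ Set.Icc a b, ∀ t ∈ Set.Icc a b, (ordu B (f s) (f t) ↔ s ≤ t)) ∧
    (∀ A ∈ fibs, ∀ A' ∈ fibs, ∀ B ∈ fibu, ∀ B' ∈ fibu,
      ∀ p ∈ A ∩ B, ∀ q ∈ A ∩ B', ∀ p' ∈ A' ∩ B, ∀ q' ∈ A' ∩ B',
        (ords A p q ↔ ords A' p' q')) ∧
    (∀ B ∈ fibu, ∀ B' ∈ fibu, ∀ A ∈ fibs, ∀ A' ∈ fibs,
      ∀ p ∈ B ∩ A, ∀ q ∈ B ∩ A', ∀ p' ∈ B' ∩ A, ∀ q' ∈ B' ∩ A',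
        (ordu B p q ↔ ordu B' p' q'))
  /-- (c) the stream measures of the fibers are bounded above. -/
  bounded : ∃ L : ℝ≥0∞, L < ⊤ ∧
    (∀ A ∈ fibs, ∀ ℓ ∈ Ts.lines, A ⊆ ℓ → Ts.ν ℓ A ≤ L) ∧
    (∀ B ∈ fibu, ∀ ℓ ∈ Tu.lines, B ⊆ ℓ → Tu.ν ℓ B ≤ L)
  /-- (d) `Rs ∪ Ru` is contained in an open topological disk. -/
  in_disk : ∃ U : Set S, IsOpen U ∧ Rs ∪ Ru ⊆ U ∧ Nonempty (U ≃ₜ ℝ × ℝ)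

namespace Tartan

variable {μ : Measure S} {Ts Tu : MeasuredTurbulation μ}

/-- The set `R^⋔` of tartan intersection points. -/
def core (R : Tartan Ts Tu) : Set S := R.Rs ∩ R.Ru

/-- The tartan `R` is compatible with the ambient measure `μ`: for all stable and unstable
fibers `𝔰`, `𝔲`, the bijection `ψ : E^𝔰 × E^𝔲 → R^⋔`, `(x, y) ↦ 𝔲(x) ⋔ 𝔰(y)`, is
bi-measurable and pushes `ν_𝔰 × ν_𝔲` forward to `μ` restricted to `R^⋔`. -/
def Compatible (R : Tartan Ts Tu) : Prop :=
  ∀ 𝔰 ∈ R.fibs, ∀ 𝔲 ∈ R.fibu,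
  ∀ ℓs ∈ Ts.lines, 𝔰 ⊆ ℓs → ∀ ℓu ∈ Tu.lines, 𝔲 ⊆ ℓu →
  ∃ ψ : S × S → S,
    (∀ x ∈ 𝔰 ∩ R.core, ∀ y ∈ 𝔲 ∩ R.core,
      ∀ B ∈ R.fibu, x ∈ B → ∀ A ∈ R.fibs, y ∈ A → ψ (x, y) ∈ B ∩ A) ∧
    Set.InjOn ψ ((𝔰 ∩ R.core) ×ˢ (𝔲 ∩ R.core)) ∧
    ψ '' ((𝔰 ∩ R.core) ×ˢ (𝔲 ∩ R.core)) = R.core ∧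
    Measurable ψ ∧
    (∀ E : Set (S × S), E ⊆ (𝔰 ∩ R.core) ×ˢ (𝔲 ∩ R.core) → MeasurableSet E →
      MeasurableSet (ψ '' E)) ∧
    Measure.map ψ (((Ts.ν ℓs).restrict (𝔰 ∩ R.core)).prod
      ((Tu.ν ℓu).restrict (𝔲 ∩ R.core))) = μ.restrict R.core

/-- Image of `B ⊆ E^𝔰` under the holonomy map `h_{𝔰,𝔰'} : E^𝔰 → E^{𝔰'}`, `x ↦ 𝔲(x) ⋔ 𝔰'`. -/
def holSS (R : Tartan Ts Tu) (𝔰' B : Set S) : Set S :=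
  {x' : S | ∃ x ∈ B, ∃ Bu ∈ R.fibu, x ∈ Bu ∧ x' ∈ Bu ∩ 𝔰'}

/-- Image of `B ⊆ E^𝔲` under the holonomy map `h_{𝔲,𝔲'} : E^𝔲 → E^{𝔲'}`, `y ↦ 𝔰(y) ⋔ 𝔲'`. -/
def holUU (R : Tartan Ts Tu) (𝔲' B : Set S) : Set S :=
  {y' : S | ∃ y ∈ B, ∃ A ∈ R.fibs, y ∈ A ∧ y' ∈ A ∩ 𝔲'}

/-- "`𝔲(x) ⋔ 𝔰(y) ∈ A`": the intersection point of the unstable fiber through `x` and the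
stable fiber through `y` belongs to `A`. -/
def sectMem (R : Tartan Ts Tu) (A : Set S) (x y : S) : Prop :=
  ∃ B ∈ R.fibu, x ∈ B ∧ ∃ C ∈ R.fibs, y ∈ C ∧ ∃ z ∈ B ∩ C, z ∈ A

/-- `ν_{𝔲(x)}(A ∩ 𝔲(x))`: the stream measure of `A` along the unstable fiber through `x`. -/
def fiberMeasU (R : Tartan Ts Tu) (A : Set S) (x : S) : ℝ≥0∞ :=
  ⨆ (B : Set S) (_ : B ∈ R.fibu) (_ : x ∈ B) (ℓ : Set S) (_ : ℓ ∈ Tu.lines) (_ : B ⊆ ℓ),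
    Tu.ν ℓ (A ∩ B)

/-- `ν_{𝔰(y)}(A ∩ 𝔰(y))`: the stream measure of `A` along the stable fiber through `y`. -/
def fiberMeasS (R : Tartan Ts Tu) (A : Set S) (y : S) : ℝ≥0∞ :=
  ⨆ (C : Set S) (_ : C ∈ R.fibs) (_ : y ∈ C) (ℓ : Set S) (_ : ℓ ∈ Ts.lines) (_ : C ⊆ ℓ),
    Ts.ν ℓ (A ∩ C)

end Tartan

/-- The union of the stable streamlines containing fibers of `R`. -/
def stableSaturation {μ : Measure S} {Ts Tu : MeasuredTurbulation μ} (R : Tartan Ts Tu) :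
    Set S :=
  ⋃₀ {ℓ : Set S | ℓ ∈ Ts.lines ∧ ∃ A ∈ R.fibs, A ⊆ ℓ}

/-- The union of the unstable streamlines containing fibers of `R`. -/
def unstableSaturation {μ : Measure S} {Ts Tu : MeasuredTurbulation μ} (R : Tartan Ts Tu) :
    Set S :=
  ⋃₀ {ℓ : Set S | ℓ ∈ Tu.lines ∧ ∃ B ∈ R.fibu, B ⊆ ℓ}

/-- The pair `(Ts, Tu)` is full: countably many compatible tartans cover a full measure
subset of `S`, and every non-empty open set contains a positive measure compatible tartan. -/
def FullPair {μ : Measure S} (Ts Tu : MeasuredTurbulation μ) : Prop :=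
  (∃ R : ℕ → Tartan Ts Tu, (∀ i, (R i).Compatible) ∧ μ (⋃ i, (R i).core) = 1) ∧
  (∀ U : Set S, IsOpen U → U.Nonempty →
    ∃ R : Tartan Ts Tu, R.Compatible ∧ 0 < μ R.core ∧ R.Rs ∪ R.Ru ⊆ U)

/-- `(Ts, Tu)` are measurable pseudo-Anosov turbulations: transverse, tame, full, with
dense streamlines. -/
def MPATurbulations {μ : Measure S} (Ts Tu : MeasuredTurbulation μ) : Prop :=
  Ts.TransversePair Tu ∧ Ts.Tame ∧ Tu.Tame ∧ FullPair Ts Tu ∧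
    Ts.DenseStreamlines ∧ Tu.DenseStreamlines

/-- `F` is a measurable pseudo-Anosov homeomorphism with invariant turbulations `(Ts, Tu)`
and dilatation `lam > 1`. -/
structure IsMPA (μ : Measure S) (F : S ≃ₜ S) (Ts Tu : MeasuredTurbulation μ)
    (lam : ℝ) : Prop where
  measurePreserving : MeasurePreserving (⇑F) μ μ
  one_lt_lam : 1 < lam
  turbulations : MPATurbulations Ts Tu
  stable_image : ∀ ℓ ∈ Ts.lines, ⇑F '' ℓ ∈ Ts.lines
  unstable_image : ∀ ℓ ∈ Tu.lines, ⇑F '' ℓ ∈ Tu.lines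
  stable_contract : ∀ ℓ ∈ Ts.lines, ∀ A : Set S, ∀ x y : S, IsArcIn ℓ A x y →
    Ts.ν (⇑F '' ℓ) (⇑F '' A) = (ENNReal.ofReal lam)⁻¹ * Ts.ν ℓ A
  unstable_expand : ∀ ℓ ∈ Tu.lines, ∀ A : Set S, ∀ x y : S, IsArcIn ℓ A x y →
    Tu.ν (⇑F '' ℓ) (⇑F '' A) = ENNReal.ofReal lam * Tu.ν ℓ A

/-- `x` is a (two-sided) density point of `D` along the streamline `ℓ` of `T`. -/
def DensityPtAlong {μ : Measure S} (T : MeasuredTurbulation μ) (ℓ D : Set S) (x : S) :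
    Prop :=
  ∀ ε : ℝ, 0 < ε → ∃ δ : ℝ, 0 < δ ∧ ∀ A : Set S, ∀ y : S,
    IsArcIn ℓ A x y → T.ν ℓ A < ENNReal.ofReal δ →
      (1 - ε) * (T.ν ℓ A).toReal ≤ (T.ν ℓ (A ∩ D)).toReal

/-- The set `den_k(R)` of level `k` density points of the tartan `R`. -/
def denSet {μ : Measure S} {Ts Tu : MeasuredTurbulation μ} (R : Tartan Ts Tu) :
    ℕ → Set S
  | 0 => R.core
  | k + 1 =>
    {x : S | x ∈ denSet R k ∧
      (∀ ℓ ∈ Ts.lines, x ∈ ℓ → DensityPtAlong Ts ℓ (denSet R k) x) ∧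
      (∀ ℓ ∈ Tu.lines, x ∈ ℓ → DensityPtAlong Tu ℓ (denSet R k) x)}

/-- The set `X_{δ,η}(R)`: points of `R^⋔` all of whose stable and unstable stream arcs of
measure less than `η` contain points of `R^⋔` in density at least `1 - δ`. -/
def Xset {μ : Measure S} {Ts Tu : MeasuredTurbulation μ} (R : Tartan Ts Tu)
    (δ η : ℝ) : Set S :=
  {x : S | x ∈ R.core ∧
    (∀ ℓ ∈ Ts.lines, x ∈ ℓ → ∀ A : Set S, ∀ y : S, IsArcIn ℓ A x y →
      Ts.ν ℓ A < ENNReal.ofReal η →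
        ENNReal.ofReal (1 - δ) * Ts.ν ℓ A ≤ Ts.ν ℓ (A ∩ R.core)) ∧
    (∀ ℓ ∈ Tu.lines, x ∈ ℓ → ∀ A : Set S, ∀ y : S, IsArcIn ℓ A x y →
      Tu.ν ℓ A < ENNReal.ofReal η →
        ENNReal.ofReal (1 - δ) * Tu.ν ℓ A ≤ Tu.ν ℓ (A ∩ R.core))}

/-- A regular tartan: for `y ∈ 𝔰(x) ∩ R^⋔` and `z ∈ 𝔲(x) ∩ R^⋔` at small stream distance
from `x`, all the fibers of the subtartan `R(y,z)` (the subarcs of stable fibers running from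
`𝔲(y)` to `𝔲(z) = 𝔲(x)`, and of unstable fibers running from `𝔰(y) = 𝔰(x)` to `𝔰(z)`)
are contained in `U`. -/
def Tartan.Regular {μ : Measure S} {Ts Tu : MeasuredTurbulation μ}
    (R : Tartan Ts Tu) : Prop :=
  ∀ x ∈ R.core, ∀ U ∈ 𝓝 x, ∃ δ : ℝ, 0 < δ ∧
    ∀ 𝔰x ∈ R.fibs, x ∈ 𝔰x → ∀ 𝔲x ∈ R.fibu, x ∈ 𝔲x →
    ∀ y ∈ 𝔰x ∩ R.core, ∀ z ∈ 𝔲x ∩ R.core,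
    (∀ ℓ ∈ Ts.lines, 𝔰x ⊆ ℓ → ∀ α : Set S, IsArcIn ℓ α x y →
      Ts.ν ℓ α < ENNReal.ofReal δ) →
    (∀ ℓ ∈ Tu.lines, 𝔲x ⊆ ℓ → ∀ α : Set S, IsArcIn ℓ α x z →
      Tu.ν ℓ α < ENNReal.ofReal δ) →
    ∀ 𝔲y ∈ R.fibu, y ∈ 𝔲y → ∀ 𝔰z ∈ R.fibs, z ∈ 𝔰z →
      ((∀ A ∈ R.fibs, ∀ p q : S, p ∈ A ∩ 𝔲y → q ∈ A ∩ 𝔲x →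
          ∀ ℓ ∈ Ts.lines, A ⊆ ℓ → ∀ α : Set S, IsArcIn ℓ α p q → α ⊆ U) ∧
       (∀ B ∈ R.fibu, ∀ p q : S, p ∈ B ∩ 𝔰x → q ∈ B ∩ 𝔰z →
          ∀ ℓ ∈ Tu.lines, B ⊆ ℓ → ∀ β : Set S, IsArcIn ℓ β p q → β ⊆ U))

/-- A (stable) bi-Lipschitz regular tartan: for some metric compatible with the topology of
`S` and some `K ≥ 1`, stream measure and distance are `K`-bi-Lipschitz comparable along
stable fibers. -/
def Tartan.StableBiLipschitzRegular {μ : Measure S} {Ts Tu : MeasuredTurbulation μ}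
    (R : Tartan Ts Tu) : Prop :=
  ∃ d : S → S → ℝ, IsCompatibleMetric S d ∧ ∃ K : ℝ, 1 ≤ K ∧
    ∀ 𝔰 ∈ R.fibs, ∀ x ∈ 𝔰, ∀ y ∈ 𝔰, ∀ ℓ ∈ Ts.lines, 𝔰 ⊆ ℓ →
      ∀ α : Set S, IsArcIn ℓ α x y →
        d x y / K ≤ (Ts.ν ℓ α).toReal ∧ (Ts.ν ℓ α).toReal ≤ K * d x y

/-- The turbulation `T` has partial flowboxes: if `x` and `y` lie on the same streamline
`ℓ`, and arcs transverse to `ℓ` at `x` and `y` contain transverse intersections with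
streamlines of `T` arbitrarily close to `x` and `y` on the same side of `ℓ`, then every
neighbourhood `U` of the stream arc `[x,y]` contains other stream arcs with endpoints on the
two transversals.  (The transversals and the side are encoded via a chart straightening the
streamline.) -/
def HasPartialFlowboxes {μ : Measure S} (T : MeasuredTurbulation μ) : Prop :=
  ∀ ℓ ∈ T.lines, ∀ x y : S, ∀ A : Set S, IsArcIn ℓ A x y →
  ∀ V : Set S, IsOpen V → ∀ e : V ≃ₜ ℝ × ℝ, A ⊆ V →
  (Subtype.val '' (⇑e ⁻¹' {p : ℝ × ℝ | p.2 = 0}) ⊆ ℓ) →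
  (∃ hx : x ∈ V, e ⟨x, hx⟩ = (0, 0)) →
  (∃ hy : y ∈ V, e ⟨y, hy⟩ = (1, 0)) →
  (∀ ε : ℝ, 0 < ε → ∃ p : S, ∃ hp : p ∈ V,
      (e ⟨p, hp⟩).1 = 0 ∧ 0 < (e ⟨p, hp⟩).2 ∧ (e ⟨p, hp⟩).2 < ε ∧
      ∃ ℓ' ∈ T.lines, p ∈ ℓ' ∧
        TransverseAt ℓ' (Subtype.val '' (⇑e ⁻¹' {q : ℝ × ℝ | q.1 = 0})) p) →
  (∀ ε : ℝ, 0 < ε → ∃ p : S, ∃ hp : p ∈ V,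
      (e ⟨p, hp⟩).1 = 1 ∧ 0 < (e ⟨p, hp⟩).2 ∧ (e ⟨p, hp⟩).2 < ε ∧
      ∃ ℓ' ∈ T.lines, p ∈ ℓ' ∧
        TransverseAt ℓ' (Subtype.val '' (⇑e ⁻¹' {q : ℝ × ℝ | q.1 = 1})) p) →
  ∀ U : Set S, IsOpen U → A ⊆ U →
    ∃ ℓ'' ∈ T.lines, ∃ A'' : Set S, ∃ x'' y'' : S, IsArcIn ℓ'' A'' x'' y'' ∧
      A'' ⊆ U ∧ A'' ≠ A ∧
      x'' ∈ Subtype.val '' (⇑e ⁻¹' {q : ℝ × ℝ | q.1 = 0}) ∧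
      y'' ∈ Subtype.val '' (⇑e ⁻¹' {q : ℝ × ℝ | q.1 = 1})

/-- Forward Birkhoff averages of `φ` under the homeomorphism `F`. -/
def birkhoffFwd (F : S ≃ₜ S) (φ : S → ℝ) (x : S) (n : ℕ) : ℝ :=
  (n : ℝ)⁻¹ * ∑ i ∈ Finset.range n, φ ((⇑F)^[i] x)

/-- Backward Birkhoff averages of `φ` under the homeomorphism `F`. -/
def birkhoffBwd (F : S ≃ₜ S) (φ : S → ℝ) (x : S) (n : ℕ) : ℝ :=
  (n : ℝ)⁻¹ * ∑ i ∈ Finset.range n, φ ((⇑F.symm)^[i] x)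

/-- The set `Z` of points where the forward and backward Birkhoff averages of `φ` exist
and are equal. -/
def ZSet (F : S ≃ₜ S) (φ : S → ℝ) : Set S :=
  {x : S | ∃ c : ℝ, Tendsto (birkhoffFwd F φ x) atTop (𝓝 c) ∧
      Tendsto (birkhoffBwd F φ x) atTop (𝓝 c)}

/-- The relation `~` on `Z`: `x ~ y` if they are joined by a finite chain of stream arcs
whose consecutive intersections contain points of `Z`. -/
def StreamRel {μ : Measure S} (Ts Tu : MeasuredTurbulation μ) (F : S ≃ₜ S)
    (φ : S → ℝ) (x y : S) : Prop :=
  x ∈ ZSet F φ ∧ y ∈ ZSet F φ ∧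
  (x = y ∨ ∃ k : ℕ, ∃ α : Fin (k + 1) → Set S,
    (∀ i, (∃ ℓ ∈ Ts.lines, IsArc ℓ (α i)) ∨ (∃ ℓ ∈ Tu.lines, IsArc ℓ (α i))) ∧
    x ∈ α 0 ∧ y ∈ α (Fin.last k) ∧
    ∀ i : Fin k, ∃ z ∈ α i.castSucc ∩ α i.succ, z ∈ ZSet F φ)

/-! ### Continuous logarithms of plane-valued functions -/

/-- `f` has a continuous logarithm on `K`. -/
def HasLogOn {X : Type*} [TopologicalSpace X] (f : X → ℂ) (K : Set X) : Prop :=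
  ∃ g : X → ℂ, ContinuousOn g K ∧ ∀ z ∈ K, f z = Complex.exp (g z)

namespace HasLogOn

variable {X Y : Type*} [TopologicalSpace X] [TopologicalSpace Y] {f g : X → ℂ} {K L : Set X}

theorem mono (h : HasLogOn f K) (hL : L ⊆ K) : HasLogOn f L := by
  obtain ⟨u, hu, hf⟩ := h
  exact ⟨u, hu.mono hL, fun z hz => hf z (hL hz)⟩

theorem congr (h : HasLogOn f K) (hfg : ∀ z ∈ K, g z = f z) : HasLogOn g K := by
  obtain ⟨u, hu, hf⟩ := h
  exact ⟨u, hu, fun z hz => (hfg z hz).trans (hf z hz)⟩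

theorem one : HasLogOn (fun _ : X => (1 : ℂ)) K :=
  ⟨fun _ => 0, continuousOn_const, by simp⟩

theorem mul (hf : HasLogOn f K) (hg : HasLogOn g K) : HasLogOn (fun z => f z * g z) K := by
  obtain ⟨u, hu, hf⟩ := hf
  obtain ⟨v, hv, hg⟩ := hg
  exact ⟨fun z => u z + v z, hu.add hv, fun z hz => by
    rw [Complex.exp_add, ← hf z hz, ← hg z hz]⟩

theorem inv (hf : HasLogOn f K) : HasLogOn (fun z => (f z)⁻¹) K := by
  obtain ⟨u, hu, hf⟩ := hf
  exact ⟨fun z => - u z, hu.neg, fun z hz => by rw [Complex.exp_neg, ← hf z hz]⟩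

theorem div (hf : HasLogOn f K) (hg : HasLogOn g K) : HasLogOn (fun z => f z / g z) K := by
  simpa only [div_eq_mul_inv] using hf.mul hg.inv

theorem comp {φ : Y → X} {M : Set Y} (hf : HasLogOn f K) (hφ : ContinuousOn φ M)
    (hM : MapsTo φ M K) : HasLogOn (fun y => f (φ y)) M := by
  obtain ⟨u, hu, hf⟩ := hf
  exact ⟨fun y => u (φ y), hu.comp hφ hM, fun y hy => hf _ (hM hy)⟩

theorem of_mul_slitPlane (hf : ContinuousOn f K) {c : ℂ} (hc : c ≠ 0)
    (h : ∀ z ∈ K, c * f z ∈ Complex.slitPlane) : HasLogOn f K := by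
  refine ⟨fun z => Complex.log (c * f z) - Complex.log c,
    ((continuousOn_const.mul hf).clog h).sub continuousOn_const, fun z hz => ?_⟩
  rw [Complex.exp_sub, Complex.exp_log (Complex.slitPlane_ne_zero (h z hz)), Complex.exp_log hc]
  field_simp

theorem of_norm_sub_lt (hf : ContinuousOn f K) {c : ℂ} (h : ∀ z ∈ K, ‖f z - c‖ < ‖c‖) :
    HasLogOn f K := by
  rcases K.eq_empty_or_nonempty with rfl | ⟨z₀, hz₀⟩
  · exact ⟨fun _ => 0, by simp, by simp⟩
  have hc : c ≠ 0 := by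
    rintro rfl
    have := h z₀ hz₀
    simp only [norm_zero] at this
    exact absurd this (not_lt.2 (norm_nonneg _))
  refine of_mul_slitPlane hf (inv_ne_zero hc) fun z hz => ?_
  have : ‖c⁻¹ * f z - 1‖ < 1 := by
    have h1 : c⁻¹ * f z - 1 = c⁻¹ * (f z - c) := by field_simp
    rw [h1, norm_mul, norm_inv, inv_mul_lt_iff₀ (norm_pos_iff.2 hc), mul_one]
    exact h z hz
  left
  have h2 := (abs_le.1 (Complex.abs_re_le_norm (c⁻¹ * f z - 1))).1
  simp only [Complex.sub_re, Complex.one_re] at h2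
  linarith

end HasLogOn

/-- Subdivision principle for a property of intervals. -/
theorem interval_subdivision {C : ℝ → ℝ → Prop} {a b ε : ℝ} (hε : 0 < ε)
    (small : ∀ x y, a ≤ x → x ≤ y → y ≤ b → y - x < ε → C x y)
    (merge : ∀ x y z, a ≤ x → x ≤ y → y ≤ z → z ≤ b → C x y → C y z → C x z) (hab : a ≤ b) :
    C a b := by
  have key : ∀ n : ℕ, ∀ y, a ≤ y → y ≤ b → y - a < n * (ε / 2) + ε → C a y := by
    intro n
    induction n with
    | zero => intro y h1 h2 h3; exact small a y le_rfl h1 h2 (by simpa using h3)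
    | succ n ih =>
      intro y h1 h2 h3
      push_cast at h3
      by_cases h : y - a < ε
      · exact small a y le_rfl h1 h2 h
      · push Not at h
        refine merge a (y - ε / 2) y le_rfl (by linarith) (by linarith) h2 ?_ ?_
        · exact ih _ (by linarith) (by linarith) (by linarith)
        · exact small _ _ (by linarith) (by linarith) h2 (by linarith)
  obtain ⟨n, hn⟩ := exists_nat_gt ((b - a) / (ε / 2))
  refine key n b hab le_rfl ?_
  rw [div_lt_iff₀ (by positivity)] at hn
  linarith

/-- Integer step functions on the line with unit steps located in `C`. -/
inductive StepFn (C : Set ℝ) : (ℝ → ℤ) → Prop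
  | zero : StepFn C fun _ => 0
  | up {J : ℝ → ℤ} {c : ℝ} : StepFn C J → c ∈ C → StepFn C fun y => J y + if y < c then 1 else 0
  | down {J : ℝ → ℤ} {c : ℝ} : StepFn C J → c ∈ C → StepFn C fun y => J y - if y < c then 1 else 0

namespace StepFn

variable {C D : Set ℝ} {J J' : ℝ → ℤ}

theorem mono (h : StepFn C J) (hCD : C ⊆ D) : StepFn D J := by
  induction h with
  | zero => exact .zero
  | up _ hc ih => exact ih.up (hCD hc)
  | down _ hc ih => exact ih.down (hCD hc)

theorem add (h : StepFn C J) (h' : StepFn C J') : StepFn C fun y => J y + J' y := by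
  induction h' with
  | zero => simpa using h
  | up _ hc ih => simpa only [add_assoc] using ih.up hc
  | down _ hc ih => simpa only [add_sub_assoc] using ih.down hc

theorem single {c : ℝ} (hc : c ∈ C) (k : ℤ) : StepFn C fun y => k * if y < c then 1 else 0 := by
  induction k with
  | zero => simpa using StepFn.zero
  | succ n ih => simpa only [add_mul, one_mul] using ih.up hc
  | pred n ih => simpa only [sub_mul, one_mul] using ih.down hc

theorem eq_of_iff (h : StepFn C J) {y y' : ℝ} (hy : ∀ c ∈ C, (y < c ↔ y' < c)) : J y = J y' := by
  induction h with
  | zero => rfl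
  | up _ hc ih => simp only [ih, hy _ hc]
  | down _ hc ih => simp only [ih, hy _ hc]

theorem eq_zero (h : StepFn C J) {y : ℝ} (hy : ∀ c ∈ C, c ≤ y) : J y = 0 := by
  induction h with
  | zero => rfl
  | up _ hc ih => simp [ih, hy _ hc]
  | down _ hc ih => simp [ih, hy _ hc]

end StepFn

/-- A continuous integer valued function on a compact subset of the line agrees, up to a constant,
with a step function whose steps are outside the compact set. -/
theorem exists_stepFn_eq {E : Set ℝ} (hE : IsCompact E) {n : ℝ → ℤ} (hn : ContinuousOn n E)
    {a b : ℝ} (hab : a ≤ b) :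
    ∃ J m, StepFn (Icc a b \ E) J ∧ ∀ y ∈ E ∩ Icc a b, n y = m + J y := by
  obtain ⟨ε, hε, hu⟩ := Metric.uniformContinuousOn_iff.1
    (hE.uniformContinuousOn_of_continuous hn) 1 one_pos
  have hu' : ∀ x ∈ E, ∀ y ∈ E, |x - y| < ε → n x = n y := by
    intro x hx y hy hxy
    have := hu x hx y hy hxy
    rw [Int.dist_eq] at this
    have h2 : |n x - n y| < 1 := by exact_mod_cast this
    rw [Int.abs_lt_one_iff] at h2
    omega
  refine interval_subdivision
    (C := fun a b => ∃ J m, StepFn (Icc a b \ E) J ∧ ∀ y ∈ E ∩ Icc a b, n y = m + J y) hε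
    ?_ ?_ hab
  · intro x y _ hxy _ hlt
    rcases (E ∩ Icc x y).eq_empty_or_nonempty with h | ⟨w, hw, hw'⟩
    · exact ⟨_, 0, .zero, by simp [h]⟩
    · refine ⟨_, n w, .zero, fun v ⟨hv, hv'⟩ => ?_⟩
      rw [hu' v hv w hw, add_zero]
      rw [abs_lt]
      constructor <;> linarith [hv'.1, hv'.2, hw'.1, hw'.2]
  · rintro x y z _ hxy hyz _ ⟨J, m, hJ, h1⟩ ⟨J', m', hJ', h2⟩
    have sub1 : Icc x y \ E ⊆ Icc x z \ E := fun t ht => ⟨⟨ht.1.1, ht.1.2.trans hyz⟩, ht.2⟩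
    have sub2 : Icc y z \ E ⊆ Icc x z \ E := fun t ht => ⟨⟨hxy.trans ht.1.1, ht.1.2⟩, ht.2⟩
    have up0 : ∀ t, y ≤ t → J t = 0 := fun t ht =>
      hJ.eq_zero fun c hc => hc.1.2.trans ht
    have low : ∀ t, t ∈ E → t ≤ y → J' t = J' (y - 1) := by
      intro t ht hty
      refine hJ'.eq_of_iff fun c hc => ?_
      have h3 : y ≤ c := hc.1.1
      have h4 : t ≠ c := fun h => hc.2 (h ▸ ht)
      have h5 : t < c := lt_of_le_of_ne (hty.trans h3) h4
      exact ⟨fun _ => by linarith, fun _ => h5⟩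
    by_cases hy : y ∈ E
    · refine ⟨_, m', (hJ.mono sub1).add (hJ'.mono sub2), fun t ht => ?_⟩
      have e1 := h1 y ⟨hy, hxy, le_rfl⟩
      have e2 := h2 y ⟨hy, le_rfl, hyz⟩
      rw [up0 y le_rfl] at e1
      rcases le_total t y with hty | hty
      · have e3 := h1 t ⟨ht.1, ht.2.1, hty⟩
        have e4 := low t ht.1 hty
        have e5 := low y hy le_rfl
        omega
      · have e3 := h2 t ⟨ht.1, hty, ht.2.2⟩
        have e4 := up0 t hty
        omega
    · have hyC : y ∈ Icc x z \ E := ⟨⟨hxy, hyz⟩, hy⟩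
      refine ⟨_, m', ((hJ.mono sub1).add (hJ'.mono sub2)).add
        (StepFn.single hyC (m - m' - J' (y - 1))), fun t ht => ?_⟩
      have hty : t ≠ y := fun h => hy (h ▸ ht.1)
      rcases lt_or_gt_of_ne hty with hty | hty
      · have e3 := h1 t ⟨ht.1, ht.2.1, hty.le⟩
        have e4 := low t ht.1 hty.le
        simp only [hty, if_true]
        omega
      · have e3 := h2 t ⟨ht.1, hty.le, ht.2.2⟩
        have e4 := up0 t hty.le
        simp only [not_lt.2 hty.le, if_false]
        omega

/-- Products of factors `z - c` and `(z - c)⁻¹` with `c ∈ C`. -/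
inductive DivFn (C : Set ℂ) : (ℂ → ℂ) → Prop
  | one : DivFn C fun _ => 1
  | mul {p : ℂ → ℂ} {c : ℂ} : DivFn C p → c ∈ C → DivFn C fun z => p z * (z - c)
  | div {p : ℂ → ℂ} {c : ℂ} : DivFn C p → c ∈ C → DivFn C fun z => p z * (z - c)⁻¹

namespace DivFn

variable {C D : Set ℂ} {p q : ℂ → ℂ}

theorem mono (h : DivFn C p) (hCD : C ⊆ D) : DivFn D p := by
  induction h with
  | one => exact .one
  | mul _ hc ih => exact ih.mul (hCD hc)
  | div _ hc ih => exact ih.div (hCD hc)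

theorem mul' (h : DivFn C p) (h' : DivFn C q) : DivFn C fun z => p z * q z := by
  induction h' with
  | one => simpa using h
  | mul _ hc ih => simpa only [mul_assoc] using ih.mul hc
  | div _ hc ih => simpa only [mul_assoc] using ih.div hc

theorem hasLogOn (h : DivFn C p) {K : Set ℂ} (hK : ∀ c ∈ C, HasLogOn (fun z => z - c) K) :
    HasLogOn p K := by
  induction h with
  | one => exact HasLogOn.one
  | mul _ hc ih => exact ih.mul (hK _ hc)
  | div _ hc ih => exact ih.mul (hK _ hc).inv

end DivFn

theorem Complex.log_mul_I_of_pos {s : ℝ} (hs : 0 < s) :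
    Complex.log (s * Complex.I) = Real.log s + Real.pi / 2 * Complex.I := by
  rw [Complex.log_ofReal_mul hs Complex.I_ne_zero, Complex.log_I]

theorem Complex.log_neg_mul_I_of_pos {s : ℝ} (hs : 0 < s) :
    Complex.log (-(s * Complex.I)) = Real.log s - Real.pi / 2 * Complex.I := by
  rw [← mul_neg, Complex.log_ofReal_mul hs (neg_ne_zero.2 Complex.I_ne_zero), Complex.log_neg_I]
  ring

theorem Complex.mem_slitPlane_of_re_nonneg {z : ℂ} (h : 0 ≤ z.re) (h0 : z ≠ 0) :
    z ∈ Complex.slitPlane := by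
  rcases h.lt_or_eq with h | h
  · exact Or.inl h
  · right
    intro him
    exact h0 (Complex.ext h.symm him)

section Glue

variable {u : ℂ} {x : ℝ} {K₁ K₂ : Set ℂ}

theorem StepFn.exists_divFn (hu : u ≠ 0) (h₁ : ∀ z ∈ K₁, (u * z).re ≤ x)
    (h₂ : ∀ z ∈ K₂, x ≤ (u * z).re) {C : Set ℝ} {D : Set ℂ}
    (hC : ∀ y ∈ C, u⁻¹ * (x + y * Complex.I) ∈ D) (hD : ∀ z ∈ D, z ∉ K₁ ∪ K₂)
    {J : ℝ → ℤ} (hJ : StepFn C J) :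
    ∃ p l₁ l₂ : ℂ → ℂ, DivFn D p ∧ ContinuousOn l₁ K₁ ∧ ContinuousOn l₂ K₂ ∧
      (∀ z ∈ K₁, p z = Complex.exp (l₁ z)) ∧ (∀ z ∈ K₂, p z = Complex.exp (l₂ z)) ∧
      ∀ z ∈ K₁ ∩ K₂, l₁ z = l₂ z + 2 * Real.pi * Complex.I * (J (u * z).im : ℤ) := by
  have key : ∀ y ∈ C, ∃ l₁ l₂ : ℂ → ℂ, ContinuousOn l₁ K₁ ∧ ContinuousOn l₂ K₂ ∧
      (∀ z ∈ K₁, z - u⁻¹ * (x + y * Complex.I) = Complex.exp (l₁ z)) ∧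
      (∀ z ∈ K₂, z - u⁻¹ * (x + y * Complex.I) = Complex.exp (l₂ z)) ∧
      ∀ z ∈ K₁ ∩ K₂, l₁ z = l₂ z + 2 * Real.pi * Complex.I *
        ((if (u * z).im < y then 1 else 0 : ℤ) : ℂ) := by
    intro y hy
    set c := u⁻¹ * (x + y * Complex.I) with hc
    have huc : u * c = x + y * Complex.I := by rw [hc]; field_simp
    have hcK := hD _ (hC y hy)
    have s₁ : ∀ z ∈ K₁, -(u * (z - c)) ∈ Complex.slitPlane := by
      intro z hz
      refine Complex.mem_slitPlane_of_re_nonneg ?_ ?_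
      · rw [mul_sub, huc]; simpa using h₁ z hz
      · refine neg_ne_zero.2 (mul_ne_zero hu (sub_ne_zero.2 ?_))
        rintro rfl; exact hcK (Or.inl hz)
    have s₂ : ∀ z ∈ K₂, u * (z - c) ∈ Complex.slitPlane := by
      intro z hz
      refine Complex.mem_slitPlane_of_re_nonneg ?_ ?_
      · rw [mul_sub, huc]; simpa using h₂ z hz
      · refine mul_ne_zero hu (sub_ne_zero.2 ?_)
        rintro rfl; exact hcK (Or.inr hz)
    refine ⟨fun z => Complex.log (-(u * (z - c))) + Real.pi * Complex.I - Complex.log u,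
      fun z => Complex.log (u * (z - c)) - Complex.log u, ?_, ?_, ?_, ?_, ?_⟩
    · exact ((ContinuousOn.clog (by fun_prop) s₁).add continuousOn_const).sub continuousOn_const
    · exact (ContinuousOn.clog (by fun_prop) s₂).sub continuousOn_const
    · intro z hz
      rw [Complex.exp_sub, Complex.exp_add, Complex.exp_log (Complex.slitPlane_ne_zero (s₁ z hz)),
        Complex.exp_log hu, Complex.exp_pi_mul_I]
      field_simp
    · intro z hz
      rw [Complex.exp_sub, Complex.exp_log (Complex.slitPlane_ne_zero (s₂ z hz)),
        Complex.exp_log hu]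
      field_simp
    · intro z hz
      have hre : (u * z).re = x := le_antisymm (h₁ z hz.1) (h₂ z hz.2)
      have hz' : u * (z - c) = ((u * z).im - y : ℝ) * Complex.I := by
        rw [mul_sub, huc]
        conv_lhs => rw [← Complex.re_add_im (u * z), hre]
        push_cast; ring
      rcases lt_trichotomy (u * z).im y with h | h | h
      · have : u * (z - c) = -((y - (u * z).im : ℝ) * Complex.I) := by
          rw [hz']; push_cast; ring
        simp only [this, neg_neg, h, if_true]
        rw [Complex.log_mul_I_of_pos (by linarith), Complex.log_neg_mul_I_of_pos (by linarith)]
        push_cast; ring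
      · exfalso
        have := Complex.slitPlane_ne_zero (s₂ z hz.2)
        rw [hz', h] at this
        simp at this
      · simp only [hz', not_lt.2 h.le, if_false]
        rw [Complex.log_mul_I_of_pos (by linarith), Complex.log_neg_mul_I_of_pos (by linarith)]
        push_cast; ring
  induction hJ with
  | zero =>
    exact ⟨fun _ => 1, fun _ => 0, fun _ => 0, .one, continuousOn_const, continuousOn_const,
      by simp, by simp, by simp⟩
  | up _ hc ih =>
    obtain ⟨p, l₁, l₂, hp, hl₁, hl₂, e₁, e₂, hj⟩ := ih
    obtain ⟨m₁, m₂, hm₁, hm₂, d₁, d₂, hk⟩ := key _ hc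
    refine ⟨_, fun z => l₁ z + m₁ z, fun z => l₂ z + m₂ z, hp.mul (hC _ hc), hl₁.add hm₁,
      hl₂.add hm₂, fun z hz => ?_, fun z hz => ?_, fun z hz => ?_⟩
    · rw [Complex.exp_add, ← e₁ z hz, ← d₁ z hz]
    · rw [Complex.exp_add, ← e₂ z hz, ← d₂ z hz]
    · simp only [hj z hz, hk z hz, Int.cast_add]; ring
  | down _ hc ih =>
    obtain ⟨p, l₁, l₂, hp, hl₁, hl₂, e₁, e₂, hj⟩ := ih
    obtain ⟨m₁, m₂, hm₁, hm₂, d₁, d₂, hk⟩ := key _ hc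
    refine ⟨_, fun z => l₁ z - m₁ z, fun z => l₂ z - m₂ z, hp.div (hC _ hc), hl₁.sub hm₁,
      hl₂.sub hm₂, fun z hz => ?_, fun z hz => ?_, fun z hz => ?_⟩
    · rw [Complex.exp_sub, ← e₁ z hz, ← d₁ z hz, div_eq_mul_inv]
    · rw [Complex.exp_sub, ← e₂ z hz, ← d₂ z hz, div_eq_mul_inv]
    · simp only [hj z hz, hk z hz, Int.cast_sub]; ring

/-- Gluing logarithms along a line, up to a product of linear factors. -/
theorem HasLogOn.glue {q : ℂ → ℂ} (hu : u ≠ 0) {a b : ℝ} (hab : a ≤ b) (hK₁ : IsCompact K₁)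
    (hK₂ : IsCompact K₂) (h₁ : ∀ z ∈ K₁, (u * z).re ≤ x) (h₂ : ∀ z ∈ K₂, x ≤ (u * z).re)
    (hi : ∀ z ∈ K₁ ∪ K₂, (u * z).im ∈ Icc a b)
    (hline : ∀ z ∈ K₁ ∪ K₂, (u * z).re = x → z ∈ K₁ ∩ K₂)
    (hq₁ : HasLogOn q K₁) (hq₂ : HasLogOn q K₂) :
    ∃ p, DivFn {c | (u * c).re = x ∧ (u * c).im ∈ Icc a b ∧ c ∉ K₁ ∪ K₂} p ∧
      HasLogOn (fun z => q z / p z) (K₁ ∪ K₂) := by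
  classical
  obtain ⟨g₁, hg₁, e₁⟩ := hq₁
  obtain ⟨g₂, hg₂, e₂⟩ := hq₂
  set E : Set ℝ := (fun z => (u * z).im) '' (K₁ ∩ K₂) with hE
  have hEc : IsCompact E := (hK₁.inter hK₂).image (by fun_prop)
  set c : ℝ → ℂ := fun y => u⁻¹ * (x + y * Complex.I) with hc
  have huc : ∀ y, u * c y = x + y * Complex.I := fun y => by rw [hc]; field_simp
  have hcz : ∀ z ∈ K₁ ∩ K₂, c (u * z).im = z := by
    intro z hz
    have hre : (u * z).re = x := le_antisymm (h₁ z hz.1) (h₂ z hz.2)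
    apply mul_left_cancel₀ hu
    rw [huc, ← hre, Complex.re_add_im]
  have hcE : ∀ y ∈ E, c y ∈ K₁ ∩ K₂ := by
    rintro _ ⟨z, hz, rfl⟩
    simpa only [hcz z hz] using hz
  have hdiff : ∀ z ∈ K₁ ∩ K₂, ∃ n : ℤ, g₁ z = g₂ z + n * (2 * Real.pi * Complex.I) := fun z hz =>
    Complex.exp_eq_exp_iff_exists_int.1 ((e₁ z hz.1).symm.trans (e₂ z hz.2))
  set d : ℝ → ℝ := fun y => ((g₁ (c y) - g₂ (c y)) / (2 * Real.pi * Complex.I)).re with hd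
  have hpi : (2 * Real.pi * Complex.I : ℂ) ≠ 0 := Complex.two_pi_I_ne_zero
  have hcc : Continuous c := by fun_prop
  have hdc : ContinuousOn d E := by
    refine Complex.continuous_re.comp_continuousOn (ContinuousOn.div_const (ContinuousOn.sub
      (hg₁.comp hcc.continuousOn fun y hy => (hcE y hy).1)
      (hg₂.comp hcc.continuousOn fun y hy => (hcE y hy).2)) _)
  have hdn : ∀ y ∈ E, g₁ (c y) = g₂ (c y) + round (d y) * (2 * Real.pi * Complex.I) ∧
      ((round (d y) : ℤ) : ℝ) = d y := by
    intro y hy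
    obtain ⟨n, hn⟩ := hdiff _ (hcE y hy)
    have : d y = n := by
      rw [hd]
      simp only [hn, add_sub_cancel_left]
      rw [mul_div_assoc, div_self hpi, mul_one, Complex.intCast_re]
    rw [this, round_intCast]
    exact ⟨hn, rfl⟩
  have hnc : ContinuousOn (fun y => round (d y)) E := by
    rw [Int.isClosedEmbedding_coe_real.isInducing.continuousOn_iff]
    exact hdc.congr fun y hy => (hdn y hy).2
  obtain ⟨J, m, hJ, hJm⟩ := exists_stepFn_eq hEc hnc hab
  obtain ⟨p, l₁, l₂, hp, hl₁, hl₂, f₁, f₂, hj⟩ := hJ.exists_divFn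
    (D := {c | (u * c).re = x ∧ (u * c).im ∈ Icc a b ∧ c ∉ K₁ ∪ K₂}) hu h₁ h₂ (by
      intro y hy
      change (u * c y).re = x ∧ (u * c y).im ∈ Icc a b ∧ c y ∉ K₁ ∪ K₂
      have hre : (u * c y).re = x := by rw [huc]; simp
      have him : (u * c y).im = y := by rw [huc]; simp
      refine ⟨hre, by rw [him]; exact hy.1, fun h => hy.2 ?_⟩
      exact ⟨c y, hline _ h hre, him⟩) (fun z hz => hz.2.2)
  refine ⟨p, hp, fun z => if z ∈ K₁ then g₁ z - l₁ z - 2 * Real.pi * Complex.I * m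
    else g₂ z - l₂ z, ?_, ?_⟩
  · refine ContinuousOn.union_of_isClosed ?_ ?_ hK₁.isClosed hK₂.isClosed
    · exact ((hg₁.sub hl₁).sub (continuousOn_const (c := 2 * Real.pi * Complex.I * m))).congr
        fun z hz => by simp [hz]
    · refine (hg₂.sub hl₂).congr fun z hz => ?_
      by_cases hz₁ : z ∈ K₁
      · have hzE : (u * z).im ∈ E := ⟨z, ⟨hz₁, hz⟩, rfl⟩
        have h3 := (hdn _ hzE).1
        rw [hcz z ⟨hz₁, hz⟩, hJm _ ⟨hzE, hi z (Or.inl hz₁)⟩] at h3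
        simp only [hz₁, if_true, Pi.sub_apply]
        rw [h3, hj z ⟨hz₁, hz⟩]
        push_cast; ring
      · simp [hz₁]
  · intro z hz
    by_cases hz₁ : z ∈ K₁
    · simp only [hz₁, if_true]
      rw [Complex.exp_sub, Complex.exp_sub, ← e₁ z hz₁, ← f₁ z hz₁,
        mul_comm (2 * Real.pi * Complex.I) (m : ℂ), Complex.exp_int_mul_two_pi_mul_I, div_one]
    · have hz₂ : z ∈ K₂ := hz.resolve_left hz₁
      simp only [hz₁, if_false]
      rw [Complex.exp_sub, ← e₂ z hz₂, ← f₂ z hz₂]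

end Glue

theorem IsPreconnected.sub_eq_sub_of_exp_eq {X : Type*} [TopologicalSpace X] {K : Set X}
    (hK : IsPreconnected K) {g₁ g₂ : X → ℂ} (h₁ : ContinuousOn g₁ K) (h₂ : ContinuousOn g₂ K)
    (h : ∀ z ∈ K, Complex.exp (g₁ z) = Complex.exp (g₂ z)) {x y : X} (hx : x ∈ K) (hy : y ∈ K) :
    g₁ x - g₁ y = g₂ x - g₂ y := by
  have hn : ∀ z ∈ K, ∃ n : ℤ, g₁ z = g₂ z + n * (2 * Real.pi * Complex.I) := fun z hz =>
    Complex.exp_eq_exp_iff_exists_int.1 (h z hz)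
  have hre : ∀ z ∈ K, ∃ n : ℤ, (n : ℝ) = ((g₁ z - g₂ z) / (2 * Real.pi * Complex.I)).re ∧
      g₁ z = g₂ z + n * (2 * Real.pi * Complex.I) := by
    intro z hz
    obtain ⟨n, e⟩ := hn z hz
    refine ⟨n, ?_, e⟩
    rw [e, add_sub_cancel_left, mul_div_assoc, div_self Complex.two_pi_I_ne_zero, mul_one,
      Complex.intCast_re]
  have key := hK.constant_of_mapsTo Int.isClosedEmbedding_coe_real.isInducing.isDiscrete_range
    (f := fun z => ((g₁ z - g₂ z) / (2 * Real.pi * Complex.I)).re)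
    (Complex.continuous_re.comp_continuousOn ((h₁.sub h₂).div_const _))
    (fun z hz => (hre z hz).imp fun n hn => hn.1) hx hy
  obtain ⟨n, hn₁, hn₂⟩ := hre x hx
  obtain ⟨m, hm₁, hm₂⟩ := hre y hy
  have : (n : ℝ) = m := hn₁.trans (key.trans hm₁.symm)
  have : n = m := by exact_mod_cast this
  subst this
  rw [hn₂, hm₂]
  ring

section Runge

variable {K T₁ T₂ : Set ℂ} {f : ℂ → ℂ}

theorem HasLogOn.merge {u : ℂ} (hu : u ≠ 0) {x a b : ℝ} (hab : a ≤ b) (hK : IsCompact K)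
    (hT₁ : IsClosed T₁) (hT₂ : IsClosed T₂)
    (h₁ : ∀ z ∈ T₁, (u * z).re ≤ x) (h₂ : ∀ z ∈ T₂, x ≤ (u * z).re)
    (hi : ∀ z ∈ T₁ ∪ T₂, (u * z).im ∈ Icc a b)
    (hline : ∀ z, (u * z).re = x → (u * z).im ∈ Icc a b → z ∈ T₁ ∩ T₂)
    (hf₁ : ∃ p, DivFn (T₁ \ K) p ∧ HasLogOn (fun z => f z / p z) (K ∩ T₁))
    (hf₂ : ∃ p, DivFn (T₂ \ K) p ∧ HasLogOn (fun z => f z / p z) (K ∩ T₂)) :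
    ∃ p, DivFn ((T₁ ∪ T₂) \ K) p ∧ HasLogOn (fun z => f z / p z) (K ∩ (T₁ ∪ T₂)) := by
  obtain ⟨p₁, hp₁, l₁⟩ := hf₁
  obtain ⟨p₂, hp₂, l₂⟩ := hf₂
  have m₁ : HasLogOn p₁ (K ∩ T₂) := by
    refine hp₁.hasLogOn fun c hc => HasLogOn.of_mul_slitPlane (by fun_prop) hu fun z hz => ?_
    refine Complex.mem_slitPlane_of_re_nonneg ?_ (mul_ne_zero hu (sub_ne_zero.2 ?_))
    · rw [mul_sub, Complex.sub_re]
      linarith [h₁ c hc.1, h₂ z hz.2]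
    · rintro rfl; exact hc.2 hz.1
  have m₂ : HasLogOn p₂ (K ∩ T₁) := by
    refine hp₂.hasLogOn fun c hc => HasLogOn.of_mul_slitPlane (by fun_prop) (neg_ne_zero.2 hu)
      fun z hz => ?_
    refine Complex.mem_slitPlane_of_re_nonneg ?_
      (mul_ne_zero (neg_ne_zero.2 hu) (sub_ne_zero.2 ?_))
    · rw [neg_mul, mul_sub, Complex.neg_re, Complex.sub_re]
      linarith [h₁ z hz.2, h₂ c hc.1]
    · rintro rfl; exact hc.2 hz.1
  have q₁ : HasLogOn (fun z => f z / (p₁ z * p₂ z)) (K ∩ T₁) :=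
    (l₁.div m₂).congr fun z _ => by rw [div_div]
  have q₂ : HasLogOn (fun z => f z / (p₁ z * p₂ z)) (K ∩ T₂) :=
    (l₂.div m₁).congr fun z _ => by rw [div_div, mul_comm]
  obtain ⟨p, hp, hl⟩ := HasLogOn.glue hu hab (hK.inter_right hT₁) (hK.inter_right hT₂)
    (fun z hz => h₁ z hz.2) (fun z hz => h₂ z hz.2)
    (fun z hz => hi z (hz.imp And.right And.right))
    (fun z hz hx => by
      have hzK : z ∈ K := hz.elim And.left And.left
      obtain ⟨h3, h4⟩ := hline z hx (hi z (hz.imp And.right And.right))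
      exact ⟨⟨hzK, h3⟩, hzK, h4⟩) q₁ q₂
  refine ⟨_, ((hp₁.mono ?_).mul' (hp₂.mono ?_)).mul' (hp.mono ?_), ?_⟩
  · exact fun z hz => ⟨Or.inl hz.1, hz.2⟩
  · exact fun z hz => ⟨Or.inr hz.1, hz.2⟩
  · rintro z ⟨hx, hz, hzK⟩
    have := hline z hx hz
    exact ⟨Or.inl this.1, fun h => hzK (Or.inl ⟨h, this.1⟩)⟩
  · rw [inter_union_distrib_left]
    exact hl.congr fun z _ => by rw [div_div]

/-- Closed rectangles in the complex plane. -/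
def Complex.rect (x₀ x₁ y₀ y₁ : ℝ) : Set ℂ := {z | z.re ∈ Icc x₀ x₁ ∧ z.im ∈ Icc y₀ y₁}

theorem Complex.isClosed_rect (x₀ x₁ y₀ y₁ : ℝ) : IsClosed (Complex.rect x₀ x₁ y₀ y₁) :=
  (isClosed_Icc.preimage Complex.continuous_re).inter (isClosed_Icc.preimage Complex.continuous_im)

/-- A nowhere vanishing continuous function on a compact plane set is the product of an
exponential and of linear factors with poles and zeros outside the compact set. -/
theorem exists_divFn_hasLogOn_div (hK : IsCompact K) (hf : ContinuousOn f K)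
    (h0 : ∀ z ∈ K, f z ≠ 0) : ∃ p, DivFn Kᶜ p ∧ HasLogOn (fun z => f z / p z) K := by
  rcases K.eq_empty_or_nonempty with rfl | hne
  · exact ⟨_, .one, fun _ => 0, by simp, by simp⟩
  obtain ⟨z₀, hz₀, hmin⟩ := hK.exists_isMinOn hne hf.norm
  obtain ⟨ε, hε, hu⟩ := Metric.uniformContinuousOn_iff.1
    (hK.uniformContinuousOn_of_continuous hf) ‖f z₀‖ (norm_pos_iff.2 (h0 z₀ hz₀))
  obtain ⟨R, hR0, hR⟩ := hK.isBounded.exists_pos_norm_le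
  let St : Set ℂ → Prop := fun T => ∃ p, DivFn (T \ K) p ∧ HasLogOn (fun z => f z / p z) (K ∩ T)
  have small : ∀ x₀ x₁ y₀ y₁ : ℝ, x₁ - x₀ < ε / 2 → y₁ - y₀ < ε / 2 →
      St (Complex.rect x₀ x₁ y₀ y₁) := by
    intro x₀ x₁ y₀ y₁ hx hy
    refine ⟨_, .one, ?_⟩
    rcases (K ∩ Complex.rect x₀ x₁ y₀ y₁).eq_empty_or_nonempty with h | ⟨w, hw⟩
    · rw [h]; exact ⟨fun _ => 0, by simp, by simp⟩
    · refine HasLogOn.of_norm_sub_lt (c := f w) ?_ fun z hz => ?_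
      · simpa using hf.mono inter_subset_left
      · rw [div_one, ← dist_eq_norm]
        refine (hu z hz.1 w hw.1 ?_).trans_le (hmin hw.1)
        rw [dist_eq_norm]
        refine (Complex.norm_le_abs_re_add_abs_im _).trans_lt ?_
        obtain ⟨⟨a1, a2⟩, a3, a4⟩ := hz.2
        obtain ⟨⟨b1, b2⟩, b3, b4⟩ := hw.2
        have : |(z - w).re| < ε / 2 := by
          rw [Complex.sub_re, abs_lt]; constructor <;> linarith
        have : |(z - w).im| < ε / 2 := by
          rw [Complex.sub_im, abs_lt]; constructor <;> linarith
        linarith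
  have mergeX : ∀ y₀ y₁ : ℝ, y₀ ≤ y₁ → ∀ x y z : ℝ, x ≤ y → y ≤ z →
      St (Complex.rect x y y₀ y₁) → St (Complex.rect y z y₀ y₁) → St (Complex.rect x z y₀ y₁) := by
    intro y₀ y₁ hy x y z hxy hyz s₁ s₂
    have hun : Complex.rect x z y₀ y₁ = Complex.rect x y y₀ y₁ ∪ Complex.rect y z y₀ y₁ := by
      ext w
      simp only [Complex.rect, mem_ofPred_eq, mem_union, ← Icc_union_Icc_eq_Icc hxy hyz]
      tauto
    rw [hun]
    refine HasLogOn.merge (u := 1) one_ne_zero (x := y) hy hK (Complex.isClosed_rect ..)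
      (Complex.isClosed_rect ..) ?_ ?_ ?_ ?_ s₁ s₂
    · intro w hw; rw [one_mul]; exact hw.1.2
    · intro w hw; rw [one_mul]; exact hw.1.1
    · intro w hw; rw [one_mul]; exact hw.elim And.right And.right
    · intro w h1 h2
      rw [one_mul] at h1 h2
      exact ⟨⟨by rw [h1]; exact ⟨hxy, le_rfl⟩, h2⟩, by rw [h1]; exact ⟨le_rfl, hyz⟩, h2⟩
  have mergeY : ∀ x₀ x₁ : ℝ, x₀ ≤ x₁ → ∀ x y z : ℝ, x ≤ y → y ≤ z →
      St (Complex.rect x₀ x₁ x y) → St (Complex.rect x₀ x₁ y z) → St (Complex.rect x₀ x₁ x z) := by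
    intro x₀ x₁ hx x y z hxy hyz s₁ s₂
    have hun : Complex.rect x₀ x₁ x z = Complex.rect x₀ x₁ x y ∪ Complex.rect x₀ x₁ y z := by
      ext w
      simp only [Complex.rect, mem_ofPred_eq, mem_union, ← Icc_union_Icc_eq_Icc hxy hyz]
      tauto
    have hre : ∀ w : ℂ, (-Complex.I * w).re = w.im := fun w => by simp
    have him : ∀ w : ℂ, (-Complex.I * w).im = - w.re := fun w => by simp
    rw [hun]
    refine HasLogOn.merge (u := -Complex.I) (neg_ne_zero.2 Complex.I_ne_zero) (x := y)
      (neg_le_neg hx) hK (Complex.isClosed_rect ..) (Complex.isClosed_rect ..) ?_ ?_ ?_ ?_ s₁ s₂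
    · intro w hw; rw [hre]; exact hw.2.2
    · intro w hw; rw [hre]; exact hw.2.1
    · intro w hw
      rw [him]
      obtain ⟨h1, h2⟩ := hw.elim And.left And.left
      exact ⟨neg_le_neg h2, neg_le_neg h1⟩
    · intro w h1 h2
      rw [hre] at h1
      rw [him] at h2
      have h3 : w.re ∈ Icc x₀ x₁ := ⟨neg_le_neg_iff.1 h2.2, neg_le_neg_iff.1 h2.1⟩
      exact ⟨⟨h3, by rw [h1]; exact ⟨hxy, le_rfl⟩⟩, h3, by rw [h1]; exact ⟨le_rfl, hyz⟩⟩
  have strip : ∀ y₀ y₁ : ℝ, y₀ ≤ y₁ → y₁ - y₀ < ε / 2 → St (Complex.rect (-R) R y₀ y₁) := by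
    intro y₀ y₁ hy hlt
    exact interval_subdivision (C := fun a b => St (Complex.rect a b y₀ y₁)) (half_pos hε)
      (fun x y _ _ _ h => small x y y₀ y₁ h hlt)
      (fun x y z _ h1 h2 _ => mergeX y₀ y₁ hy x y z h1 h2) (by linarith)
  have all : St (Complex.rect (-R) R (-R) R) :=
    interval_subdivision (C := fun a b => St (Complex.rect (-R) R a b)) (half_pos hε)
      (fun x y _ hxy _ h => strip x y hxy h)
      (fun x y z _ h1 h2 _ => mergeY (-R) R (by linarith) x y z h1 h2) (by linarith)
  obtain ⟨p, hp, hl⟩ := all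
  refine ⟨p, hp.mono fun z hz => hz.2, hl.mono fun z hz => ⟨hz, ?_, ?_⟩⟩
  · exact abs_le.1 ((Complex.abs_re_le_norm z).trans (hR z hz))
  · exact abs_le.1 ((Complex.abs_im_le_norm z).trans (hR z hz))

end Runge

theorem IsPreconnected.of_locally_constant {X : Type*} [TopologicalSpace X] {Y : Set X}
    (hY : IsPreconnected Y) {P : X → Prop} (hP : ∀ d ∈ Y, ∀ᶠ e in 𝓝 d, (P e ↔ P d)) {c d : X}
    (hd : d ∈ Y) (hc : c ∈ Y) (h : P d) : P c := by
  by_contra hcon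
  obtain ⟨x, -, hx₁, hx₂⟩ := hY (interior {e | P e}) (interior {e | ¬ P e}) isOpen_interior
    isOpen_interior (fun e he => by
      by_cases h : P e
      · exact Or.inl (mem_interior_iff_mem_nhds.2 ((hP e he).mono fun x hx => hx.2 h))
      · exact Or.inr (mem_interior_iff_mem_nhds.2 ((hP e he).mono fun x hx h' => h (hx.1 h'))))
    ⟨d, hd, mem_interior_iff_mem_nhds.2 ((hP d hd).mono fun x hx => hx.2 h)⟩
    ⟨c, hc, mem_interior_iff_mem_nhds.2 ((hP c hc).mono fun x hx h' => hcon (hx.1 h'))⟩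
  exact interior_subset hx₂ (interior_subset hx₁)

/-! ### Points that can be joined to infinity -/

/-- `c` can be joined to infinity outside `K`. -/
def Escapes (K : Set ℂ) (c : ℂ) : Prop :=
  ∃ Y : Set ℂ, IsPreconnected Y ∧ c ∈ Y ∧ Disjoint Y K ∧ ¬ Bornology.IsBounded Y

theorem Escapes.mono {K L : Set ℂ} {c : ℂ} (h : Escapes K c) (hL : L ⊆ K) : Escapes L c := by
  obtain ⟨Y, h1, h2, h3, h4⟩ := h
  exact ⟨Y, h1, h2, h3.mono_right hL, h4⟩

theorem Escapes.trans {K Z : Set ℂ} {c d : ℂ} (h : Escapes K d) (hZ : IsPreconnected Z)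
    (hd : d ∈ Z) (hc : c ∈ Z) (hZK : Disjoint Z K) : Escapes K c := by
  obtain ⟨Y, h1, h2, h3, h4⟩ := h
  refine ⟨Z ∪ Y, hZ.union d hd h2 h1, Or.inl hc, hZK.union_left h3, fun hb => h4 ?_⟩
  exact hb.subset subset_union_right

theorem Escapes.notMem {K : Set ℂ} {c : ℂ} (h : Escapes K c) : c ∉ K := by
  obtain ⟨Y, _, h2, h3, _⟩ := h
  exact disjoint_left.1 h3 h2

theorem Escapes.hasLogOn {K : Set ℂ} (hK : IsCompact K) {c : ℂ} (h : Escapes K c) :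
    HasLogOn (fun z => z - c) K := by
  obtain ⟨Y, hY, hcY, hYK, hYb⟩ := h
  obtain ⟨R, hR0, hR⟩ := hK.isBounded.exists_pos_norm_le
  have local_const : ∀ d ∈ Y, ∀ᶠ e in 𝓝 d,
      (HasLogOn (fun z => z - e) K ↔ HasLogOn (fun z => z - d) K) := by
    intro d hd
    have hdK : d ∈ Kᶜ := disjoint_left.1 hYK hd
    obtain ⟨r, hr, hball⟩ := Metric.isOpen_iff.1 hK.isClosed.isOpen_compl d hdK
    filter_upwards [Metric.ball_mem_nhds d (half_pos hr)] with e he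
    have hdist : ∀ z ∈ K, r ≤ ‖z - d‖ := by
      intro z hz
      by_contra! hlt
      exact hball (by rwa [Metric.mem_ball, dist_eq_norm]) hz
    have hne : ∀ z ∈ K, z - d ≠ 0 := fun z hz h => by
      have := hdist z hz
      rw [h, norm_zero] at this
      linarith
    have hed : ‖e - d‖ < r / 2 := by rwa [← dist_eq_norm]
    have hne' : ∀ z ∈ K, z - e ≠ 0 := fun z hz h => by
      have h1 := hdist z hz
      have h2 : z - d = e - d := by rw [sub_eq_zero.1 h]
      rw [h2] at h1
      linarith
    have hq : HasLogOn (fun z => (z - e) / (z - d)) K := by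
      refine HasLogOn.of_norm_sub_lt (c := 1)
        (ContinuousOn.div (by fun_prop) (by fun_prop) hne) fun z hz => ?_
      have : (z - e) / (z - d) - 1 = (d - e) / (z - d) := by
        have := hne z hz
        field_simp; ring
      rw [this, norm_div, norm_one, div_lt_one (norm_pos_iff.2 (hne z hz)), norm_sub_rev]
      linarith [hdist z hz]
    constructor
    · intro h
      refine (h.div hq).congr fun z hz => ?_
      have := hne z hz
      have := hne' z hz
      field_simp
    · intro h
      refine (h.mul hq).congr fun z hz => ?_
      have := hne z hz
      field_simp
  by_contra hcon
  have hbig : ∀ d, R < ‖d‖ → HasLogOn (fun z => z - d) K := by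
    intro d hd
    refine HasLogOn.of_norm_sub_lt (c := -d) (by fun_prop) fun z hz => ?_
    rw [sub_neg_eq_add, sub_add_cancel, norm_neg]
    exact (hR z hz).trans_lt hd
  have hex : ∃ d ∈ Y, R < ‖d‖ := by
    by_contra! hall
    exact hYb (isBounded_iff_forall_norm_le.2 ⟨R, hall⟩)
  obtain ⟨d, hdY, hd⟩ := hex
  exact hcon (hY.of_locally_constant local_const hdY hcY (hbig d hd))

/-- A nowhere vanishing continuous function on a compact set which does not separate the plane
has a logarithm. -/
theorem HasLogOn.of_forall_escapes {K : Set ℂ} (hK : IsCompact K) (h : ∀ c ∉ K, Escapes K c)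
    {f : ℂ → ℂ} (hf : ContinuousOn f K) (h0 : ∀ z ∈ K, f z ≠ 0) : HasLogOn f K := by
  obtain ⟨p, hp, hl⟩ := exists_divFn_hasLogOn_div hK hf h0
  obtain ⟨u, hu, hpu⟩ := hp.hasLogOn fun c hc => (h c hc).hasLogOn hK
  refine (hl.mul ⟨u, hu, hpu⟩).congr fun z hz => ?_
  have : p z ≠ 0 := by rw [hpu z hz]; exact Complex.exp_ne_zero _
  field_simp

/-- The union of a plane set with the bounded pieces of its complement. -/
def planeFill (Q : Set ℂ) : Set ℂ := {c | ¬ Escapes Q c}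

theorem subset_planeFill (Q : Set ℂ) : Q ⊆ planeFill Q := fun _ hc h => h.notMem hc

theorem escapes_locally {Q : Set ℂ} (hQ : IsCompact Q) {c : ℂ} (hc : c ∉ Q) :
    ∀ᶠ e in 𝓝 c, (Escapes Q e ↔ Escapes Q c) := by
  obtain ⟨r, hr, hball⟩ := Metric.isOpen_iff.1 hQ.isClosed.isOpen_compl c hc
  have hd : Disjoint (Metric.ball c r) Q := disjoint_left.2 hball
  have hpc := (convex_ball c r).isPreconnected
  filter_upwards [Metric.ball_mem_nhds c hr] with e he
  exact ⟨fun h => h.trans hpc he (Metric.mem_ball_self hr) hd,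
    fun h => h.trans hpc (Metric.mem_ball_self hr) he hd⟩

theorem isClosed_planeFill {Q : Set ℂ} (hQ : IsCompact Q) : IsClosed (planeFill Q) := by
  rw [← isOpen_compl_iff, isOpen_iff_mem_nhds]
  intro c hc
  have hc : Escapes Q c := not_not.1 hc
  filter_upwards [escapes_locally hQ hc.notMem] with e he
  exact not_not.2 (he.2 hc)

theorem frontier_planeFill_subset {Q : Set ℂ} (hQ : IsCompact Q) : frontier (planeFill Q) ⊆ Q := by
  intro c hc
  by_contra hcQ
  by_cases h : Escapes Q c
  · have h1 : c ∈ planeFill Q := (isClosed_planeFill hQ).frontier_subset hc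
    exact h1 h
  · refine hc.2 (mem_interior_iff_mem_nhds.2 ?_)
    filter_upwards [escapes_locally hQ hcQ] with e he
    exact fun h' => h (he.1 h')

/-- Points outside the filling escape from the filling. -/
theorem Escapes.planeFill {Q : Set ℂ} {c : ℂ} (h : Escapes Q c) : Escapes (planeFill Q) c := by
  obtain ⟨Y, h1, h2, h3, h4⟩ := h
  exact ⟨Y, h1, h2, disjoint_left.2 fun d hd hd' => hd' ⟨Y, h1, hd, h3, h4⟩, h4⟩

theorem escapes_of_ray {Q : Set ℂ} {z₀ c : ℂ} (hc : c ≠ z₀)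
    (h : ∀ t : ℝ, 1 ≤ t → z₀ + t * (c - z₀) ∉ Q) : Escapes Q c := by
  refine ⟨(fun t : ℝ => z₀ + t * (c - z₀)) '' Ici 1, isPreconnected_Ici.image _ (by fun_prop),
    ⟨1, self_mem_Ici, by simp⟩, disjoint_left.2 ?_, fun hb => ?_⟩
  · rintro _ ⟨t, ht, rfl⟩
    exact h t ht
  · obtain ⟨R, hR⟩ := isBounded_iff_forall_norm_le.1 hb
    have hc' := norm_pos_iff.2 (sub_ne_zero.2 hc)
    have h1 := hR _ ⟨(|R| + ‖z₀‖) / ‖c - z₀‖ + 1, by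
      simp only [mem_Ici]
      linarith [div_nonneg (add_nonneg (abs_nonneg R) (norm_nonneg z₀)) hc'.le], rfl⟩
    have h2 := norm_sub_le (z₀ + (((|R| + ‖z₀‖) / ‖c - z₀‖ + 1 : ℝ) : ℂ) * (c - z₀)) z₀
    rw [add_sub_cancel_left, norm_mul, Complex.norm_real, Real.norm_eq_abs,
      abs_of_nonneg (by positivity), add_mul, div_mul_cancel₀ _ hc'.ne'] at h2
    linarith [le_abs_self R]

theorem HasLogOn.of_convex {K : Set ℂ} (hK : IsCompact K) (hc : Convex ℝ K) {f : ℂ → ℂ}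
    (hf : ContinuousOn f K) (h0 : ∀ z ∈ K, f z ≠ 0) : HasLogOn f K := by
  rcases K.eq_empty_or_nonempty with rfl | ⟨z₀, hz₀⟩
  · exact ⟨fun _ => 0, by simp, by simp⟩
  refine HasLogOn.of_forall_escapes hK (fun c hcK => ?_) hf h0
  refine escapes_of_ray (z₀ := z₀) (fun h => hcK (h ▸ hz₀)) fun t ht htK => hcK ?_
  have := hc.add_smul_sub_mem hz₀ htK (t := t⁻¹) ⟨by positivity, inv_le_one_of_one_le₀ ht⟩
  rwa [add_sub_cancel_left, Complex.real_smul, Complex.ofReal_inv, inv_mul_cancel_left₀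
    (Complex.ofReal_ne_zero.2 (by positivity)), add_sub_cancel] at this

theorem planeFill_subset_of_starConvex {Q C : Set ℂ} (hC : StarConvex ℝ 0 C) (h0 : (0 : ℂ) ∈ C)
    (hQ : Q ⊆ C) : planeFill Q ⊆ C := by
  intro c hc
  by_contra hcC
  refine hc (escapes_of_ray (z₀ := 0) (fun h => hcC (h ▸ h0)) fun t ht htQ => hcC ?_)
  rw [zero_add, sub_zero] at htQ
  have := hC.smul_mem (hQ htQ) (t := t⁻¹) (by positivity) (inv_le_one_of_one_le₀ ht)
  rwa [Complex.real_smul, Complex.ofReal_inv, inv_mul_cancel_left₀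
    (Complex.ofReal_ne_zero.2 (by positivity))] at this

theorem isCompact_planeFill {Q : Set ℂ} (hQ : IsCompact Q) : IsCompact (planeFill Q) := by
  obtain ⟨R, hR0, hR⟩ := hQ.isBounded.exists_pos_norm_le
  refine Metric.isCompact_of_isClosed_isBounded (isClosed_planeFill hQ)
    ((Metric.isBounded_closedBall (x := (0 : ℂ)) (r := R)).subset ?_)
  refine planeFill_subset_of_starConvex ((convex_closedBall (0 : ℂ) R).starConvex
    (Metric.mem_closedBall_self hR0.le)) (Metric.mem_closedBall_self hR0.le) fun z hz => ?_
  simpa using hR z hz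

/-- Two plane arcs meeting exactly in their endpoints enclose some point. -/
theorem exists_not_escapes_of_arcs {p q : ℝ → ℂ} (hp : ContinuousOn p (Icc 0 1))
    (hq : ContinuousOn q (Icc 0 1)) (hpi : InjOn p (Icc 0 1)) (hqi : InjOn q (Icc 0 1))
    (h0 : p 0 = q 0) (h1 : p 1 = q 1)
    (hpq : ∀ s ∈ Icc (0 : ℝ) 1, ∀ t ∈ Icc (0 : ℝ) 1, p s = q t → (s = 0 ∧ t = 0) ∨ (s = 1 ∧ t = 1)) :
    ∃ c, c ∉ p '' Icc 0 1 ∪ q '' Icc 0 1 ∧ ¬ Escapes (p '' Icc 0 1 ∪ q '' Icc 0 1) c := by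
  classical
  by_contra! hcon
  have hP := isCompact_Icc.image_of_continuousOn hp
  have hQ := isCompact_Icc.image_of_continuousOn hq
  set φ := invFunOn p (Icc (0 : ℝ) 1) with hφ
  set ψ := invFunOn q (Icc (0 : ℝ) 1) with hψ
  have hφp : ∀ t ∈ Icc (0 : ℝ) 1, φ (p t) = t := fun t ht => hpi.leftInvOn_invFunOn ht
  have hψq : ∀ t ∈ Icc (0 : ℝ) 1, ψ (q t) = t := fun t ht => hqi.leftInvOn_invFunOn ht
  have inv_cont : ∀ {r : ℝ → ℂ} {χ : ℂ → ℝ}, ContinuousOn r (Icc 0 1) →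
      (∀ t ∈ Icc (0 : ℝ) 1, χ (r t) = t) → ContinuousOn χ (r '' Icc 0 1) := by
    intro r χ hr hχ
    rw [continuousOn_iff_isClosed]
    intro t ht
    refine ⟨r '' (Icc 0 1 ∩ t), ?_, ?_⟩
    · exact ((isCompact_Icc.inter_right ht).image_of_continuousOn
        (hr.mono inter_subset_left)).isClosed
    · ext z
      constructor
      · rintro ⟨hz, s, hs, rfl⟩
        rw [mem_preimage, hχ s hs] at hz
        exact ⟨⟨s, ⟨hs, hz⟩, rfl⟩, s, hs, rfl⟩
      · rintro ⟨⟨s, ⟨hs, hz⟩, rfl⟩, -⟩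
        exact ⟨by rwa [mem_preimage, hχ s hs], s, hs, rfl⟩
  have hφc := inv_cont hp hφp
  have hψc := inv_cont hq hψq
  set f : ℂ → ℂ := fun z => if z ∈ p '' Icc 0 1 then Complex.exp (Real.pi * Complex.I * φ z)
    else Complex.exp (-(Real.pi * Complex.I * ψ z)) with hf
  have hfp : ∀ t ∈ Icc (0 : ℝ) 1, f (p t) = Complex.exp (Real.pi * Complex.I * t) := by
    intro t ht
    have : p t ∈ p '' Icc 0 1 := mem_image_of_mem p ht
    simp only [hf, this, if_true, hφp t ht]
  have hfq : ∀ t ∈ Icc (0 : ℝ) 1, f (q t) = Complex.exp (-(Real.pi * Complex.I * t)) := by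
    intro t ht
    by_cases h : q t ∈ p '' Icc 0 1
    · obtain ⟨s, hs, hst⟩ := h
      rcases hpq s hs t ht hst with ⟨rfl, rfl⟩ | ⟨rfl, rfl⟩
      · rw [← hst, hfp _ hs]; simp
      · rw [← hst, hfp _ hs]; simp [Complex.exp_neg, Complex.exp_pi_mul_I, inv_neg]
    · simp only [hf, h, if_false, hψq t ht]
  have hfc : ContinuousOn f (p '' Icc 0 1 ∪ q '' Icc 0 1) := by
    refine ContinuousOn.union_of_isClosed ?_ ?_ hP.isClosed hQ.isClosed
    · refine ContinuousOn.congr (f := fun z => Complex.exp (Real.pi * Complex.I * φ z)) ?_ ?_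
      · have := Complex.continuous_ofReal.comp_continuousOn hφc
        exact (continuousOn_const.mul this).cexp
      · rintro _ ⟨t, ht, rfl⟩
        simp only [hfp t ht, hφp t ht]
    · refine ContinuousOn.congr (f := fun z => Complex.exp (-(Real.pi * Complex.I * ψ z))) ?_ ?_
      · have := Complex.continuous_ofReal.comp_continuousOn hψc
        exact (continuousOn_const.mul this).neg.cexp
      · rintro _ ⟨t, ht, rfl⟩
        simp only [hfq t ht, hψq t ht]
  obtain ⟨g, hg, hgf⟩ := HasLogOn.of_forall_escapes (hP.union hQ) hcon hfc (fun z hz => by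
    simp only [hf]; split_ifs <;> exact Complex.exp_ne_zero _)
  have incr : ∀ {r : ℝ → ℂ} {w : ℂ}, ContinuousOn r (Icc 0 1) → (∀ t ∈ Icc (0 : ℝ) 1,
      r t ∈ p '' Icc 0 1 ∪ q '' Icc 0 1 ∧ f (r t) = Complex.exp (w * t)) →
      g (r 1) - g (r 0) = w := by
    intro r w hr hrf
    have := isPreconnected_Icc.sub_eq_sub_of_exp_eq (g₁ := fun t => g (r t))
      (g₂ := fun t : ℝ => w * t) (hg.comp hr fun t ht => (hrf t ht).1) (by fun_prop)
      (fun t ht => (hgf _ (hrf t ht).1).symm.trans (hrf t ht).2)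
      (right_mem_Icc.2 zero_le_one) (left_mem_Icc.2 zero_le_one)
    simpa using this
  have e1 := incr hp fun t ht => ⟨Or.inl (mem_image_of_mem p ht), hfp t ht⟩
  have e2 := incr (w := -(Real.pi * Complex.I)) hq fun t ht =>
    ⟨Or.inr (mem_image_of_mem q ht), by rw [hfq t ht, neg_mul]⟩
  rw [h0, h1, e2] at e1
  have : (Real.pi * Complex.I : ℂ) ≠ 0 := by simp [Real.pi_ne_zero]
  apply this
  linear_combination (-1/2 : ℂ) * e1

theorem HasLogOn.of_prod_Icc {f : ℝ × ℝ → ℂ} {a b c d : ℝ}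
    (hf : ContinuousOn f (Icc a b ×ˢ Icc c d)) (h0 : ∀ z ∈ Icc a b ×ˢ Icc c d, f z ≠ 0) :
    HasLogOn f (Icc a b ×ˢ Icc c d) := by
  have hK : Complex.equivRealProdCLM.symm '' (Icc a b ×ˢ Icc c d) =
      Complex.equivRealProdCLM ⁻¹' (Icc a b ×ˢ Icc c d) :=
    Complex.equivRealProdCLM.symm.image_eq_preimage_symm _
  have hmaps : MapsTo Complex.equivRealProdCLM
      (Complex.equivRealProdCLM.symm '' (Icc a b ×ˢ Icc c d)) (Icc a b ×ˢ Icc c d) := by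
    rw [hK]; exact fun z hz => hz
  have h := HasLogOn.of_convex
    ((isCompact_Icc.prod isCompact_Icc).image Complex.equivRealProdCLM.symm.continuous)
    (((convex_Icc a b).prod (convex_Icc c d)).linear_image
      Complex.equivRealProdCLM.symm.toLinearMap)
    (f := fun z => f (Complex.equivRealProdCLM z))
    (hf.comp Complex.equivRealProdCLM.continuous.continuousOn hmaps)
    (fun z hz => h0 _ (hmaps hz))
  refine (h.comp (φ := Complex.equivRealProdCLM.symm) (M := Icc a b ×ˢ Icc c d)
    Complex.equivRealProdCLM.symm.continuous.continuousOn (mapsTo_image _ _)).congr ?_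
  intro z _
  simp only [ContinuousLinearEquiv.apply_symm_apply]

theorem HasLogOn.of_Icc {f : ℝ → ℂ} {a b : ℝ}
    (hf : ContinuousOn f (Icc a b)) (h0 : ∀ z ∈ Icc a b, f z ≠ 0) : HasLogOn f (Icc a b) := by
  have h := HasLogOn.of_prod_Icc (f := fun z : ℝ × ℝ => f z.1) (a := a) (b := b) (c := 0) (d := 0)
    (hf.comp continuous_fst.continuousOn fun z hz => hz.1) (fun z hz => h0 _ hz.1)
  exact (h.comp (φ := fun x => (x, (0 : ℝ))) (M := Icc a b) (by fun_prop)
    fun x hx => ⟨hx, by simp⟩)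

/-- The increment along `[a, b]` of a continuous logarithm of `f`. -/
def logInc (f : ℝ → ℂ) (a b : ℝ) : ℂ :=
  open Classical in
  if h : HasLogOn f (uIcc a b) then h.choose b - h.choose a else 0

theorem logInc_eq {f g : ℝ → ℂ} {a b : ℝ} (hg : ContinuousOn g (uIcc a b))
    (h : ∀ z ∈ uIcc a b, f z = Complex.exp (g z)) : logInc f a b = g b - g a := by
  have hf : HasLogOn f (uIcc a b) := ⟨g, hg, h⟩
  rw [logInc, dif_pos hf]
  exact isPreconnected_uIcc.sub_eq_sub_of_exp_eq hf.choose_spec.1 hg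
    (fun z hz => (hf.choose_spec.2 z hz).symm.trans (h z hz)) right_mem_uIcc left_mem_uIcc

theorem logInc_congr {f g : ℝ → ℂ} {a b : ℝ} (h : ∀ z ∈ uIcc a b, f z = g z) :
    logInc f a b = logInc g a b := by
  by_cases hg : HasLogOn g (uIcc a b)
  · obtain ⟨u, hu, e⟩ := hg
    rw [logInc_eq hu e, logInc_eq hu fun z hz => (h z hz).trans (e z hz)]
  · have hf : ¬ HasLogOn f (uIcc a b) := fun hf => hg (hf.congr fun z hz => (h z hz).symm)
    rw [logInc, logInc, dif_neg hf, dif_neg hg]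

theorem logInc_neg (f : ℝ → ℂ) (a b : ℝ) : logInc (fun t => -f t) a b = logInc f a b := by
  by_cases hf : HasLogOn f (uIcc a b)
  · obtain ⟨u, hu, e⟩ := hf
    rw [logInc_eq hu e, logInc_eq (f := fun t => -f t) (g := fun t => u t + Real.pi * Complex.I)
      (hu.add continuousOn_const) fun z hz => by
        rw [Complex.exp_add, Complex.exp_pi_mul_I, e z hz]; ring]
    ring
  · have hf' : ¬ HasLogOn (fun t => -f t) (uIcc a b) := fun ⟨u, hu, e⟩ =>
      hf ⟨fun t => u t + Real.pi * Complex.I, hu.add continuousOn_const, fun z hz => by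
        rw [Complex.exp_add, Complex.exp_pi_mul_I, ← e z hz]; ring⟩
    rw [logInc, logInc, dif_neg hf, dif_neg hf']

theorem logInc_add {f : ℝ → ℂ} {a b c : ℝ} (hab : a ≤ b) (hbc : b ≤ c)
    (hf : ContinuousOn f (Icc a c)) (h0 : ∀ z ∈ Icc a c, f z ≠ 0) :
    logInc f a b + logInc f b c = logInc f a c := by
  obtain ⟨u, hu, e⟩ := HasLogOn.of_Icc hf h0
  have s₁ : uIcc a b ⊆ Icc a c := by rw [uIcc_of_le hab]; exact Icc_subset_Icc_right hbc
  have s₂ : uIcc b c ⊆ Icc a c := by rw [uIcc_of_le hbc]; exact Icc_subset_Icc_left hab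
  have s₃ : uIcc a c ⊆ Icc a c := by rw [uIcc_of_le (hab.trans hbc)]
  have h₁ := logInc_eq (hu.mono s₁) fun z hz => e z (s₁ hz)
  have h₂ := logInc_eq (hu.mono s₂) fun z hz => e z (s₂ hz)
  have h₃ := logInc_eq (hu.mono s₃) fun z hz => e z (s₃ hz)
  rw [h₁, h₂, h₃]
  ring

/-- The increment of the logarithm of `D` along the boundary of a rectangle. -/
def boundaryInc (D : ℝ × ℝ → ℂ) (a b c d : ℝ) : ℂ :=
  logInc (fun t => D (t, c)) a b + logInc (fun s => D (b, s)) c d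
    - logInc (fun t => D (t, d)) a b - logInc (fun s => D (a, s)) c d

section Square

variable {D : ℝ × ℝ → ℂ} {a b c d : ℝ}

theorem boundaryInc_congr {E : ℝ × ℝ → ℂ} (hab : a ≤ b) (hcd : c ≤ d)
    (h : ∀ z ∈ Icc a b ×ˢ Icc c d, D z = E z) : boundaryInc D a b c d = boundaryInc E a b c d := by
  have ht : ∀ s ∈ Icc c d, logInc (fun t => D (t, s)) a b = logInc (fun t => E (t, s)) a b :=
    fun s hs => logInc_congr fun t ht => h _ ⟨by rwa [uIcc_of_le hab] at ht, hs⟩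
  have hs : ∀ t ∈ Icc a b, logInc (fun s => D (t, s)) c d = logInc (fun s => E (t, s)) c d :=
    fun t ht => logInc_congr fun s hs => h _ ⟨ht, by rwa [uIcc_of_le hcd] at hs⟩
  rw [boundaryInc, boundaryInc, ht _ (left_mem_Icc.2 hcd), ht _ (right_mem_Icc.2 hcd),
    hs _ (left_mem_Icc.2 hab), hs _ (right_mem_Icc.2 hab)]

theorem boundaryInc_eq_zero (hab : a ≤ b) (hcd : c ≤ d)
    (hD : ContinuousOn D (Icc a b ×ˢ Icc c d)) (h0 : ∀ z ∈ Icc a b ×ˢ Icc c d, D z ≠ 0) :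
    boundaryInc D a b c d = 0 := by
  obtain ⟨u, hu, e⟩ := HasLogOn.of_prod_Icc hD h0
  have ht : ∀ s ∈ Icc c d, logInc (fun t => D (t, s)) a b = u (b, s) - u (a, s) := fun s hs =>
    logInc_eq (f := fun t => D (t, s)) (g := fun t => u (t, s))
      (hu.comp (by fun_prop) fun t ht => ⟨by rwa [uIcc_of_le hab] at ht, hs⟩)
      fun t ht => e _ ⟨by rwa [uIcc_of_le hab] at ht, hs⟩
  have hs : ∀ t ∈ Icc a b, logInc (fun s => D (t, s)) c d = u (t, d) - u (t, c) := fun t ht =>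
    logInc_eq (f := fun s => D (t, s)) (g := fun s => u (t, s))
      (hu.comp (by fun_prop) fun s hs => ⟨ht, by rwa [uIcc_of_le hcd] at hs⟩)
      fun s hs => e _ ⟨ht, by rwa [uIcc_of_le hcd] at hs⟩
  rw [boundaryInc, ht _ (left_mem_Icc.2 hcd), ht _ (right_mem_Icc.2 hcd),
    hs _ (left_mem_Icc.2 hab), hs _ (right_mem_Icc.2 hab)]
  ring

theorem logInc_diagonal (hab : a ≤ b) (hD : ContinuousOn D (Icc a b ×ˢ Icc a b))
    (h0 : ∀ z ∈ Icc a b ×ˢ Icc a b, D z ≠ 0) :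
    logInc (fun t => D (t, t)) a b = logInc (fun t => D (t, a)) a b + logInc (fun s => D (b, s)) a b := by
  obtain ⟨u, hu, e⟩ := HasLogOn.of_prod_Icc hD h0
  have huab := uIcc_of_le hab
  have ha := left_mem_Icc.2 hab
  have hb := right_mem_Icc.2 hab
  rw [logInc_eq (f := fun t => D (t, t)) (g := fun t => u (t, t))
      (hu.comp (by fun_prop) fun t ht => by rw [huab] at ht; exact ⟨ht, ht⟩)
      (fun t ht => e _ (by rw [huab] at ht; exact ⟨ht, ht⟩)),
    logInc_eq (f := fun t => D (t, a)) (g := fun t => u (t, a))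
      (hu.comp (by fun_prop) fun t ht => by rw [huab] at ht; exact ⟨ht, ha⟩)
      (fun t ht => e _ (by rw [huab] at ht; exact ⟨ht, ha⟩)),
    logInc_eq (f := fun t => D (b, t)) (g := fun t => u (b, t))
      (hu.comp (by fun_prop) fun t ht => by rw [huab] at ht; exact ⟨hb, ht⟩)
      (fun t ht => e _ (by rw [huab] at ht; exact ⟨hb, ht⟩))]
  ring

theorem boundaryInc_add_left {m : ℝ} (ham : a ≤ m) (hmb : m ≤ b) (hcd : c ≤ d)
    (hD : ContinuousOn D (Icc a b ×ˢ Icc c d)) (h1 : ∀ t ∈ Icc a b, D (t, c) ≠ 0)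
    (h2 : ∀ t ∈ Icc a b, D (t, d) ≠ 0) :
    boundaryInc D a b c d = boundaryInc D a m c d + boundaryInc D m b c d := by
  unfold boundaryInc
  rw [← logInc_add (f := fun t => D (t, c)) ham hmb
      (hD.comp (by fun_prop) fun t ht => ⟨ht, left_mem_Icc.2 hcd⟩) h1,
    ← logInc_add (f := fun t => D (t, d)) ham hmb
      (hD.comp (by fun_prop) fun t ht => ⟨ht, right_mem_Icc.2 hcd⟩) h2]
  ring

theorem boundaryInc_add_right {m : ℝ} (hab : a ≤ b) (hcm : c ≤ m) (hmd : m ≤ d)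
    (hD : ContinuousOn D (Icc a b ×ˢ Icc c d)) (h1 : ∀ s ∈ Icc c d, D (a, s) ≠ 0)
    (h2 : ∀ s ∈ Icc c d, D (b, s) ≠ 0) :
    boundaryInc D a b c d = boundaryInc D a b c m + boundaryInc D a b m d := by
  unfold boundaryInc
  rw [← logInc_add (f := fun t => D (a, t)) hcm hmd
      (hD.comp (by fun_prop) fun t ht => ⟨left_mem_Icc.2 hab, ht⟩) h1,
    ← logInc_add (f := fun t => D (b, t)) hcm hmd
      (hD.comp (by fun_prop) fun t ht => ⟨right_mem_Icc.2 hab, ht⟩) h2]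
  ring

end Square

/-- Sum of the increments around a closed quadrilateral. -/
theorem HasLogOn.sum_logInc_eq_zero {γ : Fin 4 → ℝ → ℂ} (hγ : ∀ k, ContinuousOn (γ k) (Icc 0 1))
    (hc : ∀ k, γ k 1 = γ (k + 1) 0) {f : ℂ → ℂ} {v : Fin 4 → ℝ → ℂ}
    (hf : HasLogOn f (⋃ k, γ k '' Icc 0 1))
    (hv : ∀ k, ∀ t ∈ Icc (0 : ℝ) 1, v k t = f (γ k t)) :
    logInc (v 0) 0 1 + logInc (v 1) 0 1 + logInc (v 2) 0 1 + logInc (v 3) 0 1 = 0 := by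
  obtain ⟨u, hu, e⟩ := hf
  have hm : ∀ k, ∀ t ∈ Icc (0 : ℝ) 1, γ k t ∈ ⋃ k, γ k '' Icc (0 : ℝ) 1 := fun k t ht =>
    mem_iUnion.2 ⟨k, t, ht, rfl⟩
  have h01 : uIcc (0 : ℝ) 1 = Icc 0 1 := uIcc_of_le zero_le_one
  have key : ∀ k, logInc (v k) 0 1 = u (γ k 1) - u (γ k 0) := fun k =>
    logInc_eq (g := fun t => u (γ k t)) (by rw [h01]; exact hu.comp (hγ k) (hm k))
      (by rw [h01]; exact fun t ht => (hv k t ht).trans (e _ (hm k t ht)))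
  rw [key, key, key, key, hc, hc, hc, hc]
  change u (γ 1 0) - _ + (u (γ 2 0) - _) + (u (γ 3 0) - _) + (u (γ 0 0) - _) = 0
  ring

/-- An index computation: two quadrilaterals `γ`, `Γ` whose sides meet in a prescribed
combinatorial pattern. -/
theorem boundaryInc_eq_zero_of_quadrilaterals {γ Γ : Fin 4 → ℝ → ℂ}
    (hγ : ∀ k, ContinuousOn (γ k) (Icc 0 1)) (hΓ : ∀ k, ContinuousOn (Γ k) (Icc 0 1))
    (hγc : ∀ k, γ k 1 = γ (k + 1) 0) (hΓc : ∀ k, Γ k 1 = Γ (k + 1) 0)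
    (hdisj : ∀ k l : Fin 4, l ≤ k → ¬ (k = 2 ∧ l = 1) → ∀ t ∈ Icc (0 : ℝ) 1, ∀ s ∈ Icc (0 : ℝ) 1,
      Γ l s ≠ γ k t)
    {f : ℂ → ℂ} (hf : HasLogOn f (⋃ k, γ k '' Icc 0 1))
    (hfv : ∀ k, ∀ t ∈ Icc (0 : ℝ) 1, Γ k t - γ k t = f (γ k t))
    (h₁ : HasLogOn (fun z => z - Γ 0 0) (⋃ k, γ k '' Icc 0 1))
    (h₂ : HasLogOn (fun z => z - γ 0 0) (⋃ k, Γ k '' Icc 0 1)) :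
    boundaryInc (fun z => Γ 1 z.2 - γ 2 z.1) 0 1 0 1 = 0 := by
  have hcont : ∀ k l, ContinuousOn (fun z : ℝ × ℝ => Γ l z.2 - γ k z.1) (Icc 0 1 ×ˢ Icc 0 1) :=
    fun k l => ((hΓ l).comp continuousOn_snd fun z hz => hz.2).sub
      ((hγ k).comp continuousOn_fst fun z hz => hz.1)
  have cell : ∀ k l : Fin 4, l ≤ k → ¬ (k = 2 ∧ l = 1) →
      boundaryInc (fun z => Γ l z.2 - γ k z.1) 0 1 0 1 = 0 := fun k l hkl h =>
    boundaryInc_eq_zero zero_le_one zero_le_one (hcont k l) fun z hz =>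
      sub_ne_zero.2 (hdisj k l hkl h z.1 hz.1 z.2 hz.2)
  have diag : ∀ k : Fin 4, logInc (fun t => Γ k t - γ k t) 0 1 =
      logInc (fun t => Γ k 0 - γ k t) 0 1 + logInc (fun s => Γ k s - γ k 1) 0 1 := fun k =>
    logInc_diagonal (D := fun z => Γ k z.2 - γ k z.1) zero_le_one (hcont k k) fun z hz =>
      sub_ne_zero.2 (hdisj k k le_rfl (by omega) z.1 hz.1 z.2 hz.2)
  have sv := hf.sum_logInc_eq_zero hγ hγc (v := fun k t => Γ k t - γ k t) hfv
  have sI := h₁.sum_logInc_eq_zero hγ hγc (v := fun k t => γ k t - Γ 0 0) fun _ _ _ => rfl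
  have sJ := h₂.sum_logInc_eq_zero hΓ hΓc (v := fun k t => Γ k t - γ 0 0) fun _ _ _ => rfl
  have flip : ∀ k, logInc (fun t => γ k t - Γ 0 0) 0 1 = logInc (fun t => Γ 0 0 - γ k t) 0 1 :=
    fun k => by rw [← logInc_neg]; simp only [neg_sub]
  simp only [flip] at sI
  simp only [diag] at sv
  have c10 := cell 1 0 (by decide) (by decide)
  have c20 := cell 2 0 (by decide) (by decide)
  have c30 := cell 3 0 (by decide) (by decide)
  have c31 := cell 3 1 (by decide) (by decide)
  have c32 := cell 3 2 (by decide) (by decide)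
  unfold boundaryInc at *
  have e0 := hγc 0
  have e1 := hγc 1
  have e2 := hγc 2
  have e3 := hγc 3
  have E0 := hΓc 0
  have E1 := hΓc 1
  have E2 := hΓc 2
  have E3 := hΓc 3
  simp only [zero_add, show (1 : Fin 4) + 1 = 2 from rfl, show (2 : Fin 4) + 1 = 3 from rfl,
    show (3 : Fin 4) + 1 = 0 from rfl] at e0 e1 e2 e3 E0 E1 E2 E3
  simp only [e0, e1, e2, e3, E0, E1, E2, E3] at *
  linear_combination sI + sJ - sv - c10 - c20 - c30 - c31 - c32

theorem logInc_exp_mul_zpow {f u w : ℝ → ℂ} {a b : ℝ} (hu : ContinuousOn u (uIcc a b))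
    (hw : HasLogOn w (uIcc a b)) (k : ℤ)
    (hf : ∀ t ∈ uIcc a b, f t = Complex.exp (u t) * w t ^ k) :
    logInc f a b = u b - u a + k * logInc w a b := by
  obtain ⟨v, hv, e⟩ := hw
  have h₁ := logInc_eq hv e
  have h₂ : logInc f a b = (u b + k * v b) - (u a + k * v a) :=
    logInc_eq (g := fun t => u t + k * v t) (hu.add (continuousOn_const.mul hv)) fun t ht => by
      rw [hf t ht, e t ht, Complex.exp_add, Complex.exp_int_mul]
  rw [h₁, h₂]
  ring

theorem DivFn.exists_zpow {K : Set ℂ} {m : ℂ} {p : ℂ → ℂ} (h : DivFn Kᶜ p)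
    (hK : ∀ c ∉ K, ∃ k : ℤ, HasLogOn (fun z => (z - c) / (z - m) ^ k) K) (hm : m ∉ K) :
    ∃ k : ℤ, HasLogOn (fun z => p z / (z - m) ^ k) K := by
  have h0 : ∀ z ∈ K, z - m ≠ 0 := fun z hz => sub_ne_zero.2 fun h => hm (h ▸ hz)
  induction h with
  | one => exact ⟨0, by simpa using HasLogOn.one⟩
  | mul _ hc ih =>
    obtain ⟨k, hk⟩ := ih
    obtain ⟨l, hl⟩ := hK _ hc
    refine ⟨k + l, (hk.mul hl).congr fun z hz => ?_⟩
    rw [zpow_add₀ (h0 z hz)]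
    have := h0 z hz
    field_simp
  | div _ hc ih =>
    obtain ⟨k, hk⟩ := ih
    obtain ⟨l, hl⟩ := hK _ hc
    refine ⟨k - l, (hk.div hl).congr fun z hz => ?_⟩
    rw [zpow_sub₀ (h0 z hz)]
    simp only [div_eq_mul_inv, mul_inv, inv_inv]
    ring

theorem im_logInc_pos {D : ℝ → ℂ} {u : ℂ} {a b : ℝ} (hab : a ≤ b) (hu : u ≠ 0)
    (hD : ContinuousOn D (Icc a b)) (hre : ∀ t ∈ Icc a b, 0 < (u * D t).re)
    (ha : (u * D a).im < 0) (hb : 0 < (u * D b).im) : 0 < (logInc D a b).im := by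
  have huIcc := uIcc_of_le hab
  rw [logInc_eq (g := fun t => Complex.log (u * D t) - Complex.log u)
    (by
      rw [huIcc]
      exact ((continuousOn_const.mul hD).clog fun t ht => Or.inl (hre t ht)).sub continuousOn_const)
    (by
      rw [huIcc]
      intro t ht
      have : u * D t ≠ 0 := fun h => by simpa [h] using hre t ht
      rw [Complex.exp_sub, Complex.exp_log this, Complex.exp_log hu, mul_div_cancel_left₀ _ hu])]
  have h₁ : (Complex.log (u * D a)).im < 0 := by
    rw [Complex.log_im]; exact Complex.arg_neg_iff.2 ha
  have h₂ : 0 < (Complex.log (u * D b)).im := by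
    rw [Complex.log_im]
    refine lt_of_le_of_ne (Complex.arg_nonneg_iff.2 hb.le) fun h => ?_
    exact hb.ne' (Complex.arg_eq_zero_iff.1 h.symm).2
  simp only [Complex.sub_im]
  linarith

section Crossing

variable {a b c d t₀ s₀ : ℝ}

theorem boundaryInc_sub_ne_zero (ht : t₀ ∈ Ioo a b) (hs : s₀ ∈ Ioo c d) :
    boundaryInc (fun z => (⟨z.1 - t₀, z.2 - s₀⟩ : ℂ)) a b c d ≠ 0 := by
  obtain ⟨ha, hb⟩ := ht
  obtain ⟨hc, hd⟩ := hs
  have hcont : Continuous fun z : ℝ × ℝ => (⟨z.1 - t₀, z.2 - s₀⟩ : ℂ) :=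
    Complex.equivRealProdCLM.symm.continuous.comp
      (by fun_prop : Continuous fun z : ℝ × ℝ => (z.1 - t₀, z.2 - s₀))
  have hx : ∀ s : ℝ, Continuous fun t : ℝ => (⟨t - t₀, s - s₀⟩ : ℂ) := fun s =>
    hcont.comp (by fun_prop : Continuous fun t : ℝ => (t, s))
  have hy : ∀ t : ℝ, Continuous fun s : ℝ => (⟨t - t₀, s - s₀⟩ : ℂ) := fun t =>
    hcont.comp (by fun_prop : Continuous fun s : ℝ => (t, s))
  have h₁ := im_logInc_pos (u := Complex.I) (ha.trans hb).le Complex.I_ne_zero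
    (hx c).continuousOn (by simp [hc]) (by simp [ha]) (by simp [hb])
  have h₂ := im_logInc_pos (u := 1) (hc.trans hd).le one_ne_zero
    (hy b).continuousOn (by simp [hb]) (by simp [hc]) (by simp [hd])
  have flip : ∀ {f : ℝ → ℂ} {x y : ℝ} {u : ℂ}, x ≤ y → u ≠ 0 → Continuous f →
      (∀ t ∈ Icc x y, 0 < (u * f t).re) → 0 < (u * f x).im → (u * f y).im < 0 →
      (logInc f x y).im < 0 := by
    intro f x y u hxy hu hf hre hfx hfy
    have := im_logInc_pos (D := fun t => (starRingEnd ℂ) (f t)) (u := (starRingEnd ℂ) u) hxy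
      (by simpa using hu) (Complex.continuous_conj.comp hf).continuousOn
      (fun t ht => by rw [← map_mul, Complex.conj_re]; exact hre t ht)
      (by rw [← map_mul, Complex.conj_im]; linarith) (by rw [← map_mul, Complex.conj_im]; linarith)
    have hL : HasLogOn f (uIcc x y) := by
      rw [uIcc_of_le hxy]
      refine HasLogOn.of_Icc hf.continuousOn fun t ht h => ?_
      simpa [h] using hre t ht
    obtain ⟨v, hv, e⟩ := hL
    rw [logInc_eq hv e]
    rw [logInc_eq (g := fun t => (starRingEnd ℂ) (v t))
      (Complex.continuous_conj.comp_continuousOn hv)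
      (fun t ht => by rw [e t ht, Complex.exp_conj])] at this
    simp only [Complex.sub_im, Complex.conj_im] at this ⊢
    linarith
  have h₃ := flip (u := -Complex.I) (ha.trans hb).le (by simp) (hx d) (by simp [hd])
    (by simp [ha]) (by simp [hb])
  have h₄ := flip (u := -1) (hc.trans hd).le (by simp) (hy a) (by simp [ha])
    (by simp [hc]) (by simp [hd])
  intro h
  have := congrArg Complex.im h
  simp only [boundaryInc, Complex.sub_im, Complex.add_im, Complex.zero_im] at this
  linarith

theorem not_hasLogOn_sphere {ε : ℝ} (hε : 0 < ε) :
    ¬ HasLogOn (fun z : ℂ => z) (Metric.sphere 0 ε) := by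
  rintro ⟨u, hu, e⟩
  have hm : ∀ θ : ℝ, (ε : ℂ) * Complex.exp (θ * Complex.I) ∈ Metric.sphere (0 : ℂ) ε := fun θ => by
    rw [mem_sphere_zero_iff_norm, norm_mul, Complex.norm_exp_ofReal_mul_I, mul_one,
      Complex.norm_of_nonneg hε.le]
  have h := (isPreconnected_Icc (a := (0 : ℝ)) (b := 2 * Real.pi)).sub_eq_sub_of_exp_eq
    (g₁ := fun θ : ℝ => u (ε * Complex.exp (θ * Complex.I)))
    (g₂ := fun θ : ℝ => (Real.log ε : ℂ) + θ * Complex.I)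
    (hu.comp (by fun_prop) fun θ _ => hm θ) (by fun_prop)
    (fun θ _ => by
      rw [← e _ (hm θ), Complex.exp_add, ← Complex.ofReal_exp, Real.exp_log hε])
    (right_mem_Icc.2 Real.two_pi_pos.le) (left_mem_Icc.2 Real.two_pi_pos.le)
  simp only [Complex.ofReal_mul, Complex.ofReal_ofNat, Complex.exp_two_pi_mul_I] at h
  simp [Real.pi_ne_zero] at h

/-- A local homeomorphism of the plane has non-zero index at its zero. -/
theorem boundaryInc_ne_zero_of_injOn {g : ℝ × ℝ → ℂ} (ht : t₀ ∈ Ioo a b) (hs : s₀ ∈ Ioo c d)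
    (hg : ContinuousOn g (Icc a b ×ˢ Icc c d)) (hi : InjOn g (Icc a b ×ˢ Icc c d))
    (h0 : g (t₀, s₀) = 0) (hn : g '' (Icc a b ×ˢ Icc c d) ∈ 𝓝 0) :
    boundaryInc g a b c d ≠ 0 := by
  have hab := (ht.1.trans ht.2).le
  have hcd := (hs.1.trans hs.2).le
  set R := Icc a b ×ˢ Icc c d with hR
  have hz₀ : (t₀, s₀) ∈ R := ⟨Ioo_subset_Icc_self ht, Ioo_subset_Icc_self hs⟩
  let φ : ℂ → ℝ × ℝ := fun z => Complex.equivRealProdCLM z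
  have φc : Continuous φ := Complex.equivRealProdCLM.continuous
  let Rc : Set ℂ := φ ⁻¹' R
  have hRc : IsCompact Rc := by
    have := (isCompact_Icc.prod isCompact_Icc : IsCompact R).image
      Complex.equivRealProdCLM.symm.continuous
    rwa [Complex.equivRealProdCLM.symm.image_eq_preimage_symm] at this
  have hRconv : Convex ℝ Rc := by
    have := (((convex_Icc a b).prod (convex_Icc c d)).linear_preimage
      Complex.equivRealProdCLM.toLinearMap)
    exact this
  obtain ⟨ε, hε, hεR⟩ := Metric.nhds_basis_closedBall.mem_iff.1 hn
  let m : ℂ := ⟨t₀, s₀⟩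
  have hm : m ∈ Rc := hz₀
  have hG : ContinuousOn (fun z => g (φ z)) Rc := hg.comp φc.continuousOn fun z hz => hz
  have hGm : g (φ m) = 0 := h0
  obtain ⟨δ₀, hδ₀, hsmall⟩ := Metric.continuousOn_iff.1 hG m hm ε hε
  obtain ⟨δ, hδ, h₁, h₂, h₃, h₄, h₅⟩ : ∃ δ > 0, δ ≤ δ₀ ∧ δ ≤ t₀ - a ∧ δ ≤ b - t₀ ∧ δ ≤ s₀ - c ∧
      δ ≤ d - s₀ := by
    refine ⟨min δ₀ (min (min (t₀ - a) (b - t₀)) (min (s₀ - c) (d - s₀))), ?_, ?_⟩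
    · have := ht.1; have := ht.2; have := hs.1; have := hs.2
      simp only [gt_iff_lt, lt_min_iff]
      refine ⟨hδ₀, ⟨?_, ?_⟩, ?_, ?_⟩ <;> linarith
    · simp
  let K : Set ℂ := Rc ∩ {z | δ ≤ ‖z - m‖}
  have hK : IsCompact K := hRc.inter_right (isClosed_le continuous_const (by fun_prop))
  have hmK : m ∉ K := fun h => by
    have := h.2
    simp at this
    linarith
  have φinj : Injective φ := Complex.equivRealProdCLM.injective
  have hnz : ∀ z ∈ K, g (φ z) ≠ 0 := fun z hz h =>
    hmK (φinj (hi hz.1 hm (h.trans hGm.symm)) ▸ hz)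
  obtain ⟨p, hp, hlog⟩ := exists_divFn_hasLogOn_div hK (hG.mono inter_subset_left) hnz
  obtain ⟨k, hk⟩ : ∃ k : ℤ, HasLogOn (fun z => p z / (z - m) ^ k) K := by
    refine hp.exists_zpow (fun w hw => ?_) hmK
    by_cases hwR : w ∈ Rc
    · have hwδ : ‖w - m‖ < δ := not_le.1 fun h => hw ⟨hwR, h⟩
      have hzm : ∀ z ∈ K, z - m ≠ 0 := fun z hz => sub_ne_zero.2 fun h => hmK (h ▸ hz)
      refine ⟨1, HasLogOn.of_norm_sub_lt (c := 1) ?_ fun z hz => ?_⟩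
      · simp only [zpow_one]
        exact ContinuousOn.div (by fun_prop) (by fun_prop) hzm
      · have : (z - w) / (z - m) ^ (1 : ℤ) - 1 = (m - w) / (z - m) := by
          have := hzm z hz
          field_simp
          simp
        rw [this, norm_div, norm_one, div_lt_one (norm_pos_iff.2 (hzm z hz)), norm_sub_rev]
        exact hwδ.trans_le hz.2
    · refine ⟨0, ?_⟩
      simp only [zpow_zero, div_one]
      refine (HasLogOn.of_convex hRc hRconv (f := fun z => z - w) (by fun_prop) fun z hz =>
        sub_ne_zero.2 fun h => hwR ?_).mono inter_subset_left
      rwa [← h]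
  obtain ⟨u, hu, hexp⟩ := hlog.mul hk
  have hp0 : ∀ z ∈ K, p z ≠ 0 := by
    intro z hz h
    obtain ⟨v, -, e⟩ := hlog
    have := e z hz
    simp only [h, div_zero] at this
    exact Complex.exp_ne_zero _ this.symm
  have hfac : ∀ z ∈ K, g (φ z) = Complex.exp (u z) * (z - m) ^ k := fun z hz => by
    have hzm : z - m ≠ 0 := sub_ne_zero.2 fun h => hmK (h ▸ hz)
    rw [← hexp z hz]
    have := hp0 z hz
    field_simp
  have hk0 : k ≠ 0 := by
    rintro rfl
    refine not_hasLogOn_sphere hε ?_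
    have himg : ∀ w ∈ Metric.sphere (0 : ℂ) ε, ∃ z ∈ Rc, g (φ z) = w := fun w hw => by
      obtain ⟨z, hz, rfl⟩ := hεR (Metric.sphere_subset_closedBall hw)
      exact ⟨⟨z.1, z.2⟩, hz, rfl⟩
    choose! ι hι hgι using himg
    have hιK : MapsTo ι (Metric.sphere (0 : ℂ) ε) K := fun w hw => by
      refine ⟨hι w hw, show δ ≤ ‖ι w - m‖ from not_lt.1 fun hlt => ?_⟩
      have := hsmall (ι w) (hι w hw) (by rw [dist_eq_norm]; linarith)
      rw [hGm, hgι w hw, dist_zero_right, mem_sphere_zero_iff_norm.1 hw] at this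
      exact this.false
    have hιc : ContinuousOn ι (Metric.sphere (0 : ℂ) ε) := by
      rw [continuousOn_iff_isClosed]
      intro A hA
      refine ⟨(fun z => g (φ z)) '' (A ∩ Rc), ((hRc.inter_left hA).image_of_continuousOn
        (hG.mono inter_subset_right)).isClosed, ?_⟩
      ext w
      constructor
      · rintro ⟨hwA, hw⟩
        exact ⟨⟨ι w, ⟨hwA, hι w hw⟩, hgι w hw⟩, hw⟩
      · rintro ⟨⟨z, ⟨hzA, hzR⟩, hzw⟩, hw⟩
        refine ⟨?_, hw⟩
        have hzw' : g (φ z) = w := hzw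
        rw [mem_preimage, φinj (hi (hι w hw) hzR ((hgι w hw).trans hzw'.symm))]
        exact hzA
    refine ⟨fun w => u (ι w), hu.comp hιc hιK, fun w hw => ?_⟩
    have := hfac _ (hιK hw)
    rwa [hgι w hw, zpow_zero, mul_one] at this
  let ψ : ℝ × ℝ → ℂ := fun z => ⟨z.1, z.2⟩
  have ψc : Continuous ψ := Complex.equivRealProdCLM.symm.continuous
  have edge : ∀ {γ : ℝ → ℝ × ℝ} {x y : ℝ}, x ≤ y → Continuous γ → (∀ t ∈ Icc x y, ψ (γ t) ∈ K) →
      logInc (fun t => g (γ t)) x y = u (ψ (γ y)) - u (ψ (γ x)) +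
        k * logInc (fun t => (⟨(γ t).1 - t₀, (γ t).2 - s₀⟩ : ℂ)) x y := by
    intro γ x y hxy hγ hγK
    have huI := uIcc_of_le hxy
    have hsub : ∀ t, (⟨(γ t).1 - t₀, (γ t).2 - s₀⟩ : ℂ) = ψ (γ t) - m := fun t => by
      apply Complex.ext <;> simp [ψ, m]
    simp only [hsub]
    refine logInc_exp_mul_zpow (u := fun t => u (ψ (γ t))) (w := fun t => ψ (γ t) - m) ?_ ?_ k ?_
    · rw [huI]
      exact hu.comp (ψc.comp hγ).continuousOn hγK
    · rw [huI]
      exact HasLogOn.of_Icc ((ψc.comp hγ).sub continuous_const).continuousOn fun t ht =>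
        sub_ne_zero.2 fun h => hmK (h ▸ hγK t ht)
    · rw [huI]
      exact fun t ht => hfac _ (hγK t ht)
  have hnorm₁ : ∀ z : ℂ, δ ≤ |z.re - t₀| → δ ≤ ‖z - m‖ := fun z h =>
    h.trans (Complex.abs_re_le_norm (z - m))
  have hnorm₂ : ∀ z : ℂ, δ ≤ |z.im - s₀| → δ ≤ ‖z - m‖ := fun z h =>
    h.trans (Complex.abs_im_le_norm (z - m))
  have e₁ := edge (γ := fun t => (t, c)) hab (by fun_prop) fun t ht =>
    ⟨⟨ht, left_mem_Icc.2 hcd⟩, hnorm₂ _ (by rw [abs_sub_comm]; exact h₄.trans (le_abs_self _))⟩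
  have e₂ := edge (γ := fun t => (t, d)) hab (by fun_prop) fun t ht =>
    ⟨⟨ht, right_mem_Icc.2 hcd⟩, hnorm₂ _ (h₅.trans (le_abs_self _))⟩
  have e₃ := edge (γ := fun s => (a, s)) hcd (by fun_prop) fun s hs =>
    ⟨⟨left_mem_Icc.2 hab, hs⟩, hnorm₁ _ (by rw [abs_sub_comm]; exact h₂.trans (le_abs_self _))⟩
  have e₄ := edge (γ := fun s => (b, s)) hcd (by fun_prop) fun s hs =>
    ⟨⟨right_mem_Icc.2 hab, hs⟩, hnorm₁ _ (h₃.trans (le_abs_self _))⟩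
  have : boundaryInc g a b c d =
      k * boundaryInc (fun z => (⟨z.1 - t₀, z.2 - s₀⟩ : ℂ)) a b c d := by
    rw [boundaryInc, boundaryInc, e₁, e₂, e₃, e₄]
    ring
  rw [this]
  exact mul_ne_zero (Int.cast_ne_zero.2 hk0) (boundaryInc_sub_ne_zero ht hs)

end Crossing

section Crossing

variable {a b c d t₀ s₀ : ℝ}

/-- Homotopy invariance of the boundary increment. -/
theorem boundaryInc_eq_of_homotopy {H : ℝ → ℝ × ℝ → ℂ} (hab : a ≤ b) (hcd : c ≤ d)
    (hH : ContinuousOn (fun z : ℝ × ℝ × ℝ => H z.1 z.2) (Icc 0 1 ×ˢ (Icc a b ×ˢ Icc c d)))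
    (h0 : ∀ r ∈ Icc (0 : ℝ) 1, ∀ z ∈ Icc a b ×ˢ Icc c d,
      (z.1 = a ∨ z.1 = b ∨ z.2 = c ∨ z.2 = d) → H r z ≠ 0) :
    boundaryInc (H 0) a b c d = boundaryInc (H 1) a b c d := by
  have face : ∀ {γ : ℝ → ℝ × ℝ} {x y : ℝ}, x ≤ y → Continuous γ →
      (∀ t ∈ Icc x y, γ t ∈ Icc a b ×ˢ Icc c d) →
      (∀ t ∈ Icc x y, (γ t).1 = a ∨ (γ t).1 = b ∨ (γ t).2 = c ∨ (γ t).2 = d) →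
      boundaryInc (fun z => H z.1 (γ z.2)) 0 1 x y = 0 := fun {γ _ _} hxy hγ hm hb =>
    boundaryInc_eq_zero zero_le_one hxy
      (hH.comp (f := fun z : ℝ × ℝ => (z.1, γ z.2)) (by fun_prop) fun z hz => ⟨hz.1, hm _ hz.2⟩)
      fun z hz => h0 _ hz.1 _ (hm _ hz.2) (hb _ hz.2)
  have ha := left_mem_Icc.2 hab
  have hb := right_mem_Icc.2 hab
  have hc := left_mem_Icc.2 hcd
  have hd := right_mem_Icc.2 hcd
  have f₁ := face (γ := fun t => (t, c)) hab (by fun_prop) (fun t ht => ⟨ht, hc⟩) (by simp)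
  have f₂ := face (γ := fun t => (t, d)) hab (by fun_prop) (fun t ht => ⟨ht, hd⟩) (by simp)
  have f₃ := face (γ := fun s => (a, s)) hcd (by fun_prop) (fun s hs => ⟨ha, hs⟩) (by simp)
  have f₄ := face (γ := fun s => (b, s)) hcd (by fun_prop) (fun s hs => ⟨hb, hs⟩) (by simp)
  simp only [boundaryInc] at *
  linear_combination f₂ + f₃ - f₁ - f₄

theorem exists_Icc_subset_of_injOn {ρ : ℝ → ℝ} {I : Set ℝ} (hI : I ∈ 𝓝 t₀)
    (hρ : ContinuousOn ρ I) (hi : InjOn ρ I) {J : Set ℝ} (hJ : J ∈ 𝓝 (ρ t₀)) :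
    ∃ x y, t₀ ∈ Ioo x y ∧ Icc x y ⊆ I ∧ MapsTo ρ (Icc x y) J ∧ ρ '' Icc x y ∈ 𝓝 (ρ t₀) := by
  have h₁ : I ∩ ρ ⁻¹' J ∈ 𝓝 t₀ := inter_mem hI ((hρ.continuousAt hI).preimage_mem_nhds hJ)
  obtain ⟨ε, hε, hs⟩ := Metric.nhds_basis_closedBall.mem_iff.1 h₁
  rw [Real.closedBall_eq_Icc] at hs
  have hlt : t₀ - ε < t₀ + ε := by linarith
  have hm : t₀ ∈ Ioo (t₀ - ε) (t₀ + ε) := by constructor <;> linarith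
  have hsI : Icc (t₀ - ε) (t₀ + ε) ⊆ I := fun t ht => (hs ht).1
  refine ⟨_, _, hm, hsI, fun t ht => (hs ht).2, ?_⟩
  have hm' := Ioo_subset_Icc_self hm
  have hl := left_mem_Icc.2 hlt.le
  have hr := right_mem_Icc.2 hlt.le
  rcases (hρ.mono hsI).strictMonoOn_of_injOn_Icc' hlt.le (hi.mono hsI) with h | h
  · exact mem_of_superset (Icc_mem_nhds (h hl hm' hm.1) (h hm' hr hm.2))
      (intermediate_value_Icc hlt.le (hρ.mono hsI))
  · exact mem_of_superset (Icc_mem_nhds (h hm' hr hm.2) (h hl hm' hm.1))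
      (intermediate_value_Icc' hlt.le (hρ.mono hsI))

/-- Two paths crossing exactly once, transversally, have non-zero boundary increment. -/
theorem boundaryInc_ne_zero_of_crossing {p q : ℝ → ℂ} (hp : ContinuousOn p (Icc 0 1))
    (hq : ContinuousOn q (Icc 0 1)) (ht₀ : t₀ ∈ Ioo (0 : ℝ) 1) (hs₀ : s₀ ∈ Ioo (0 : ℝ) 1)
    (hpq : ∀ t ∈ Icc (0 : ℝ) 1, ∀ s ∈ Icc (0 : ℝ) 1, q s = p t → t = t₀ ∧ s = s₀)
    {h : ℝ × ℝ → ℂ} {r : ℝ} (hr : 0 < r) (hh : ContinuousOn h (Icc (-r) r ×ˢ Icc (-r) r))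
    (hi : InjOn h (Icc (-r) r ×ˢ Icc (-r) r)) (ho : ∀ N ∈ 𝓝 ((0, 0) : ℝ × ℝ), h '' N ∈ 𝓝 (h (0, 0)))
    {ρ₁ ρ₂ : ℝ → ℝ} {I₁ I₂ : Set ℝ} (hI₁ : I₁ ∈ 𝓝 t₀) (hI₂ : I₂ ∈ 𝓝 s₀)
    (hρ₁ : ContinuousOn ρ₁ I₁) (hρ₂ : ContinuousOn ρ₂ I₂) (hi₁ : InjOn ρ₁ I₁) (hi₂ : InjOn ρ₂ I₂)
    (h₁ : ρ₁ t₀ = 0) (h₂ : ρ₂ s₀ = 0) (hph : ∀ t ∈ I₁, p t = h (ρ₁ t, 0))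
    (hqh : ∀ s ∈ I₂, q s = h (0, ρ₂ s)) :
    boundaryInc (fun z => q z.2 - p z.1) 0 1 0 1 ≠ 0 := by
  have hJ : Icc (-r) r ∈ 𝓝 (0 : ℝ) := Icc_mem_nhds (by linarith) hr
  obtain ⟨a, b, ht, hab, hmt, hnt⟩ := exists_Icc_subset_of_injOn
    (inter_mem hI₁ (Icc_mem_nhds ht₀.1 ht₀.2)) (hρ₁.mono inter_subset_left)
    (hi₁.mono inter_subset_left) (h₁.symm ▸ hJ)
  obtain ⟨c, d, hs, hcd, hms, hns⟩ := exists_Icc_subset_of_injOn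
    (inter_mem hI₂ (Icc_mem_nhds hs₀.1 hs₀.2)) (hρ₂.mono inter_subset_left)
    (hi₂.mono inter_subset_left) (h₂.symm ▸ hJ)
  rw [h₁] at hnt
  rw [h₂] at hns
  have hab' := (ht.1.trans ht.2).le
  have hcd' := (hs.1.trans hs.2).le
  have a0 := (hab (left_mem_Icc.2 hab')).2.1
  have b1 := (hab (right_mem_Icc.2 hab')).2.2
  have c0 := (hcd (left_mem_Icc.2 hcd')).2.1
  have d1 := (hcd (right_mem_Icc.2 hcd')).2.2
  set D : ℝ × ℝ → ℂ := fun z => q z.2 - p z.1 with hDdef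
  have hD : ContinuousOn D (Icc 0 1 ×ˢ Icc 0 1) :=
    (hq.comp continuousOn_snd fun z hz => hz.2).sub (hp.comp continuousOn_fst fun z hz => hz.1)
  have hD0 : ∀ z ∈ Icc (0 : ℝ) 1 ×ˢ Icc (0 : ℝ) 1, z.1 ≠ t₀ ∨ z.2 ≠ s₀ → D z ≠ 0 := by
    intro z hz hne h
    have := hpq z.1 hz.1 z.2 hz.2 (sub_eq_zero.1 h)
    tauto
  have loc : boundaryInc D 0 1 0 1 = boundaryInc D a b c d := by
    have l1 := left_mem_Icc.2 (zero_le_one (α := ℝ))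
    have r1 := right_mem_Icc.2 (zero_le_one (α := ℝ))
    rw [boundaryInc_add_left a0 (hab'.trans b1) zero_le_one hD
        (fun t ht => hD0 _ ⟨ht, l1⟩ (Or.inr hs₀.1.ne)) (fun t ht => hD0 _ ⟨ht, r1⟩ (Or.inr hs₀.2.ne')),
      boundaryInc_add_left hab' b1 zero_le_one (hD.mono (by gcongr))
        (fun t ht => hD0 _ ⟨⟨a0.trans ht.1, ht.2⟩, l1⟩ (Or.inr hs₀.1.ne))
        (fun t ht => hD0 _ ⟨⟨a0.trans ht.1, ht.2⟩, r1⟩ (Or.inr hs₀.2.ne')),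
      boundaryInc_eq_zero a0 zero_le_one (hD.mono (by gcongr; linarith))
        (fun z hz => hD0 _ ⟨⟨hz.1.1, hz.1.2.trans (hab'.trans b1)⟩, hz.2⟩
          (Or.inl (hz.1.2.trans_lt ht.1).ne)),
      boundaryInc_eq_zero b1 zero_le_one (hD.mono (by gcongr; linarith))
        (fun z hz => hD0 _ ⟨⟨(a0.trans hab').trans hz.1.1, hz.1.2⟩, hz.2⟩
          (Or.inl (ht.2.trans_le hz.1.1).ne')), zero_add, add_zero]
    have hsub : Icc a b ×ˢ Icc 0 1 ⊆ Icc 0 1 ×ˢ Icc (0 : ℝ) 1 := prod_mono_left (Icc_subset_Icc a0 b1)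
    rw [boundaryInc_add_right hab' c0 (hcd'.trans d1) (hD.mono hsub)
        (fun s hs => hD0 _ (hsub ⟨left_mem_Icc.2 hab', hs⟩) (Or.inl ht.1.ne))
        (fun s hs => hD0 _ (hsub ⟨right_mem_Icc.2 hab', hs⟩) (Or.inl ht.2.ne')),
      boundaryInc_add_right hab' hcd' d1 (hD.mono (Subset.trans (by gcongr) hsub))
        (fun s hs => hD0 _ (hsub ⟨left_mem_Icc.2 hab', ⟨c0.trans hs.1, hs.2⟩⟩) (Or.inl ht.1.ne))
        (fun s hs => hD0 _ (hsub ⟨right_mem_Icc.2 hab', ⟨c0.trans hs.1, hs.2⟩⟩) (Or.inl ht.2.ne')),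
      boundaryInc_eq_zero hab' c0 (hD.mono (Subset.trans (by gcongr; linarith) hsub))
        (fun z hz => hD0 _ (hsub ⟨hz.1, ⟨hz.2.1, hz.2.2.trans (hcd'.trans d1)⟩⟩)
          (Or.inr (hz.2.2.trans_lt hs.1).ne)),
      boundaryInc_eq_zero hab' d1 (hD.mono (Subset.trans (by gcongr; linarith) hsub))
        (fun z hz => hD0 _ (hsub ⟨hz.1, ⟨(c0.trans hcd').trans hz.2.1, hz.2.2⟩⟩)
          (Or.inr (hs.2.trans_le hz.2.1).ne')), zero_add, add_zero]
  rw [loc]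
  set Q := Icc (-r) r ×ˢ Icc (-r) r with hQ
  have h0r : (0 : ℝ) ∈ Icc (-r) r := ⟨by linarith, hr.le⟩
  have mul_mem : ∀ {x k : ℝ}, x ∈ Icc (-r) r → k ∈ Icc (-1 : ℝ) 1 → k * x ∈ Icc (-r) r := by
    intro x k hx hk
    rw [mem_Icc, ← abs_le] at hx hk ⊢
    rw [abs_mul]
    calc |k| * |x| ≤ 1 * r := by gcongr
      _ = r := one_mul r
  let H : ℝ → ℝ × ℝ → ℂ := fun l z => h (-l * ρ₁ z.1, ρ₂ z.2) - h ((1 - l) * ρ₁ z.1, 0)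
  have m₁ : ∀ l ∈ Icc (0 : ℝ) 1, ∀ z ∈ Icc a b ×ˢ Icc c d, (-l * ρ₁ z.1, ρ₂ z.2) ∈ Q :=
    fun l hl z hz => ⟨mul_mem (hmt hz.1) ⟨by linarith [hl.2], by linarith [hl.1]⟩, hms hz.2⟩
  have m₂ : ∀ l ∈ Icc (0 : ℝ) 1, ∀ z ∈ Icc a b ×ˢ Icc c d, ((1 - l) * ρ₁ z.1, (0 : ℝ)) ∈ Q :=
    fun l hl z hz => ⟨mul_mem (hmt hz.1) ⟨by linarith [hl.2], by linarith [hl.1]⟩, h0r⟩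
  have ρ₁c : ContinuousOn (fun z : ℝ × ℝ × ℝ => ρ₁ z.2.1) (Icc 0 1 ×ˢ (Icc a b ×ˢ Icc c d)) :=
    (hρ₁.mono fun t ht => (hab ht).1).comp (by fun_prop) fun z hz => hz.2.1
  have ρ₂c : ContinuousOn (fun z : ℝ × ℝ × ℝ => ρ₂ z.2.2) (Icc 0 1 ×ˢ (Icc a b ×ˢ Icc c d)) :=
    (hρ₂.mono fun t ht => (hcd ht).1).comp (by fun_prop) fun z hz => hz.2.2
  have hHc : ContinuousOn (fun z : ℝ × ℝ × ℝ => H z.1 z.2) (Icc 0 1 ×ˢ (Icc a b ×ˢ Icc c d)) := by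
    refine ContinuousOn.sub (hh.comp (((continuous_fst.neg).continuousOn.mul ρ₁c).prodMk ρ₂c)
      fun z hz => m₁ _ hz.1 _ hz.2) (hh.comp (((by fun_prop : Continuous fun z : ℝ × ℝ × ℝ =>
        (1 - z.1)).continuousOn.mul ρ₁c).prodMk continuousOn_const) fun z hz => m₂ _ hz.1 _ hz.2)
  have e₁ : ∀ t ∈ Icc a b, ρ₁ t = 0 → t = t₀ := fun t hz h =>
    hi₁ (hab hz).1 (hab (Ioo_subset_Icc_self ht)).1 (h.trans h₁.symm)
  have e₂ : ∀ s ∈ Icc c d, ρ₂ s = 0 → s = s₀ := fun t hz h =>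
    hi₂ (hcd hz).1 (hcd (Ioo_subset_Icc_self hs)).1 (h.trans h₂.symm)
  have hom := boundaryInc_eq_of_homotopy (H := H) hab' hcd' hHc fun l hl z hz hb h0 => by
    have := hi (m₁ l hl z hz) (m₂ l hl z hz) (sub_eq_zero.1 h0)
    rw [Prod.mk.injEq] at this
    have z₁ := e₁ _ hz.1 (by linarith [this.1])
    have z₂ := e₂ _ hz.2 this.2
    have := ht.1; have := ht.2; have := hs.1; have := hs.2
    rcases hb with h | h | h | h <;> linarith
  have hH0 : boundaryInc D a b c d = boundaryInc (H 0) a b c d :=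
    boundaryInc_congr hab' hcd' fun z hz => by
      simp only [hDdef, H, neg_zero, zero_mul, sub_zero, one_mul]
      rw [hph _ (hab hz.1).1, hqh _ (hcd hz.2).1]
  rw [hH0, hom]
  refine boundaryInc_ne_zero_of_injOn ht hs
    (hHc.comp (f := fun z : ℝ × ℝ => ((1 : ℝ), z)) (by fun_prop) fun z hz => ⟨by simp, hz⟩) ?_ ?_ ?_
  · intro z hz w hw hzw
    have := hi (m₁ 1 (by simp) z hz) (m₁ 1 (by simp) w hw) (by simpa [H] using hzw)
    simp only [neg_mul, one_mul, Prod.mk.injEq, neg_inj] at this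
    exact Prod.ext (hi₁ (hab hz.1).1 (hab hw.1).1 this.1) (hi₂ (hcd hz.2).1 (hcd hw.2).1 this.2)
  · simp [H, h₁, h₂]
  · have hN : ((fun x : ℝ => -x) '' (ρ₁ '' Icc a b)) ×ˢ (ρ₂ '' Icc c d) ∈ 𝓝 ((0, 0) : ℝ × ℝ) := by
      refine prod_mem_nhds ?_ hns
      rw [image_neg_eq_neg]
      simpa using neg_mem_nhds_zero ℝ hnt
    have := ho _ hN
    have htr : (fun w => w - h (0, 0)) '' (h '' (((fun x : ℝ => -x) '' (ρ₁ '' Icc a b)) ×ˢ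
        (ρ₂ '' Icc c d))) ∈ 𝓝 (0 : ℂ) := by
      have := (Homeomorph.subRight (h (0, 0))).isOpenMap.image_mem_nhds this
      simpa using this
    refine mem_of_superset htr ?_
    rintro _ ⟨_, ⟨⟨_, _⟩, ⟨⟨_, ⟨t, ht', rfl⟩, rfl⟩, ⟨s, hs', rfl⟩⟩, rfl⟩, rfl⟩
    exact ⟨(t, s), ⟨ht', hs'⟩, by simp [H]⟩

end Crossing

section Patch

variable {S : Type*} [TopologicalSpace S] [T2Space S] {j : ℂ → S}

theorem isPreconnected_compl_image_ball [PreconnectedSpace S] (hj : IsOpenEmbedding j) {r : ℝ}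
    (hr : 0 < r) : IsPreconnected (j '' Metric.ball 0 r)ᶜ := by
  have hV : IsOpen (j '' Metric.ball 0 r) := hj.isOpenMap _ Metric.isOpen_ball
  have hcl : IsClosed (j '' Metric.closedBall 0 r) :=
    ((isCompact_closedBall _ _).image hj.continuous).isClosed
  have hsph : IsPreconnected (j '' Metric.sphere 0 r) :=
    (isPreconnected_sphere (by
      rw [← Module.finrank_eq_rank, Complex.finrank_real_complex]; norm_num) _ _).image _
      hj.continuous.continuousOn
  have hsub : j '' Metric.sphere 0 r ⊆ (j '' Metric.ball 0 r)ᶜ := by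
    rintro _ ⟨z, hz, rfl⟩ ⟨w, hw, h⟩
    rw [hj.injective h] at hw
    exact Metric.sphere_disjoint_ball.le_bot ⟨hz, hw⟩
  have key : ∀ A B : Set S, IsClosed A → IsClosed B → (j '' Metric.ball 0 r)ᶜ = A ∪ B →
      Disjoint A B → j '' Metric.sphere 0 r ⊆ A → B = ∅ := by
    intro A B hA hB hAB hd hsA
    have hBo : IsOpen B := by
      have : Bᶜ = A ∪ j '' Metric.closedBall 0 r := by
        ext x
        have hx : x ∈ (j '' Metric.ball 0 r)ᶜ ↔ x ∈ A ∪ B := by rw [hAB]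
        have h2 : x ∈ A → x ∉ B := fun h h' => hd.le_bot ⟨h, h'⟩
        have h3 : x ∈ j '' Metric.closedBall 0 r ↔
            x ∈ j '' Metric.ball 0 r ∨ x ∈ j '' Metric.sphere 0 r := by
          rw [← Metric.ball_union_sphere, image_union]; rfl
        have h4 : x ∈ j '' Metric.sphere 0 r → x ∈ A := fun h => hsA h
        simp only [mem_compl_iff, mem_union] at hx ⊢
        rw [h3]
        tauto
      rw [← isClosed_compl_iff, this]
      exact hA.union hcl
    rcases isClopen_iff.1 ⟨hB, hBo⟩ with h | h
    · exact h
    · have : j 0 ∈ (j '' Metric.ball 0 r)ᶜ := hAB ▸ Or.inr (h ▸ mem_univ _)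
      exact absurd (mem_image_of_mem j (Metric.mem_ball_self hr)) this
  rw [isPreconnected_iff_subset_of_disjoint_closed]
  intro u v hu hv huv hd
  have hC := hV.isClosed_compl
  have hd' : Disjoint ((j '' Metric.ball 0 r)ᶜ ∩ u) ((j '' Metric.ball 0 r)ᶜ ∩ v) := by
    rw [disjoint_iff_inter_eq_empty, ← inter_inter_distrib_left]; exact hd
  have hun : (j '' Metric.ball 0 r)ᶜ = (j '' Metric.ball 0 r)ᶜ ∩ u ∪ (j '' Metric.ball 0 r)ᶜ ∩ v := by
    rw [← inter_union_distrib_left, inter_eq_left.2 huv]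
  rcases (isPreconnected_iff_subset_of_disjoint_closed.1 hsph) u v hu hv (hsub.trans huv)
    (subset_empty_iff.1 (by rw [← hd]; gcongr)) with h | h
  · have := key _ _ (hC.inter hu) (hC.inter hv) hun hd' (subset_inter hsub h)
    left
    rw [this, union_empty] at hun
    exact fun x hx => (hun ▸ hx : x ∈ _ ∩ u).2
  · have := key _ _ (hC.inter hv) (hC.inter hu) (by rw [union_comm]; exact hun) hd'.symm
      (subset_inter hsub h)
    right
    rw [this, empty_union] at hun
    exact fun x hx => (hun ▸ hx : x ∈ _ ∩ v).2

/-- A planar fixed point criterion. -/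
theorem exists_fixedPoint_of_quadrilaterals [PreconnectedSpace S] [MeasurableSpace S] [BorelSpace S]
    {μ : Measure S} (hj : IsOpenEmbedding j) {r : ℝ} (hr : 0 < r)
    (hμ : μ (j '' Metric.ball 0 r) < μ (j '' Metric.ball 0 r)ᶜ) (G : S ≃ₜ S)
    (hG : MeasurePreserving G μ μ) {γ Γ : Fin 4 → ℝ → ℂ}
    (hγ : ∀ k, ContinuousOn (γ k) (Icc 0 1)) (hΓ : ∀ k, ContinuousOn (Γ k) (Icc 0 1))
    (hγr : ∀ k, MapsTo (γ k) (Icc 0 1) (Metric.ball 0 r))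
    (hΓr : ∀ k, MapsTo (Γ k) (Icc 0 1) (Metric.ball 0 r))
    (hγc : ∀ k, γ k 1 = γ (k + 1) 0) (hΓc : ∀ k, Γ k 1 = Γ (k + 1) 0)
    (hGγ : ∀ k, ∀ t ∈ Icc (0 : ℝ) 1, G (j (γ k t)) = j (Γ k t))
    (hdisj : ∀ k l : Fin 4, l ≤ k → ¬ (k = 2 ∧ l = 1) → ∀ t ∈ Icc (0 : ℝ) 1, ∀ s ∈ Icc (0 : ℝ) 1,
      Γ l s ≠ γ k t)
    (h₁ : Escapes (⋃ k, γ k '' Icc 0 1) (Γ 0 0)) (h₂ : Escapes (⋃ k, Γ k '' Icc 0 1) (γ 0 0))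
    (h0 : boundaryInc (fun z => Γ 1 z.2 - γ 2 z.1) 0 1 0 1 ≠ 0) :
    ∃ z ∈ Metric.ball (0 : ℂ) r, G (j z) = j z := by
  by_contra! hfix
  set Q := ⋃ k, γ k '' Icc 0 1 with hQ
  have hQc : IsCompact Q := isCompact_iUnion fun k => isCompact_Icc.image_of_continuousOn (hγ k)
  have hQ'c : IsCompact (⋃ k, Γ k '' Icc 0 1) :=
    isCompact_iUnion fun k => isCompact_Icc.image_of_continuousOn (hΓ k)
  set K := planeFill Q with hK
  have hKc : IsCompact K := isCompact_planeFill hQc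
  have hQr : Q ⊆ Metric.ball 0 r := iUnion_subset fun k => (hγr k).image_subset
  have h0r : (0 : ℂ) ∈ Metric.ball (0 : ℂ) r := Metric.mem_ball_self hr
  have hKr : K ⊆ Metric.ball 0 r :=
    planeFill_subset_of_starConvex ((convex_ball (0 : ℂ) r).starConvex h0r) h0r hQr
  set V := j '' Metric.ball 0 r with hV
  have hfr : frontier (G '' (j '' K)) ⊆ V := by
    rw [← G.image_frontier]
    have : frontier (j '' K) ⊆ j '' Q := by
      intro x hx
      have hxK : x ∈ j '' K := (hKc.image hj.continuous).isClosed.frontier_subset hx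
      obtain ⟨z, hz, rfl⟩ := hxK
      refine ⟨z, frontier_planeFill_subset hQc ⟨subset_closure hz, fun hi => hx.2 ?_⟩, rfl⟩
      exact (hj.isOpenMap.image_interior_subset _) (mem_image_of_mem _ hi)
    rintro _ ⟨x, hx, rfl⟩
    obtain ⟨z, hz, rfl⟩ := this hx
    obtain ⟨k, t, ht, rfl⟩ := mem_iUnion.1 hz
    rw [hGγ k t ht]
    exact mem_image_of_mem _ (hΓr k ht)
  have hGK : G '' (j '' K) ⊆ V := by
    by_contra hcon
    obtain ⟨x, hx, hxV⟩ := not_subset.1 hcon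
    have hsub : Vᶜ ⊆ G '' (j '' K) := by
      by_contra hns
      obtain ⟨y, hy, hyK⟩ := not_subset.1 hns
      have hcl : IsClosed (G '' (j '' K)) := ((hKc.image hj.continuous).image G.continuous).isClosed
      have hmem_int : ∀ w ∈ Vᶜ, w ∈ G '' (j '' K) → w ∈ interior (G '' (j '' K)) := fun w hw hwK => by
        by_contra hwi
        exact hw (hfr ⟨subset_closure hwK, hwi⟩)
      obtain ⟨z, -, hz, hz'⟩ := isPreconnected_compl_image_ball hj hr _ _ isOpen_interior
        hcl.isOpen_compl (fun w hw => (em (w ∈ G '' (j '' K))).imp (hmem_int w hw) id)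
        ⟨x, hxV, hmem_int x hxV hx⟩ ⟨y, hy, hyK⟩
      exact hz' (interior_subset hz)
    have : μ (G '' (j '' K)) = μ (j '' K) := by
      rw [← hG.measure_preimage_equiv (f := G.toMeasurableEquiv)]
      congr 1
      exact G.injective.preimage_image _
    have hle : μ Vᶜ ≤ μ V := (measure_mono hsub).trans (this.le.trans (measure_mono (image_mono hKr)))
    exact absurd hμ hle.not_gt
  let κ : S → ℂ := invFun j
  have hκ : ∀ z, κ (j z) = z := leftInverse_invFun hj.injective
  have hκc : ContinuousOn κ (range j) := by
    rintro _ ⟨z, rfl⟩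
    refine ContinuousAt.continuousWithinAt ?_
    rw [hj.continuousAt_iff (f := j) |>.symm]
    have : κ ∘ j = id := funext hκ
    rw [this]
    exact continuousAt_id
  have hf : ContinuousOn (fun z => κ (G (j z)) - z) K := by
    refine ContinuousOn.sub (hκc.comp (G.continuous.comp hj.continuous).continuousOn fun z hz => ?_)
      continuousOn_id
    exact image_subset_range _ _ (hGK (mem_image_of_mem _ (mem_image_of_mem _ hz)))
  have hf0 : ∀ z ∈ K, κ (G (j z)) - z ≠ 0 := by
    intro z hz h
    obtain ⟨w, hw, hwz⟩ := hGK (mem_image_of_mem G (mem_image_of_mem j hz))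
    rw [← hwz, hκ, sub_eq_zero] at h
    exact hfix z (hKr hz) (by rw [← hwz, h])
  have hlog := HasLogOn.of_forall_escapes hKc (fun c hc => (not_not.1 hc : Escapes Q c).planeFill)
    hf hf0
  refine h0 (boundaryInc_eq_zero_of_quadrilaterals hγ hΓ hγc hΓc hdisj
    (hlog.mono (subset_planeFill Q)) (fun k t ht => ?_) (h₁.hasLogOn hQc) (h₂.hasLogOn hQ'c))
  rw [hGγ k t ht, hκ]

end Patch

section Patches

variable {S : Type} [TopologicalSpace S]

/-- Every point has a small planar neighbourhood, star-convex in suitable coordinates. -/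
theorem exists_planar_patch [T1Space S] [ChartedSpace (EuclideanHalfSpace 2) S] {x y : S}
    (hxy : x ≠ y) :
    ∃ N : Set S, IsOpen N ∧ x ∈ N ∧ y ∉ N ∧ ∃ (κ : S → ℂ) (ι : ℂ → S), ContinuousOn κ N ∧
      ContinuousOn ι (κ '' N) ∧ LeftInvOn ι κ N ∧ StarConvex ℝ 0 (κ '' N) ∧ 0 ∈ κ '' N := by
  let e := chartAt (EuclideanHalfSpace 2) x
  let φ : EuclideanHalfSpace 2 → ℂ := fun h => ⟨h.1 0, h.1 1⟩
  let φ' : ℂ → EuclideanHalfSpace 2 := fun z => ⟨!₂[max z.re 0, z.im], by simp⟩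
  have hφc : Continuous φ := Complex.equivRealProdCLM.symm.continuous.comp
    (by fun_prop : Continuous fun h : EuclideanHalfSpace 2 => (h.1 0, h.1 1))
  have hφ'c : Continuous φ' := by
    refine Continuous.subtype_mk ?_ _
    fun_prop
  have hφ' : ∀ h, φ' (φ h) = h := by
    intro h
    apply Subtype.ext
    ext i
    fin_cases i
    · have := h.2
      simp [φ, φ', this]
    · simp [φ, φ']
  have hφφ' : ∀ z : ℂ, 0 ≤ z.re → φ (φ' z) = z := by
    intro z hz
    apply Complex.ext <;> simp [φ, φ', hz]
  let O : Set (EuclideanHalfSpace 2) := e.target ∩ e.symm ⁻¹' {y}ᶜ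
  have hO : IsOpen O := e.isOpen_inter_preimage_symm isOpen_compl_singleton
  have hxs : x ∈ e.source := mem_chart_source _ x
  have hxO : e x ∈ O := ⟨e.map_source hxs, by simpa [e.left_inv hxs] using hxy⟩
  let w := φ (e x)
  have hpre : φ' ⁻¹' O ∈ 𝓝 w :=
    hφ'c.continuousAt.preimage_mem_nhds (hO.mem_nhds (by rw [hφ']; exact hxO))
  obtain ⟨r, hr, hball⟩ := Metric.mem_nhds_iff.1 hpre
  refine ⟨e.source ∩ e ⁻¹' (φ ⁻¹' Metric.ball w r),
    e.isOpen_inter_preimage (Metric.isOpen_ball.preimage hφc), ⟨hxs, Metric.mem_ball_self hr⟩,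
    fun hy => ?_, fun z => φ (e z) - w, fun z => e.symm (φ' (z + w)), ?_, ?_, ?_, ?_, ?_⟩
  · have : φ' (φ (e y)) ∈ O := hball hy.2
    rw [hφ'] at this
    exact this.2 (e.left_inv hy.1)
  · exact ((hφc.comp_continuousOn e.continuousOn).sub continuousOn_const).mono inter_subset_left
  · refine e.continuousOn_symm.comp (hφ'c.comp (by fun_prop)).continuousOn ?_
    rintro _ ⟨z, hz, rfl⟩
    simpa [hφ'] using e.map_source hz.1
  · intro z hz
    simp only [sub_add_cancel, hφ']
    exact e.left_inv hz.1
  · have himg : (fun z => φ (e z) - w) '' (e.source ∩ e ⁻¹' (φ ⁻¹' Metric.ball w r)) =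
        Metric.ball 0 r ∩ {z | 0 ≤ z.re + w.re} := by
      ext z
      constructor
      · rintro ⟨x', hx', rfl⟩
        refine ⟨by simpa [dist_eq_norm] using hx'.2, ?_⟩
        have := (e x').2
        simpa [φ] using this
      · rintro ⟨hz, hz'⟩
        have hz'' : 0 ≤ (z + w).re := hz'
        have hb : z + w ∈ Metric.ball w r := by simpa [dist_eq_norm] using hz
        have hmem := (hball hb).1
        refine ⟨e.symm (φ' (z + w)), ⟨e.map_target hmem, ?_⟩, ?_⟩
        · rw [mem_preimage, mem_preimage, e.right_inv hmem, hφφ' _ hz'']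
          exact hb
        · simp only [e.right_inv hmem, hφφ' _ hz'', add_sub_cancel_right]
    rw [himg]
    refine ((convex_ball (0 : ℂ) r).inter ?_).starConvex ⟨Metric.mem_ball_self hr, ?_⟩
    · have hset : {z : ℂ | 0 ≤ z.re + w.re} = {z : ℂ | -w.re ≤ Complex.reLm z} := by
        ext z
        show 0 ≤ z.re + w.re ↔ -w.re ≤ z.re
        constructor <;> intro h <;> linarith
      rw [hset]
      exact convex_halfSpace_ge Complex.reLm.isLinear _
    · have := (e x).2
      simpa [φ, w] using this
  · exact ⟨x, ⟨hxs, Metric.mem_ball_self hr⟩, by simp [w]⟩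

theorem metrizableSpace_of_halfSpace [T2Space S] [CompactSpace S]
    [ChartedSpace (EuclideanHalfSpace 2) S] : TopologicalSpace.MetrizableSpace S := by
  have : SecondCountableTopology (EuclideanHalfSpace 2) :=
    inferInstanceAs (SecondCountableTopology {x : EuclideanSpace ℝ (Fin 2) // 0 ≤ x 0})
  have : SecondCountableTopology S :=
    ChartedSpace.secondCountable_of_sigmaCompact (EuclideanHalfSpace 2) S
  infer_instance

end Patches

section Trap

variable {S : Type} [TopologicalSpace S]

/-- Two arcs with common endpoints inside a planar patch bound an open set. -/
theorem exists_open_of_arcs_in_patch [T2Space S] {N : Set S} (hN : IsOpen N) {y : S} (hy : y ∉ N)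
    {κ : S → ℂ} {ι : ℂ → S} (hκ : ContinuousOn κ N) (hι : ContinuousOn ι (κ '' N))
    (hικ : LeftInvOn ι κ N) (hstar : StarConvex ℝ 0 (κ '' N)) (h0N : 0 ∈ κ '' N)
    {p q : ℝ → S} (hp : ContinuousOn p (Icc 0 1)) (hq : ContinuousOn q (Icc 0 1))
    (hpi : InjOn p (Icc 0 1)) (hqi : InjOn q (Icc 0 1)) (hpN : MapsTo p (Icc 0 1) N)
    (hqN : MapsTo q (Icc 0 1) N) (h0 : p 0 = q 0) (h1 : p 1 = q 1)
    (hpq : ∀ s ∈ Icc (0 : ℝ) 1, ∀ t ∈ Icc (0 : ℝ) 1, p s = q t →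
      (s = 0 ∧ t = 0) ∨ (s = 1 ∧ t = 1)) :
    ∃ O : Set S, IsOpen O ∧ O.Nonempty ∧ IsClosed (O ∪ (p '' Icc 0 1 ∪ q '' Icc 0 1)) ∧
      O ∪ (p '' Icc 0 1 ∪ q '' Icc 0 1) ≠ univ := by
  have hκi : InjOn κ N := hικ.injOn
  obtain ⟨c, hc, hcE⟩ := exists_not_escapes_of_arcs (hκ.comp hp hpN) (hκ.comp hq hqN)
    (hκi.comp hpi hpN) (hκi.comp hqi hqN) (congrArg κ h0) (congrArg κ h1)
    (fun s hs t ht h => hpq s hs t ht (hκi (hpN hs) (hqN ht) h))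
  set Q : Set ℂ := (κ ∘ p) '' Icc 0 1 ∪ (κ ∘ q) '' Icc 0 1 with hQ
  set C : Set S := p '' Icc 0 1 ∪ q '' Icc 0 1 with hC
  have hCN : C ⊆ N := union_subset hpN.image_subset hqN.image_subset
  have hQC : Q = κ '' C := by rw [hQ, hC, image_union, image_comp, image_comp]
  have hQc : IsCompact Q := (isCompact_Icc.image_of_continuousOn (hκ.comp hp hpN)).union
    (isCompact_Icc.image_of_continuousOn (hκ.comp hq hqN))
  have hfill : planeFill Q ⊆ κ '' N :=
    planeFill_subset_of_starConvex hstar h0N (hQC ▸ image_mono hCN)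
  have hopen : IsOpen (planeFill Q \ Q) := by
    rw [isOpen_iff_mem_nhds]
    intro z hz
    have hz' : z ∈ interior (planeFill Q) := by
      by_contra h
      exact hz.2 (frontier_planeFill_subset hQc ⟨subset_closure hz.1, h⟩)
    exact inter_mem (mem_interior_iff_mem_nhds.1 hz') (hQc.isClosed.isOpen_compl.mem_nhds hz.2)
  have hOC : N ∩ κ ⁻¹' (planeFill Q \ Q) ∪ C = ι '' planeFill Q := by
    ext z
    constructor
    · rintro (⟨hzN, hz⟩ | hz)
      · exact ⟨κ z, hz.1, hικ hzN⟩
      · exact ⟨κ z, subset_planeFill Q (hQC ▸ mem_image_of_mem κ hz), hικ (hCN hz)⟩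
    · rintro ⟨w, hw, rfl⟩
      obtain ⟨z, hzN, rfl⟩ := hfill hw
      rw [hικ hzN]
      by_cases hzQ : κ z ∈ Q
      · rw [hQC] at hzQ
        obtain ⟨z', hz', hzz⟩ := hzQ
        exact Or.inr (hκi (hCN hz') hzN hzz ▸ hz')
      · exact Or.inl ⟨hzN, hw, hzQ⟩
  refine ⟨N ∩ κ ⁻¹' (planeFill Q \ Q), hκ.isOpen_inter_preimage hN hopen, ?_, ?_, ?_⟩
  · obtain ⟨z, hzN, rfl⟩ := hfill (show c ∈ planeFill Q from hcE)
    exact ⟨z, hzN, hcE, hc⟩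
  · rw [hOC]
    exact ((isCompact_planeFill hQc).image_of_continuousOn (hι.mono hfill)).isClosed
  · intro h
    rw [hOC] at h
    obtain ⟨w, hw, hwy⟩ := h.symm ▸ mem_univ y
    obtain ⟨z, hzN, rfl⟩ := hfill hw
    exact hy (by rwa [← hwy, hικ hzN])

/-- A dense connected set cannot avoid the boundary of a non-trivial open set. -/
theorem not_dense_of_isClosed_union {O C ℓ : Set S} (hO : IsOpen O) (hOn : O.Nonempty)
    (hOC : IsClosed (O ∪ C)) (hne : O ∪ C ≠ univ) (hℓ : IsPreconnected ℓ) (hd : Disjoint ℓ C) :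
    ¬ Dense ℓ := by
  intro hdense
  obtain ⟨z, hzO, hzℓ⟩ := hdense.inter_open_nonempty O hO hOn
  have hsub : ℓ ⊆ O := by
    refine hℓ.subset_left_of_subset_union hO hOC.isOpen_compl ?_ ?_ ⟨z, hzℓ, hzO⟩
    · exact disjoint_left.2 fun w hw hw' => hw' (Or.inl hw)
    · intro w hw
      by_cases hwO : w ∈ O
      · exact Or.inl hwO
      · exact Or.inr fun h => h.elim hwO (disjoint_left.1 hd hw)
  refine hne (eq_univ_of_univ_subset ?_)
  rw [← hdense.closure_eq]
  exact closure_minimal (hsub.trans subset_union_left) hOC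

end Trap

section Arcs

variable {S : Type} [TopologicalSpace S]

theorem isArcIn_uIcc {ℓ : Set S} {f : ℝ → S} (hf : Continuous f) (hfi : Injective f)
    (hr : range f = ℓ) (s t : ℝ) : IsArcIn ℓ (f '' uIcc s t) (f s) (f t) := by
  rcases le_total s t with h | h
  · exact ⟨f, hf, hfi, hr, s, t, h, rfl, rfl, by rw [uIcc_of_le h]⟩
  · refine ⟨fun u => f (-u), hf.comp continuous_neg, hfi.comp neg_injective, ?_, -s, -t,
      neg_le_neg h, by simp, by simp, ?_⟩
    · rw [← hr]
      exact (Equiv.neg ℝ).surjective.range_comp f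
    · rw [uIcc_of_ge h, ← image_neg_Icc, image_image]
      simp

theorem IsArcIn.subset {ℓ A : Set S} {x y : S} (h : IsArcIn ℓ A x y) : A ⊆ ℓ := by
  obtain ⟨f, -, -, rfl, a, b, -, -, -, rfl⟩ := h
  exact image_subset_range _ _

theorem IsArcIn.isCompact {ℓ A : Set S} {x y : S} (h : IsArcIn ℓ A x y) : IsCompact A := by
  obtain ⟨f, hf, -, -, a, b, -, -, -, rfl⟩ := h
  exact isCompact_Icc.image hf

theorem IsArcIn.image {ℓ A : Set S} {x y : S} (h : IsArcIn ℓ A x y) (H : S ≃ₜ S) :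
    IsArcIn (H '' ℓ) (H '' A) (H x) (H y) := by
  obtain ⟨f, hf, hfi, rfl, a, b, hab, rfl, rfl, rfl⟩ := h
  exact ⟨H ∘ f, H.continuous.comp hf, H.injective.comp hfi, range_comp _ _, a, b, hab, rfl, rfl,
    by rw [image_comp]⟩

theorem IsImmersedLine.isPreconnected {ℓ : Set S} (h : IsImmersedLine ℓ) : IsPreconnected ℓ := by
  obtain ⟨f, hf, -, rfl⟩ := h
  exact isPreconnected_range hf

/-- Arcs of `ℓ` are determined by their endpoints. -/
def UniqueArcs (ℓ : Set S) : Prop :=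
  ∀ A B : Set S, ∀ x y : S, IsArcIn ℓ A x y → IsArcIn ℓ B x y → A = B

theorem isCompatibleMetric_dist (S : Type) [MetricSpace S] :
    IsCompatibleMetric S (fun x y : S => dist x y) := by
  refine ⟨dist_comm, fun x y => dist_eq_zero, dist_triangle, fun s => ?_⟩
  rw [Metric.isOpen_iff]
  refine forall₂_congr fun x _ => exists_congr fun ε => and_congr_right fun _ => ?_
  simp [subset_def, Metric.mem_ball, dist_comm]

/-- A streamline whose arcs are contracted by homeomorphisms has unique arcs. -/
theorem uniqueArcs_of_contracting [T2Space S] [CompactSpace S]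
    [ChartedSpace (EuclideanHalfSpace 2) S] [MeasurableSpace S] {μ : Measure S}
    (T : MeasuredTurbulation μ) (hT : T.Tame) (hd : T.DenseStreamlines)
    (hne : ∀ ℓ ∈ T.lines, ∃ ℓ' ∈ T.lines, ℓ' ≠ ℓ) {ℓ : Set S} (H : ℕ → S ≃ₜ S)
    (hH : ∀ k, H k '' ℓ ∈ T.lines)
    (hc : ∀ A x y, IsArcIn ℓ A x y → Tendsto (fun k => T.ν (H k '' ℓ) (H k '' A)) atTop (𝓝 0)) :
    UniqueArcs ℓ := by
  have := metrizableSpace_of_halfSpace (S := S)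
  let _ := TopologicalSpace.metrizableSpaceMetric S
  suffices hsub : ∀ A B : Set S, ∀ x y : S, IsArcIn ℓ A x y → IsArcIn ℓ B x y → A ⊆ B from
    fun A B x y hA hB => (hsub A B x y hA hB).antisymm (hsub B A x y hB hA)
  intro A B x y hA hB
  have hBc : IsClosed B := hB.isCompact.isClosed
  have hA0 := hA
  have hB0 := hB
  obtain ⟨f, hf, hfi, hfr, a, b, hab, rfl, rfl, rfl⟩ := hA
  obtain ⟨g, hg, hgi, hgr, c, d, hcd, hgc, hgd, rfl⟩ := hB
  rintro _ ⟨t, ht, rfl⟩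
  by_contra htB
  obtain ⟨a', ⟨ha', ha't⟩, ha'max⟩ := (isCompact_Icc.inter_right (hBc.preimage hf) :
    IsCompact (Icc a t ∩ f ⁻¹' (g '' Icc c d))).exists_isGreatest
    ⟨a, ⟨le_rfl, ht.1⟩, c, ⟨le_rfl, hcd⟩, hgc⟩
  obtain ⟨b', ⟨hb', hb't⟩, hb'min⟩ := (isCompact_Icc.inter_right (hBc.preimage hf) :
    IsCompact (Icc t b ∩ f ⁻¹' (g '' Icc c d))).exists_isLeast
    ⟨b, ⟨ht.2, le_rfl⟩, d, ⟨hcd, le_rfl⟩, hgd⟩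
  have hat : a' < t := lt_of_le_of_ne ha'.2 fun h => htB (h ▸ ha't)
  have htb : t < b' := lt_of_le_of_ne hb'.1 fun h => htB (h.symm ▸ hb't)
  obtain ⟨c', hc', hgc'⟩ := ha't
  obtain ⟨d', hd', hgd'⟩ := hb't
  have hgap : ∀ s ∈ Icc a' b', f s ∈ g '' Icc c d → s = a' ∨ s = b' := by
    intro s hs hsB
    rcases le_total s t with h | h
    · exact Or.inl (le_antisymm (ha'max ⟨⟨ha'.1.trans hs.1, h⟩, hsB⟩) hs.1)
    · exact Or.inr (le_antisymm hs.2 (hb'min ⟨⟨h, hs.2.trans hb'.2⟩, hsB⟩))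
  have hab' : b' - a' ≠ 0 := (sub_pos.2 (hat.trans htb)).ne'
  have hcd' : d' - c' ≠ 0 := by
    intro h
    rw [sub_eq_zero.1 h, hgc'] at hgd'
    exact hab' (sub_eq_zero.2 (hfi hgd').symm)
  let p : ℝ → S := fun s => f (a' + s * (b' - a'))
  let q : ℝ → S := fun s => g (c' + s * (d' - c'))
  have hpmem : ∀ s ∈ Icc (0 : ℝ) 1, a' + s * (b' - a') ∈ Icc a' b' := fun s hs =>
    ⟨by nlinarith [hs.1], by nlinarith [hs.2]⟩
  have hqmem : ∀ s ∈ Icc (0 : ℝ) 1, c' + s * (d' - c') ∈ Icc c d := fun s hs =>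
    ⟨by nlinarith [hs.1, hs.2, hc'.1, hd'.1], by nlinarith [hs.1, hs.2, hc'.2, hd'.2]⟩
  obtain ⟨x₀, y₀, hxy₀⟩ : ∃ x₀ y₀ : S, x₀ ≠ y₀ :=
    ⟨f a', f b', fun h => hab' (sub_eq_zero.2 (hfi h).symm)⟩
  have hpatch : ∀ z : S, ∃ N : Set S, IsOpen N ∧ z ∈ N ∧ ∃ y, y ∉ N ∧ ∃ (κ : S → ℂ) (ι : ℂ → S),
      ContinuousOn κ N ∧ ContinuousOn ι (κ '' N) ∧ LeftInvOn ι κ N ∧ StarConvex ℝ 0 (κ '' N) ∧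
      0 ∈ κ '' N := by
    intro z
    obtain ⟨y, hy⟩ : ∃ y, z ≠ y := by
      by_cases h : z = x₀
      · exact ⟨y₀, h ▸ hxy₀⟩
      · exact ⟨x₀, h⟩
    obtain ⟨N, h1, h2, h3, h4⟩ := exists_planar_patch hy
    exact ⟨N, h1, h2, y, h3, h4⟩
  choose N hNo hzN hNrest using hpatch
  obtain ⟨ε, hε, hLeb⟩ := lebesgue_number_lemma_of_metric (isCompact_univ (X := S)) hNo
    (fun z _ => mem_iUnion.2 ⟨z, hzN z⟩)
  obtain ⟨δ, hδ, htame⟩ := hT _ (isCompatibleMetric_dist S) ε hε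
  have hδ' : 0 < ENNReal.ofReal δ := ENNReal.ofReal_pos.2 hδ
  obtain ⟨k, hkA, hkB⟩ := (((hc _ _ _ hA0).eventually_lt_const hδ').and
    ((hc _ _ _ hB0).eventually_lt_const hδ')).exists
  obtain ⟨z, hz⟩ := hLeb (H k (f a')) (mem_univ _)
  obtain ⟨y₁, hy₁, κ, ι, hκ, hι, hικ, hstar, h0⟩ := hNrest z
  have hpN : MapsTo (H k ∘ p) (Icc 0 1) (N z) := by
    intro s hs
    apply hz
    rw [Metric.mem_ball, dist_comm]
    refine htame _ (hH k) _ _ _ ((isArcIn_uIcc hf hfi hfr a' _).image (H k))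
      (lt_of_le_of_lt (measure_mono (image_mono (image_mono ?_))) hkA)
    rw [uIcc_of_le (hpmem s hs).1]
    exact Icc_subset_Icc ha'.1 ((hpmem s hs).2.trans hb'.2)
  have hqN : MapsTo (H k ∘ q) (Icc 0 1) (N z) := by
    intro s hs
    apply hz
    rw [Metric.mem_ball, dist_comm, ← hgc']
    refine htame _ (hH k) _ _ _ ((isArcIn_uIcc hg hgi hgr c' _).image (H k))
      (lt_of_le_of_lt (measure_mono (image_mono (image_mono ?_))) hkB)
    exact uIcc_subset_Icc hc' (hqmem s hs)
  have hpc : Continuous p := hf.comp (by fun_prop)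
  have hqc : Continuous q := hg.comp (by fun_prop)
  have hpi : Injective p := hfi.comp fun s t h => by
    simpa [hab'] using h
  have hqi : Injective q := hgi.comp fun s t h => by
    simpa [hcd'] using h
  have hp0 : p 0 = q 0 := by simp [p, q, hgc']
  have hp1 : p 1 = q 1 := by simp [p, q, hgd']
  obtain ⟨O, hO, hOn, hOC, hOu⟩ := exists_open_of_arcs_in_patch (hNo z) hy₁ hκ hι hικ hstar h0
    ((H k).continuous.comp hpc).continuousOn ((H k).continuous.comp hqc).continuousOn
    ((H k).injective.comp hpi).injOn ((H k).injective.comp hqi).injOn hpN hqN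
    (congrArg (H k) hp0) (congrArg (H k) hp1) (by
      intro s hs u hu hsu
      have hsu : p s = q u := (H k).injective hsu
      rcases hgap _ (hpmem s hs) (by
        rw [show f (a' + s * (b' - a')) = q u from hsu]
        exact mem_image_of_mem g (hqmem u hu)) with h | h
      · have hs0 : s = 0 := by simpa [hab'] using h
        subst hs0
        exact Or.inl ⟨rfl, (hqi (hp0.symm.trans hsu)).symm⟩
      · have hs1 : s = 1 := by
          have : (s - 1) * (b' - a') = 0 := by linarith
          rcases mul_eq_zero.1 this with h | h
          · linarith
          · exact absurd h hab'
        subst hs1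
        exact Or.inr ⟨rfl, (hqi (hp1.symm.trans hsu)).symm⟩)
  obtain ⟨ℓ', hℓ', hℓne⟩ := hne _ (hH k)
  refine not_dense_of_isClosed_union hO hOn hOC hOu (T.lines_immersed _ hℓ').isPreconnected ?_
    (hd _ hℓ')
  refine (T.lines_disjoint hℓ' (hH k) hℓne).mono_right ?_
  rw [← hfr]
  rintro _ (⟨s, -, rfl⟩ | ⟨s, -, rfl⟩)
  · exact ⟨_, mem_range_self _, rfl⟩
  · exact ⟨_, by rw [hfr, ← hgr]; exact mem_range_self _, rfl⟩

end Arcs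

section Sfinite

variable {S : Type} [TopologicalSpace S] [MeasurableSpace S] {μ : Measure S}

theorem MeasuredTurbulation.sigmaFinite (T : MeasuredTurbulation μ) {ℓ : Set S} (hℓ : ℓ ∈ T.lines) :
    SigmaFinite (T.ν ℓ) := by
  obtain ⟨f, hf, hfi, hfr⟩ := T.lines_immersed ℓ hℓ
  refine Measure.FiniteSpanningSetsIn.sigmaFinite (C := univ)
    ⟨fun n => f '' Icc (-(n : ℝ)) n ∪ ℓᶜ, fun _ => mem_univ _, fun n => ?_, ?_⟩
  · have h := T.ν_arc_finite ℓ hℓ _ _ _ ⟨f, hf, hfi, hfr, -n, n, by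
      linarith [(Nat.cast_nonneg n : (0 : ℝ) ≤ n)], rfl, rfl, rfl⟩
    refine (measure_union_le _ _).trans_lt ?_
    rw [T.ν_supported ℓ hℓ, add_zero]
    exact h
  · refine eq_univ_of_forall fun z => mem_iUnion.2 ?_
    by_cases hz : z ∈ ℓ
    · rw [← hfr] at hz
      obtain ⟨t, rfl⟩ := hz
      obtain ⟨n, hn⟩ := exists_nat_ge |t|
      exact ⟨n, Or.inl ⟨t, abs_le.1 hn, rfl⟩⟩
    · exact ⟨0, Or.inr hz⟩

theorem IsArcIn.measure_lt_top {T : MeasuredTurbulation μ} {ℓ A : Set S} {x y : S}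
    (h : IsArcIn ℓ A x y) (hℓ : ℓ ∈ T.lines) : T.ν ℓ A < ⊤ := T.ν_arc_finite ℓ hℓ A x y h

end Sfinite

namespace Tartan

variable {S : Type} [TopologicalSpace S] [MeasurableSpace S] {μ : Measure S}
  {Ts Tu : MeasuredTurbulation μ}

/-- The tartan with the roles of stable and unstable fibers exchanged. -/
def swap (R : Tartan Ts Tu) : Tartan Tu Ts where
  Rs := R.Ru
  Ru := R.Rs
  borel_s := R.borel_u
  borel_u := R.borel_s
  fibs := R.fibu
  fibu := R.fibs
  fibs_disjoint := R.fibu_disjoint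
  fibu_disjoint := R.fibs_disjoint
  fibs_cover := R.fibu_cover
  fibu_cover := R.fibs_cover
  inter_unique := fun A hA B hB => by
    rw [inter_comm]
    exact R.inter_unique B hB A hA
  oriented := by
    obtain ⟨os, ou, h1, h2, h3, h4⟩ := R.oriented
    exact ⟨ou, os, h2, h1, h4, h3⟩
  bounded := by
    obtain ⟨L, hL, h1, h2⟩ := R.bounded
    exact ⟨L, hL, h2, h1⟩
  in_disk := by
    obtain ⟨U, hU, h, hd⟩ := R.in_disk
    exact ⟨U, hU, by rwa [union_comm], hd⟩

theorem core_swap (R : Tartan Ts Tu) : R.swap.core = R.core := inter_comm _ _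

theorem exists_fibs_line (R : Tartan Ts Tu) {A : Set S} (hA : A ∈ R.fibs) :
    ∃ ℓ ∈ Ts.lines, IsArc ℓ A := by
  obtain ⟨os, ou, h1, -⟩ := R.oriented
  obtain ⟨ℓ, hℓ, f, hf, hfi, hfr, a, b, hab, hA', -⟩ := h1 A hA
  exact ⟨ℓ, hℓ, _, _, f, hf, hfi, hfr, a, b, hab, rfl, rfl, hA'⟩

theorem eq_of_mem_fibs (R : Tartan Ts Tu) {A B : Set S} (hA : A ∈ R.fibs) (hB : B ∈ R.fibs) {x : S}
    (hxA : x ∈ A) (hxB : x ∈ B) : A = B := by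
  by_contra h
  exact disjoint_left.1 (R.fibs_disjoint hA hB h) hxA hxB

theorem mem_core_of_mem (R : Tartan Ts Tu) {A B : Set S} (hA : A ∈ R.fibs) (hB : B ∈ R.fibu) {x : S}
    (hxA : x ∈ A) (hxB : x ∈ B) : x ∈ R.core := by
  refine ⟨?_, ?_⟩
  · rw [← R.fibs_cover]
    exact ⟨A, hA, hxA⟩
  · rw [← R.fibu_cover]
    exact ⟨B, hB, hxB⟩

theorem exists_fibers_of_mem_core (R : Tartan Ts Tu) {x : S} (hx : x ∈ R.core) :
    ∃ A ∈ R.fibs, ∃ B ∈ R.fibu, x ∈ A ∧ x ∈ B := by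
  obtain ⟨h1, h2⟩ := hx
  rw [← R.fibs_cover] at h1
  rw [← R.fibu_cover] at h2
  obtain ⟨A, hA, hxA⟩ := h1
  obtain ⟨B, hB, hxB⟩ := h2
  exact ⟨A, hA, B, hB, hxA, hxB⟩

theorem measurableSet_core (R : Tartan Ts Tu) : MeasurableSet R.core := R.borel_s.inter R.borel_u

theorem Compatible.swap {R : Tartan Ts Tu} (hR : R.Compatible) : R.swap.Compatible := by
  intro 𝔲 h𝔲 𝔰 h𝔰 ℓu hℓu h𝔲ℓ ℓs hℓs h𝔰ℓ
  obtain ⟨ψ, h1, h2, h3, h4, h5, h6⟩ := hR 𝔰 h𝔰 𝔲 h𝔲 ℓs hℓs h𝔰ℓ ℓu hℓu h𝔲ℓ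
  have := Ts.sigmaFinite hℓs
  have := Tu.sigmaFinite hℓu
  rw [core_swap]
  refine ⟨ψ ∘ Prod.swap, ?_, ?_, ?_, h4.comp measurable_swap, ?_, ?_⟩
  · intro x hx y hy B hB hxB A hA hyA
    rw [inter_comm]
    exact h1 y hy x hx A hA hyA B hB hxB
  · refine h2.comp Prod.swap_injective.injOn ?_
    rintro ⟨x, y⟩ ⟨hx, hy⟩
    exact ⟨hy, hx⟩
  · rw [image_comp, image_swap_prod, h3]
  · intro E hE hEm
    rw [image_comp]
    refine h5 _ ?_ ?_
    · rw [← image_swap_prod]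
      exact image_mono hE
    · exact MeasurableEquiv.prodComm.measurableEmbedding.measurableSet_image.2 hEm
  · rw [← Measure.map_map h4 measurable_swap, Measure.prod_swap, h6]

end Tartan

section Images

variable {X S : Type*} [MeasurableSpace X] [StandardBorelSpace X] [MeasurableSpace S]
  [MeasurableSpace.CountablySeparated S]

theorem measure_image_eq_of_map_eq_restrict {m : Measure X} {μ : Measure S} {φ : X → S}
    (hφ : Measurable φ) {D : Set X} (hD : m Dᶜ = 0) (hi : InjOn φ D) {C : Set S}
    (hm : Measure.map φ m = μ.restrict C) (hDC : φ '' D ⊆ C) {E : Set X} (hE : E ⊆ D)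
    (hEm : MeasurableSet E) : MeasurableSet (φ '' E) ∧ μ (φ '' E) = m E := by
  have hmeas : MeasurableSet (φ '' E) := hEm.image_of_measurable_injOn hφ (hi.mono hE)
  refine ⟨hmeas, ?_⟩
  have h1 : μ (φ '' E) = m (φ ⁻¹' (φ '' E)) := by
    rw [← Measure.map_apply hφ hmeas, hm, Measure.restrict_apply hmeas,
      inter_eq_left.2 ((image_mono hE).trans hDC)]
  rw [h1]
  refine le_antisymm ?_ (measure_mono (subset_preimage_image φ E))
  calc m (φ ⁻¹' (φ '' E)) ≤ m (E ∪ Dᶜ) := by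
        refine measure_mono ?_
        rintro x ⟨y, hy, hxy⟩
        by_cases hx : x ∈ D
        · exact Or.inl (hi (hE hy) hx hxy ▸ hy)
        · exact Or.inr hx
    _ ≤ m E + m Dᶜ := measure_union_le _ _
    _ = m E := by rw [hD, add_zero]

end Images

/-- A family of streamline arcs, indexed by `a ∈ A`, each meeting a common transversal family
indexed by `b ∈ B` in the points `pt a b`. -/
structure Comb {S : Type} [TopologicalSpace S] [MeasurableSpace S] {μ : Measure S}
    (T : MeasuredTurbulation μ) (A B : Set ℝ) (β : Measure ℝ) (pt : ℝ → ℝ → S) where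
  line : ℝ → Set S
  par : ℝ → ℝ → S
  lo : ℝ → ℝ
  hi : ℝ → ℝ
  pos : ℝ → ℝ → ℝ
  bd : ℝ≥0∞
  line_mem : ∀ a ∈ A, line a ∈ T.lines
  par_cont : ∀ a ∈ A, Continuous (par a)
  par_inj : ∀ a ∈ A, Injective (par a)
  par_range : ∀ a ∈ A, range (par a) = line a
  pos_mem : ∀ a ∈ A, ∀ b ∈ B, pos a b ∈ Icc (lo a) (hi a)
  pos_mono : ∀ a ∈ A, StrictMonoOn (pos a) B
  par_pos : ∀ a ∈ A, ∀ b ∈ B, par a (pos a b) = pt a b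
  measure_eq : ∀ a ∈ A, ∀ M ⊆ B, MeasurableSet M → T.ν (line a) (pt a '' M) = β M
  bd_lt : bd < ⊤
  measure_le : ∀ a ∈ A, T.ν (line a) (par a '' Icc (lo a) (hi a)) ≤ bd
  disj : ∀ a ∈ A, ∀ a' ∈ A, a ≠ a' → Disjoint (par a '' Icc (lo a) (hi a))
    ((par a') '' Icc (lo a') (hi a'))

namespace Comb

variable {S : Type} [TopologicalSpace S] [MeasurableSpace S] {μ : Measure S}
  {T : MeasuredTurbulation μ} {A B : Set ℝ} {β : Measure ℝ} {pt : ℝ → ℝ → S}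

/-- The `a`-th arc of a comb. -/
def fiber (C : Comb T A B β pt) (a : ℝ) : Set S := C.par a '' Icc (C.lo a) (C.hi a)

theorem pt_mem_fiber (C : Comb T A B β pt) {a b : ℝ} (ha : a ∈ A) (hb : b ∈ B) :
    pt a b ∈ C.fiber a := ⟨C.pos a b, C.pos_mem a ha b hb, C.par_pos a ha b hb⟩

theorem exists_ne_line [BorelSpace S] [T2Space S] (C : Comb T A B β pt) {α : Measure ℝ}
    [NullSingletonClass α] (hα : α A ≠ 0) (hβ : β B ≠ 0) (hB : MeasurableSet B) {ℓ : Set S}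
    (hℓ : ℓ ∈ T.lines) : ∃ ℓ' ∈ T.lines, ℓ' ≠ ℓ := by
  by_contra! hcon
  have := T.sigmaFinite hℓ
  have hfib : ∀ a : A, IsCompact (C.fiber a) := fun a => isCompact_Icc.image (C.par_cont a a.2)
  have hcount := Measure.countable_meas_pos_of_disjoint_iUnion (μ := T.ν ℓ)
    (As := fun a : A => C.fiber a) (fun a => (hfib a).isClosed.measurableSet)
    (fun a a' haa => C.disj a a.2 a' a'.2 fun h => haa (Subtype.ext h))
  have huniv : {a : A | 0 < T.ν ℓ (C.fiber a)} = univ := by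
    refine eq_univ_of_forall fun a => ?_
    have h1 := C.measure_eq a a.2 B Subset.rfl hB
    rw [hcon _ (C.line_mem a a.2)] at h1
    refine lt_of_lt_of_le (pos_iff_ne_zero.2 hβ) (h1 ▸ measure_mono ?_)
    rintro _ ⟨b, hb, rfl⟩
    exact C.pt_mem_fiber a.2 hb
  rw [huniv, countable_univ_iff] at hcount
  exact hα (Set.Countable.measure_zero (countable_coe_iff.1 hcount) α)

end Comb

section Extraction

variable {S : Type} [TopologicalSpace S] [PolishSpace S] [MeasurableSpace S] [BorelSpace S]
  {μ : Measure S} {Ts Tu : MeasuredTurbulation μ}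

theorem Tartan.exists_comb (R : Tartan Ts Tu) (hR : R.Compatible) {ou : Set S → S → S → Prop}
    (hu : ∀ B ∈ R.fibu, ∃ ℓ ∈ Tu.lines, ∃ f : ℝ → S, Continuous f ∧ Injective f ∧
        range f = ℓ ∧ ∃ a b : ℝ, a ≤ b ∧ B = f '' Icc a b ∧
        ∀ s ∈ Icc a b, ∀ t ∈ Icc a b, (ou B (f s) (f t) ↔ s ≤ t))
    (ho : ∀ B ∈ R.fibu, ∀ B' ∈ R.fibu, ∀ A ∈ R.fibs, ∀ A' ∈ R.fibs,
      ∀ p ∈ B ∩ A, ∀ q ∈ B ∩ A', ∀ p' ∈ B' ∩ A, ∀ q' ∈ B' ∩ A', (ou B p q ↔ ou B' p' q'))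
    {𝔰 𝔲 ℓs : Set S} (h𝔰 : 𝔰 ∈ R.fibs) (h𝔲 : 𝔲 ∈ R.fibu) (hℓs : ℓs ∈ Ts.lines) (h𝔰ℓ : 𝔰 ⊆ ℓs)
    (hνs : Ts.ν ℓs (𝔰 ∩ R.core) ≠ 0) (hνs' : Ts.ν ℓs (𝔰 ∩ R.core) ≠ ⊤)
    {f g : ℝ → S} (hf : Injective f) {A B : Set ℝ} (hfA : f '' A = 𝔰 ∩ R.core)
    (hg : Injective g) (hgB : g '' B = 𝔲 ∩ R.core)
    (hgo : ∀ s ∈ B, ∀ t ∈ B, (ou 𝔲 (g s) (g t) ↔ s ≤ t))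
    {β : Measure ℝ} {pt : ℝ → ℝ → S} (hpm : Measurable (uncurry pt))
    (hpt : ∀ a ∈ A, ∀ b ∈ B, ∀ U ∈ R.fibu, f a ∈ U → ∀ V ∈ R.fibs, g b ∈ V → pt a b ∈ U ∩ V)
    (hμ : ∀ M ⊆ B, MeasurableSet M →
      μ (uncurry pt '' (A ×ˢ M)) = Ts.ν ℓs (𝔰 ∩ R.core) * β M) :
    ∃ C : Comb Tu A B β pt, ∀ a ∈ A, C.fiber a ∈ R.fibu ∧ f a ∈ C.fiber a := by
  classical
  have hfmem : ∀ a ∈ A, f a ∈ 𝔰 ∩ R.core := fun a ha => hfA ▸ mem_image_of_mem f ha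
  have hgmem : ∀ b ∈ B, g b ∈ 𝔲 ∩ R.core := fun b hb => hgB ▸ mem_image_of_mem g hb
  have hdata : ∀ a : A, ∃ U ∈ R.fibu, f a ∈ U ∧ ∃ ℓ ∈ Tu.lines, ∃ φ : ℝ → S, Continuous φ ∧
      Injective φ ∧ range φ = ℓ ∧ ∃ l h : ℝ, l ≤ h ∧ U = φ '' Icc l h ∧
        ∀ s ∈ Icc l h, ∀ t ∈ Icc l h, (ou U (φ s) (φ t) ↔ s ≤ t) := by
    intro a
    obtain ⟨-, -, U, hU, -, hfU⟩ := R.exists_fibers_of_mem_core (hfmem a a.2).2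
    exact ⟨U, hU, hfU, hu U hU⟩
  choose U hU hfU ℓ hℓ φ hφc hφi hφr lo hi hlohi hUφ hUo using hdata
  have hstab : ∀ b : B, ∃ V ∈ R.fibs, g b ∈ V := by
    intro b
    obtain ⟨V, hV, -, -, hgV, -⟩ := R.exists_fibers_of_mem_core (hgmem b b.2).2
    exact ⟨V, hV, hgV⟩
  choose V hV hgV using hstab
  have hptm : ∀ (a : A) (b : B), pt a b ∈ U a ∩ V b := fun a b =>
    hpt a a.2 b b.2 _ (hU a) (hfU a) _ (hV b) (hgV b)
  have hpos : ∀ (a : A) (b : B), ∃ t ∈ Icc (lo a) (hi a), φ a t = pt a b := by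
    intro a b
    have := (hptm a b).1
    rwa [hUφ a] at this
  choose pos hposm hpospt using hpos
  have hVinj : ∀ b b' : B, V b = V b' → b = b' := by
    intro b b' h
    refine Subtype.ext (hg ?_)
    exact (R.inter_unique _ (hV b) _ h𝔲).unique ⟨hgV b, (hgmem b b.2).1⟩
      ⟨h ▸ hgV b', (hgmem b' b'.2).1⟩
  have hUinj : ∀ a a' : A, U a = U a' → a = a' := by
    intro a a' h
    refine Subtype.ext (hf ?_)
    exact (R.inter_unique _ h𝔰 _ (hU a)).unique ⟨(hfmem a a.2).1, hfU a⟩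
      ⟨(hfmem a' a'.2).1, h ▸ hfU a'⟩
  have hposle : ∀ (a : A) (b b' : B), pos a b ≤ pos a b' ↔ b ≤ b' := by
    intro a b b'
    rw [← hUo a _ (hposm a b) _ (hposm a b'), hpospt, hpospt, ← Subtype.coe_le_coe,
      ← hgo b b.2 b' b'.2]
    exact ho _ (hU a) _ h𝔲 _ (hV b) _ (hV b') _ (hptm a b) _ (hptm a b') _
      ⟨(hgmem b b.2).1, hgV b⟩ _ ⟨(hgmem b' b'.2).1, hgV b'⟩
  have hposlt : ∀ (a : A) (b b' : B), b < b' → pos a b < pos a b' := by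
    intro a b b' h
    exact lt_of_not_ge fun h' => absurd ((hposle a b' b).1 h') (not_le.2 h)
  have hptinj : ∀ (a : A) (b b' : B), pt a b = pt a b' → b = b' := fun a b b' h =>
    hVinj b b' (R.eq_of_mem_fibs (hV b) (hV b') (hptm a b).2 (h ▸ (hptm a b').2))
  have := Ts.sigmaFinite hℓs
  have hmeas : ∀ a : A, ∀ M ⊆ B, MeasurableSet M → Tu.ν (ℓ a) (pt a '' M) = β M := by
    intro a M hMB hM
    have hUℓ : U a ⊆ ℓ a := by
      rw [hUφ a, ← hφr a]
      exact image_subset_range _ _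
    obtain ⟨ψ, h1, h2, h3, h4, -, h6⟩ := hR 𝔰 h𝔰 (U a) (hU a) ℓs hℓs h𝔰ℓ (ℓ a) (hℓ a) hUℓ
    have := Tu.sigmaFinite (hℓ a)
    have hPm : Measurable (pt a) := hpm.comp measurable_prodMk_left
    have hI : MeasurableSet (pt a '' M) := hM.image_of_measurable_injOn hPm fun b hb b' hb' h =>
      congrArg Subtype.val (hptinj a ⟨b, hMB hb⟩ ⟨b', hMB hb'⟩ h)
    have hIsub : pt a '' M ⊆ U a ∩ R.core := by
      rintro _ ⟨b, hb, rfl⟩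
      have := hptm a ⟨b, hMB hb⟩
      exact ⟨this.1, R.mem_core_of_mem (hV _) (hU a) this.2 this.1⟩
    have h𝔰m : MeasurableSet (𝔰 ∩ R.core) := by
      obtain ⟨ℓ', -, x, y, harc⟩ := R.exists_fibs_line h𝔰
      exact harc.isCompact.isClosed.measurableSet.inter R.measurableSet_core
    have hUm : MeasurableSet (U a ∩ R.core) := by
      rw [hUφ a]
      exact (isCompact_Icc.image (hφc a)).isClosed.measurableSet.inter R.measurableSet_core
    rw [Measure.prod_restrict] at h6
    have hE : (𝔰 ∩ R.core) ×ˢ (pt a '' M) ⊆ (𝔰 ∩ R.core) ×ˢ (U a ∩ R.core) :=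
      prod_mono_right hIsub
    have key := (measure_image_eq_of_map_eq_restrict h4 (D := (𝔰 ∩ R.core) ×ˢ (U a ∩ R.core)) (by
        rw [Measure.restrict_apply (h𝔰m.prod hUm).compl, compl_inter_self, measure_empty])
      h2 h6 h3.le hE (h𝔰m.prod hI)).2
    have hset : ψ '' ((𝔰 ∩ R.core) ×ˢ (pt a '' M)) = uncurry pt '' (A ×ˢ M) := by
      have hval : ∀ (a' : A) (b : B), ψ (f a', pt a b) = pt a' b := by
        intro a' b
        have h := h1 _ (hfmem a' a'.2) _ (R.mem_core_of_mem (hV b) (hU a) (hptm a b).2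
          (hptm a b).1 |> fun h => ⟨(hptm a b).1, h⟩) _ (hU a') (hfU a') _ (hV b) (hptm a b).2
        exact (R.inter_unique _ (hV b) _ (hU a')).unique h.symm (hptm a' b).symm
      ext z
      constructor
      · rintro ⟨⟨x, y⟩, ⟨hx, b, hb, rfl⟩, rfl⟩
        rw [← hfA] at hx
        obtain ⟨a', ha', rfl⟩ := hx
        exact ⟨(a', b), ⟨ha', hb⟩, (hval ⟨a', ha'⟩ ⟨b, hMB hb⟩).symm⟩
      · rintro ⟨⟨a', b⟩, ⟨ha', hb⟩, rfl⟩
        exact ⟨(f a', pt a b), ⟨hfmem a' ha', b, hb, rfl⟩, hval ⟨a', ha'⟩ ⟨b, hMB hb⟩⟩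
    rw [hset, hμ M hMB hM, Measure.restrict_apply (h𝔰m.prod hI), inter_eq_left.2 hE,
      Measure.prod_prod] at key
    exact ((ENNReal.mul_right_inj hνs hνs').1 key).symm
  obtain ⟨L, hL, -, hLu⟩ := R.bounded
  have hUeq : ∀ a (ha : a ∈ A), (fun a => if h : a ∈ A then U ⟨a, h⟩ else ∅) a = U ⟨a, ha⟩ :=
    fun a ha => dif_pos ha
  refine ⟨{
    line := fun a => if h : a ∈ A then ℓ ⟨a, h⟩ else ∅
    par := fun a => if h : a ∈ A then φ ⟨a, h⟩ else f
    lo := fun a => if h : a ∈ A then lo ⟨a, h⟩ else 0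
    hi := fun a => if h : a ∈ A then hi ⟨a, h⟩ else 0
    pos := fun a b => if h : a ∈ A ∧ b ∈ B then pos ⟨a, h.1⟩ ⟨b, h.2⟩ else 0
    bd := L
    line_mem := fun a ha => by simpa [ha] using hℓ ⟨a, ha⟩
    par_cont := fun a ha => by simpa [ha] using hφc ⟨a, ha⟩
    par_inj := fun a ha => by simpa [ha] using hφi ⟨a, ha⟩
    par_range := fun a ha => by simpa [ha] using hφr ⟨a, ha⟩
    pos_mem := fun a ha b hb => by simpa [ha, hb] using hposm ⟨a, ha⟩ ⟨b, hb⟩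
    pos_mono := fun a ha b hb b' hb' h => by
      simpa [ha, hb, hb'] using hposlt ⟨a, ha⟩ ⟨b, hb⟩ ⟨b', hb'⟩ h
    par_pos := fun a ha b hb => by simpa [ha, hb] using hpospt ⟨a, ha⟩ ⟨b, hb⟩
    measure_eq := fun a ha M hMB hM => by simpa [ha] using hmeas ⟨a, ha⟩ M hMB hM
    bd_lt := hL
    measure_le := fun a ha => by
      simp only [ha, dif_pos]
      rw [← hUφ]
      refine hLu _ (hU _) _ (hℓ _) ?_
      rw [hUφ, ← hφr]
      exact image_subset_range _ _
    disj := fun a ha a' ha' h => by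
      simp only [ha, ha', dif_pos]
      rw [← hUφ, ← hUφ]
      exact R.fibu_disjoint (hU _) (hU _) fun h' => h (congrArg Subtype.val (hUinj _ _ h')) },
    fun a ha => ?_⟩
  simp only [Comb.fiber, ha, dif_pos]
  rw [← hUφ]
  exact ⟨hU _, hfU _⟩

end Extraction

/-- The measurable product structure carried by a compatible tartan, in real coordinates. -/
structure Weave {S : Type} [TopologicalSpace S] [MeasurableSpace S] {μ : Measure S}
    (Ts Tu : MeasuredTurbulation μ) (V : Set S) where
  A : Set ℝ
  B : Set ℝ
  α : Measure ℝ
  β : Measure ℝ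
  pt : ℝ → ℝ → S
  cu : Comb Tu A B β pt
  cs : Comb Ts B A α (fun b a => pt a b)
  measurableSet_A : MeasurableSet A
  measurableSet_B : MeasurableSet B
  finite_α : IsFiniteMeasure α
  finite_β : IsFiniteMeasure β
  noAtoms_α : NullSingletonClass α
  noAtoms_β : NullSingletonClass β
  α_ne : α A ≠ 0
  β_ne : β B ≠ 0
  pt_meas : Measurable (uncurry pt)
  inter : ∀ a ∈ A, ∀ b ∈ B, ∀ z ∈ cu.fiber a, z ∈ cs.fiber b → z = pt a b
  cu_sub : ∀ a ∈ A, cu.fiber a ⊆ V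
  cs_sub : ∀ b ∈ B, cs.fiber b ⊆ V
  measure_image : ∀ E ⊆ A ×ˢ B, MeasurableSet E →
    MeasurableSet (uncurry pt '' E) ∧ μ (uncurry pt '' E) = (α.prod β) E

section Extraction

variable {S : Type} [TopologicalSpace S] [PolishSpace S] [MeasurableSpace S] [BorelSpace S]
  {μ : Measure S} {Ts Tu : MeasuredTurbulation μ}

/-- A parametrized arc pulls stream measure back to a finite non-atomic measure. -/
theorem MeasuredTurbulation.comap_restrict (T : MeasuredTurbulation μ) {ℓ : Set S}
    (hℓ : ℓ ∈ T.lines) {f : ℝ → S} (hf : Continuous f) (hfi : Injective f) (hfr : range f = ℓ)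
    {a b : ℝ} (hab : a ≤ b) {K : Set S} (hK : MeasurableSet K) :
    IsFiniteMeasure ((Measure.comap f (T.ν ℓ)).restrict (Icc a b ∩ f ⁻¹' K)) ∧
    NullSingletonClass ((Measure.comap f (T.ν ℓ)).restrict (Icc a b ∩ f ⁻¹' K)) ∧
    MeasurePreserving f ((Measure.comap f (T.ν ℓ)).restrict (Icc a b ∩ f ⁻¹' K))
      ((T.ν ℓ).restrict (f '' Icc a b ∩ K)) := by
  have hemb : MeasurableEmbedding f := hf.measurableEmbedding hfi
  have hns : NullSingletonClass (Measure.comap f (T.ν ℓ)) :=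
    ⟨fun x => by rw [hemb.comap_apply, image_singleton]; exact T.ν_nonatomic ℓ hℓ _⟩
  refine ⟨⟨?_⟩, inferInstance, hf.measurable, ?_⟩
  · rw [Measure.restrict_apply_univ, hemb.comap_apply]
    refine (measure_mono (image_mono inter_subset_left)).trans_lt ?_
    exact T.ν_arc_finite ℓ hℓ _ _ _ ⟨f, hf, hfi, hfr, a, b, hab, rfl, rfl, rfl⟩
  · have hm : MeasurableSet (f '' Icc a b ∩ K) :=
      (isCompact_Icc.image hf).isClosed.measurableSet.inter hK
    have hpre : Icc a b ∩ f ⁻¹' K = f ⁻¹' (f '' Icc a b ∩ K) := by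
      rw [preimage_inter, preimage_image_eq _ hfi]
    rw [hpre, ← Measure.restrict_map hf.measurable hm, hemb.map_comap,
      Measure.restrict_restrict hm, inter_eq_left.2]
    exact inter_subset_left.trans (image_subset_range _ _)

theorem Tartan.exists_weave (R : Tartan Ts Tu) (hR : R.Compatible) (hpos : 0 < μ R.core) {V : Set S}
    (hV : R.Rs ∪ R.Ru ⊆ V) : Nonempty (Weave Ts Tu V) := by
  obtain ⟨x, hx⟩ : R.core.Nonempty := nonempty_of_measure_ne_zero hpos.ne'
  obtain ⟨𝔰, h𝔰, 𝔲, h𝔲, -, -⟩ := R.exists_fibers_of_mem_core hx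
  obtain ⟨os, ou, hs, hu, hos, hou⟩ := R.oriented
  obtain ⟨ℓs, hℓs, f, hf, hfi, hfr, a, b, hab, h𝔰f, hfo⟩ := hs 𝔰 h𝔰
  obtain ⟨ℓu, hℓu, g, hg, hgi, hgr, c, d, hcd, h𝔲g, hgo⟩ := hu 𝔲 h𝔲
  have h𝔰ℓ : 𝔰 ⊆ ℓs := by rw [h𝔰f, ← hfr]; exact image_subset_range _ _
  have h𝔲ℓ : 𝔲 ⊆ ℓu := by rw [h𝔲g, ← hgr]; exact image_subset_range _ _
  obtain ⟨ψ, h1, h2, h3, h4, -, h6⟩ := hR 𝔰 h𝔰 𝔲 h𝔲 ℓs hℓs h𝔰ℓ ℓu hℓu h𝔲ℓ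
  have hσs := Ts.sigmaFinite hℓs
  have hσu := Tu.sigmaFinite hℓu
  obtain ⟨hα1, hα2, hα3⟩ := Ts.comap_restrict hℓs hf hfi hfr hab R.measurableSet_core
  obtain ⟨hβ1, hβ2, hβ3⟩ := Tu.comap_restrict hℓu hg hgi hgr hcd R.measurableSet_core
  rw [← h𝔰f] at hα3
  rw [← h𝔲g] at hβ3
  set A : Set ℝ := Icc a b ∩ f ⁻¹' R.core with hA
  set B : Set ℝ := Icc c d ∩ g ⁻¹' R.core with hB
  have hAm : MeasurableSet A := measurableSet_Icc.inter (hf.measurable R.measurableSet_core)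
  have hBm : MeasurableSet B := measurableSet_Icc.inter (hg.measurable R.measurableSet_core)
  set α : Measure ℝ := (Measure.comap f (Ts.ν ℓs)).restrict A with hα
  set β : Measure ℝ := (Measure.comap g (Tu.ν ℓu)).restrict B with hβ
  have hfA : f '' A = 𝔰 ∩ R.core := by
    rw [hA, h𝔰f, image_inter_preimage]
  have hgB : g '' B = 𝔲 ∩ R.core := by
    rw [hB, h𝔲g, image_inter_preimage]
  have hαA : α A = Ts.ν ℓs (𝔰 ∩ R.core) := by
    rw [hα, Measure.restrict_apply_self, (hf.measurableEmbedding hfi).comap_apply, hfA]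
  have hβB : β B = Tu.ν ℓu (𝔲 ∩ R.core) := by
    rw [hβ, Measure.restrict_apply_self, (hg.measurableEmbedding hgi).comap_apply, hgB]
  have hαc : α Aᶜ = 0 := by
    rw [hα, Measure.restrict_apply hAm.compl, compl_inter_self, measure_empty]
  have hβc : β Bᶜ = 0 := by
    rw [hβ, Measure.restrict_apply hBm.compl, compl_inter_self, measure_empty]
  let pt : ℝ → ℝ → S := fun s t => ψ (f s, g t)
  have hptm : Measurable (uncurry pt) :=
    h4.comp ((hf.measurable.comp measurable_fst).prodMk (hg.measurable.comp measurable_snd))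
  have hfmem : ∀ a ∈ A, f a ∈ 𝔰 ∩ R.core := fun a ha => hfA ▸ mem_image_of_mem f ha
  have hgmem : ∀ b ∈ B, g b ∈ 𝔲 ∩ R.core := fun b hb => hgB ▸ mem_image_of_mem g hb
  have hpt : ∀ a ∈ A, ∀ b ∈ B, ∀ U ∈ R.fibu, f a ∈ U → ∀ V ∈ R.fibs, g b ∈ V → pt a b ∈ U ∩ V :=
    fun a ha b hb => h1 _ (hfmem a ha) _ (hgmem b hb)
  have hcov : MeasurePreserving (Prod.map f g) (α.prod β)
      (((Ts.ν ℓs).restrict (𝔰 ∩ R.core)).prod ((Tu.ν ℓu).restrict (𝔲 ∩ R.core))) := hα3.prod hβ3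
  have hmap : Measure.map (uncurry pt) (α.prod β) = μ.restrict R.core := by
    rw [← h6, ← hcov.map_eq, Measure.map_map h4 hcov.measurable]
    rfl
  have hinj : InjOn (uncurry pt) (A ×ˢ B) := by
    rintro ⟨s, t⟩ ⟨hs, ht⟩ ⟨s', t'⟩ ⟨hs', ht'⟩ h
    have := h2 (mk_mem_prod (hfmem s hs) (hgmem t ht)) (mk_mem_prod (hfmem s' hs') (hgmem t' ht')) h
    rw [Prod.mk.injEq] at this ⊢
    exact ⟨hfi this.1, hgi this.2⟩
  have hsub : uncurry pt '' (A ×ˢ B) ⊆ R.core := by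
    rw [← h3]
    rintro _ ⟨⟨s, t⟩, ⟨hs, ht⟩, rfl⟩
    exact ⟨_, mk_mem_prod (hfmem s hs) (hgmem t ht), rfl⟩
  have himg : ∀ E ⊆ A ×ˢ B, MeasurableSet E →
      MeasurableSet (uncurry pt '' E) ∧ μ (uncurry pt '' E) = (α.prod β) E := by
    intro E hE hEm
    refine measure_image_eq_of_map_eq_restrict hptm ?_ hinj hmap hsub hE hEm
    rw [compl_prod_eq_union]
    refine measure_union_null ?_ ?_ <;> rw [Measure.prod_prod]
    · rw [hαc, zero_mul]
    · rw [hβc, mul_zero]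
  have hcore : μ R.core = α A * β B := by
    rw [← Measure.prod_prod, ← (himg _ Subset.rfl (hAm.prod hBm)).2, ← h3, ← hfA, ← hgB,
      prod_image_image_eq, image_image]
    rfl
  have hα0 : α A ≠ 0 := fun h => hpos.ne' (by rw [hcore, h, zero_mul])
  have hβ0 : β B ≠ 0 := fun h => hpos.ne' (by rw [hcore, h, mul_zero])
  obtain ⟨cu, hcu⟩ := R.exists_comb hR hu hou h𝔰 h𝔲 hℓs h𝔰ℓ (hαA ▸ hα0)
    (hαA ▸ measure_ne_top α A) hfi hfA hgi hgB
    (fun s hs t ht => hgo s hs.1 t ht.1) (β := β) hptm hpt (fun M hM hMm => by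
      rw [(himg _ (prod_mono_right hM) (hAm.prod hMm)).2, Measure.prod_prod, hαA])
  obtain ⟨cs, hcs⟩ := R.swap.exists_comb hR.swap (ou := os) hs hos h𝔲 h𝔰 hℓu h𝔲ℓ
    (by rw [R.core_swap]; exact hβB ▸ hβ0) (by rw [R.core_swap]; exact hβB ▸ measure_ne_top β B)
    hgi (by rw [R.core_swap]; exact hgB) hfi (by rw [R.core_swap]; exact hfA)
    (fun s hs t ht => hfo s hs.1 t ht.1) (β := α) (pt := fun b a => pt a b)
    (hptm.comp measurable_swap)
    (fun b hb a ha V hV hbV U hU haU => (hpt a ha b hb U hU haU V hV hbV).symm)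
    (fun M hM hMm => by
      have h : uncurry (fun b a => pt a b) '' (B ×ˢ M) = uncurry pt '' (M ×ˢ B) := by
        rw [← image_swap_prod, image_image]
        rfl
      rw [h, (himg _ (prod_mono_left hM) (hMm.prod hBm)).2, Measure.prod_prod, R.core_swap, ← hβB,
        mul_comm])
  refine ⟨{
    A := A, B := B, α := α, β := β, pt := pt, cu := cu, cs := cs
    measurableSet_A := hAm
    measurableSet_B := hBm
    finite_α := hα1
    finite_β := hβ1
    noAtoms_α := hα2
    noAtoms_β := hβ2
    α_ne := hα0
    β_ne := hβ0
    pt_meas := hptm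
    inter := fun a ha b hb z hzu hzs => (R.inter_unique _ (hcs b hb).1 _ (hcu a ha).1).unique
      ⟨hzs, hzu⟩ (hpt a ha b hb _ (hcu a ha).1 (hcu a ha).2 _ (hcs b hb).1 (hcs b hb).2).symm
    cu_sub := fun a ha => ?_
    cs_sub := fun b hb => ?_
    measure_image := himg }⟩
  · refine Subset.trans ?_ (subset_union_right.trans hV)
    rw [← R.fibu_cover]
    exact subset_sUnion_of_mem (hcu a ha).1
  · refine Subset.trans ?_ (subset_union_left.trans hV)
    rw [← R.fibs_cover]
    exact subset_sUnion_of_mem (hcs b hb).1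

end Extraction

section Splitting

/-- A positive-measure set for a non-atomic measure on the line can be split by a point. -/
theorem exists_split_of_measure_ne_zero {m : Measure ℝ} [NullSingletonClass m] {X : Set ℝ}
    (hX : m X ≠ 0) : ∃ t, m (X ∩ Iio t) ≠ 0 ∧ m (X ∩ Ioi t) ≠ 0 := by
  have hfreq : ∀ b : ℝ, ∃ᶠ x in ae (m.restrict X), id x ≠ b := by
    intro b hb
    have h : ∀ᵐ x ∂(m.restrict X), x = b := by
      filter_upwards [hb] with x hx using not_not.1 hx
    have h2 : (m.restrict X) univ = 0 := by
      refine le_antisymm ((measure_mono_ae ?_).trans (measure_singleton (μ := m.restrict X) b).le)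
        zero_le
      filter_upwards [h] with x hx _ using hx
    exact hX (by rwa [Measure.restrict_apply_univ] at h2)
  obtain ⟨a, b, hab, ha, hb⟩ := exists_ne_forall_mem_nhds_pos_measure_preimage hfreq
  rcases lt_or_gt_of_ne hab with h | h
  · obtain ⟨t, h1, h2⟩ := exists_between h
    refine ⟨t, ?_, ?_⟩
    · have := ha (Iio t) (Iio_mem_nhds h1)
      rw [preimage_id, Measure.restrict_apply measurableSet_Iio, inter_comm] at this
      exact this.ne'
    · have := hb (Ioi t) (Ioi_mem_nhds h2)
      rw [preimage_id, Measure.restrict_apply measurableSet_Ioi, inter_comm] at this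
      exact this.ne'
  · obtain ⟨t, h1, h2⟩ := exists_between h
    refine ⟨t, ?_, ?_⟩
    · have := hb (Iio t) (Iio_mem_nhds h1)
      rw [preimage_id, Measure.restrict_apply measurableSet_Iio, inter_comm] at this
      exact this.ne'
    · have := ha (Ioi t) (Ioi_mem_nhds h2)
      rw [preimage_id, Measure.restrict_apply measurableSet_Ioi, inter_comm] at this
      exact this.ne'

/-- A positive-measure set contains an increasing sequence of positive-measure windows. -/
theorem exists_windows {m : Measure ℝ} [NullSingletonClass m] {X : Set ℝ} (hXm : MeasurableSet X)
    (hX : m X ≠ 0) : ∃ Y : ℕ → Set ℝ, (∀ i, Y i ⊆ X ∧ MeasurableSet (Y i) ∧ m (Y i) ≠ 0) ∧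
      ∀ i j, i < j → ∀ x ∈ Y i, ∀ y ∈ Y j, x < y := by
  choose t ht1 ht2 using fun Z : {Z : Set ℝ // m Z ≠ 0} => exists_split_of_measure_ne_zero Z.2
  let R : ℕ → {Z : Set ℝ // m Z ≠ 0} := fun n =>
    Nat.rec ⟨X, hX⟩ (fun _ Z => ⟨Z.1 ∩ Ioi (t Z), ht2 Z⟩) n
  have hR : ∀ n, (R (n + 1)).1 = (R n).1 ∩ Ioi (t (R n)) := fun _ => rfl
  have hanti : Antitone fun n => (R n).1 :=
    antitone_nat_of_succ_le fun n => (hR n).trans_subset inter_subset_left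
  have hmeas : ∀ n, MeasurableSet (R n).1 := by
    intro n
    induction n with
    | zero => exact hXm
    | succ n ih => rw [hR]; exact ih.inter measurableSet_Ioi
  refine ⟨fun n => (R n).1 ∩ Iio (t (R n)), fun i => ⟨inter_subset_left.trans (hanti (Nat.zero_le i)),
    (hmeas i).inter measurableSet_Iio, ht1 _⟩, fun i j hij x hx y hy => ?_⟩
  have h : y ∈ (R (i + 1)).1 := hanti hij hy.1
  rw [hR] at h
  exact lt_trans hx.2 h.2

end Splitting

section Recurrence

variable {S : Type*} [MeasurableSpace S] {μ : Measure S} [IsProbabilityMeasure μ] {f : S → S}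

/-- Recurrence with a uniform lower bound along arbitrarily large times. -/
theorem MeasureTheory.MeasurePreserving.exists_frequently_le_measure_inter (hf : MeasurePreserving f μ μ)
    {P : Set S} (hP : MeasurableSet P) (hP0 : μ P ≠ 0) :
    ∃ c : ℝ, 0 < c ∧ ∃ᶠ n in atTop, c ≤ μ.real (P ∩ f^[n] ⁻¹' P) := by
  have hp : 0 < μ.real P := (measureReal_nonneg).lt_of_ne' (by
    rw [measureReal_def]
    exact ENNReal.toReal_ne_zero.2 ⟨hP0, measure_ne_top _ _⟩)
  set p := μ.real P with hpdef
  obtain ⟨K, hK⟩ := exists_nat_gt (2 / p)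
  have hK0 : (0 : ℝ) < K := lt_trans (by positivity) hK
  refine ⟨p / (2 * K), by positivity, ?_⟩
  by_contra hcon
  rw [not_frequently] at hcon
  obtain ⟨m, hm⟩ := eventually_atTop.1 hcon
  have hm : ∀ n, m ≤ n → μ.real (P ∩ f^[n] ⁻¹' P) ≤ p / (2 * K) := fun n hn => (not_le.1 (hm n hn)).le
  let E : ℕ → Set S := fun i => f^[i * (m + 1)] ⁻¹' P
  have hE : ∀ i, MeasurableSet (E i) := fun i => (hf.iterate _).measurable hP
  have hEμ : ∀ i, μ.real (E i) = p := fun i => by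
    rw [measureReal_def, (hf.iterate _).measure_preimage hP.nullMeasurableSet, hpdef, measureReal_def]
  have hpair : ∀ i j, i < j → μ.real (E j ∩ E i) ≤ p / (2 * K) := by
    intro i j hij
    have h : E j ∩ E i = f^[i * (m + 1)] ⁻¹' (P ∩ f^[(j - i) * (m + 1)] ⁻¹' P) := by
      have : j * (m + 1) = (j - i) * (m + 1) + i * (m + 1) := by
        rw [← Nat.add_mul, Nat.sub_add_cancel hij.le]
      rw [preimage_inter, ← preimage_comp, ← iterate_add, ← this, inter_comm]
    rw [h, measureReal_def, (hf.iterate _).measure_preimage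
      (hP.inter ((hf.iterate _).measurable hP)).nullMeasurableSet, ← measureReal_def]
    refine hm _ ?_
    calc m ≤ 1 * (m + 1) := by omega
      _ ≤ (j - i) * (m + 1) := Nat.mul_le_mul_right _ (by omega)
  have hind : ∀ k ≤ K, k * (p / 2) ≤ μ.real (⋃ i ∈ Finset.range k, E i) := by
    intro k
    induction k with
    | zero => intro; simp
    | succ k ih =>
      intro hk
      have hU : MeasurableSet (⋃ i ∈ Finset.range k, E i) :=
        Finset.measurableSet_biUnion _ fun i _ => hE i
      have h1 : (⋃ i ∈ Finset.range (k + 1), E i) = E k ∪ ⋃ i ∈ Finset.range k, E i := by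
        rw [Finset.range_add_one, Finset.set_biUnion_insert]
      have h2 := measureReal_union_add_inter (μ := μ) (s := E k) hU (measure_ne_top _ _)
        (measure_ne_top _ _)
      have h3 : μ.real (E k ∩ ⋃ i ∈ Finset.range k, E i) ≤ k * (p / (2 * K)) := by
        rw [inter_iUnion₂]
        refine (measureReal_biUnion_finset_le _ _).trans ?_
        calc ∑ i ∈ Finset.range k, μ.real (E k ∩ E i) ≤ ∑ i ∈ Finset.range k, p / (2 * K) :=
              Finset.sum_le_sum fun i hi => hpair i k (Finset.mem_range.1 hi)
          _ = k * (p / (2 * K)) := by simp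
      have h4 : (k : ℝ) * (p / (2 * K)) ≤ p / 2 := by
        have hkK : (k : ℝ) ≤ K := by exact_mod_cast (by omega : k ≤ K)
        calc (k : ℝ) * (p / (2 * K)) ≤ K * (p / (2 * K)) := by gcongr
          _ = p / 2 := by field_simp
      have := ih (by omega)
      rw [h1]
      rw [hEμ] at h2
      push_cast
      linarith
  have h1 := hind K le_rfl
  have h2 : μ.real (⋃ i ∈ Finset.range K, E i) ≤ 1 := measureReal_le_one
  rw [div_lt_iff₀ hp] at hK
  linarith

end Recurrence

section Hopf

variable {S : Type*} [MetricSpace S] [CompactSpace S] [MeasurableSpace S] [BorelSpace S]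
  {μ : Measure S} [IsFiniteMeasure μ]

/-- Asymptotic sequences of maps with uniformly bounded densities asymptotically visit any
measurable set at the same time. -/
theorem tendsto_measure_of_asymptotic {X : Type*} [MeasurableSpace X] {m : Measure X} {D : Set X}
    (hD : m Dᶜ = 0) {T T' : ℕ → X → S} {C : ℝ≥0∞} (hC : C ≠ ⊤)
    (hT : ∀ n, ∀ Q, MeasurableSet Q → m (T n ⁻¹' Q) ≤ C * μ Q)
    (hT' : ∀ n, ∀ Q, MeasurableSet Q → m (T' n ⁻¹' Q) ≤ C * μ Q)
    (hd : ∀ ε > 0, ∀ᶠ n in atTop, ∀ x ∈ D, dist (T n x) (T' n x) < ε)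
    {P : Set S} (hP : MeasurableSet P) :
    Tendsto (fun n => m {x | T n x ∈ P ∧ T' n x ∉ P}) atTop (𝓝 0) := by
  rw [ENNReal.tendsto_nhds_zero]
  intro ε hε
  obtain ⟨η, hη, hηε⟩ : ∃ η : ℝ≥0∞, η ≠ 0 ∧ C * η + C * η ≤ ε := by
    rcases eq_or_ne ε ⊤ with rfl | hεt
    · exact ⟨1, one_ne_zero, le_top⟩
    refine ⟨ε / (2 * (C + 1)), (ENNReal.div_pos hε.ne' (by finiteness)).ne', ?_⟩
    calc C * (ε / (2 * (C + 1))) + C * (ε / (2 * (C + 1)))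
        ≤ (C + 1) * (ε / (2 * (C + 1))) + (C + 1) * (ε / (2 * (C + 1))) := by
          gcongr <;> exact le_self_add
      _ = (2 * (C + 1)) * (ε / (2 * (C + 1))) := by ring
      _ ≤ ε := ENNReal.mul_div_le
  obtain ⟨K, hKP, hK, hKμ⟩ := hP.exists_isClosed_sdiff_lt (measure_ne_top μ P) hη
  obtain ⟨U, hKU, hU, -, hUμ⟩ := hK.measurableSet.exists_isOpen_sdiff_lt (measure_ne_top μ K) hη
  obtain ⟨δ, hδ, hthick⟩ := hK.isCompact.exists_thickening_subset_open hU hKU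
  filter_upwards [hd δ hδ] with n hn
  calc m {x | T n x ∈ P ∧ T' n x ∉ P}
      ≤ m (T n ⁻¹' (P \ K) ∪ T' n ⁻¹' (U \ K) ∪ Dᶜ) := by
        refine measure_mono ?_
        rintro x ⟨h1, h2⟩
        by_cases hx : x ∈ D
        · refine Or.inl ?_
          by_cases hxK : T n x ∈ K
          · refine Or.inr ⟨hthick ?_, fun h => h2 (hKP h)⟩
            exact Metric.mem_thickening_iff.2 ⟨_, hxK, by rw [dist_comm]; exact hn x hx⟩
          · exact Or.inl ⟨h1, hxK⟩
        · exact Or.inr hx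
    _ ≤ m (T n ⁻¹' (P \ K)) + m (T' n ⁻¹' (U \ K)) + m Dᶜ :=
        (measure_union_le _ _).trans (by gcongr; exact measure_union_le _ _)
    _ ≤ C * η + C * η := by
        rw [hD, add_zero]
        gcongr
        · exact (hT n _ (hP.diff hK.measurableSet)).trans (by gcongr)
        · exact (hT' n _ (hU.measurableSet.diff hK.measurableSet)).trans (by gcongr)
    _ ≤ ε := hηε

end Hopf

section TripleProducts

variable {X Y Z : Type*} [MeasurableSpace X] [MeasurableSpace Y] [MeasurableSpace Z]
  {a : Measure X} {b : Measure Y} {c : Measure Z} [IsFiniteMeasure a] [IsFiniteMeasure b]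
  [IsFiniteMeasure c]

theorem prod_prod_apply_fst {E : Set (X × Y)} (hE : MeasurableSet E) :
    (a.prod (b.prod c)) {x | (x.1, x.2.1) ∈ E} = c univ * (a.prod b) E := by
  have h : (a.prod (b.prod c)).map (Prod.map id Prod.fst) = c univ • a.prod b := by
    rw [← Measure.map_prod_map _ _ measurable_id measurable_fst, Measure.map_id,
      Measure.map_fst_prod, Measure.prod_smul_right]
  calc _ = ((a.prod (b.prod c)).map (Prod.map id Prod.fst)) E :=
        (Measure.map_apply (by fun_prop) hE).symm
    _ = _ := by rw [h]; simp

theorem prod_prod_apply_snd {E : Set (X × Z)} (hE : MeasurableSet E) :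
    (a.prod (b.prod c)) {x | (x.1, x.2.2) ∈ E} = b univ * (a.prod c) E := by
  have h : (a.prod (b.prod c)).map (Prod.map id Prod.snd) = b univ • a.prod c := by
    rw [← Measure.map_prod_map _ _ measurable_id measurable_snd, Measure.map_id,
      Measure.map_snd_prod, Measure.prod_smul_right]
  calc _ = ((a.prod (b.prod c)).map (Prod.map id Prod.snd)) E :=
        (Measure.map_apply (by fun_prop) hE).symm
    _ = _ := by rw [h]; simp

theorem mul_prod_le_add_mul_prod {E : Set (X × Y)} {E' : Set (X × Z)} (hE : MeasurableSet E)
    (hE' : MeasurableSet E') :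
    c univ * (a.prod b) E ≤
      (a.prod (b.prod c)) {x | (x.1, x.2.1) ∈ E ∧ (x.1, x.2.2) ∉ E'} + b univ * (a.prod c) E' := by
  rw [← prod_prod_apply_fst hE, ← prod_prod_apply_snd hE']
  refine (measure_mono fun x hx => ?_).trans (measure_union_le _ _)
  by_cases h : (x.1, x.2.2) ∈ E'
  exacts [Or.inr h, Or.inl ⟨hx, h⟩]

theorem mul_prod_le_add_prod_inter {E : Set (X × Y)} {E' : Set (X × Z)} (hE : MeasurableSet E) :
    c univ * (a.prod b) E ≤
      (a.prod (b.prod c)) {x | (x.1, x.2.1) ∈ E ∧ (x.1, x.2.2) ∉ E'} +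
        (a.prod (b.prod c)) {x | (x.1, x.2.1) ∈ E ∧ (x.1, x.2.2) ∈ E'} := by
  rw [← prod_prod_apply_fst hE]
  refine (measure_mono fun x hx => ?_).trans (measure_union_le _ _)
  by_cases h : (x.1, x.2.2) ∈ E'
  exacts [Or.inr ⟨hx, h⟩, Or.inl ⟨hx, h⟩]

theorem mul_prod_section_le {E : Set (X × Y)} {E' : Set (X × Z)} (hE : MeasurableSet E)
    (hE' : MeasurableSet E') (ε : ℝ≥0∞) :
    MeasurableSet {x : X × Y | x ∈ E ∧ ε ≤ c {z | (x.1, z) ∉ E'}} ∧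
    ε * (a.prod b) {x | x ∈ E ∧ ε ≤ c {z | (x.1, z) ∉ E'}} ≤
      (a.prod (b.prod c)) {x | (x.1, x.2.1) ∈ E ∧ (x.1, x.2.2) ∉ E'} := by
  have hm : Measurable fun x : X × Y => c {z | (x.1, z) ∉ E'} :=
    (measurable_measure_prodMk_left hE'.compl).comp measurable_fst
  have hQ : MeasurableSet {x : (X × Y) × Z | x.1 ∈ E ∧ (x.1.1, x.2) ∉ E'} :=
    (measurable_fst hE).inter
      ((measurable_fst.fst.prodMk measurable_snd : Measurable fun x : (X × Y) × Z =>
        (x.1.1, x.2)) hE'.compl)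
  have hQ' : MeasurableSet {x : X × Y × Z | (x.1, x.2.1) ∈ E ∧ (x.1, x.2.2) ∉ E'} :=
    ((by fun_prop : Measurable fun x : X × Y × Z => (x.1, x.2.1)) hE).inter
      ((by fun_prop : Measurable fun x : X × Y × Z => (x.1, x.2.2)) hE'.compl)
  refine ⟨hE.inter (measurableSet_le measurable_const hm), ?_⟩
  have h1 : (a.prod (b.prod c)) {x | (x.1, x.2.1) ∈ E ∧ (x.1, x.2.2) ∉ E'} =
      ∫⁻ x, c {z | x ∈ E ∧ (x.1, z) ∉ E'} ∂(a.prod b) := by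
    rw [← Measure.prodAssoc_prod, Measure.map_apply MeasurableEquiv.prodAssoc.measurable hQ']
    exact Measure.prod_apply hQ
  rw [h1]
  refine le_trans ?_ (mul_meas_ge_le_lintegral (measurable_measure_prodMk_left hQ) ε)
  gcongr
  intro hx
  rename_i x
  change ε ≤ c {z | x ∈ E ∧ (x.1, z) ∉ E'}
  simpa [hx.1] using hx.2

/-- Frequent lower bounds propagate through inequalities with vanishing error. -/
theorem frequently_le_of_mul_le {r s e : ℕ → ℝ≥0∞} {u v : ℝ≥0∞} (hu : u ≠ 0) (hu' : u ≠ ⊤)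
    (hv : v ≠ ⊤) (h : ∀ n, u * r n ≤ e n + v * s n) (he : Tendsto e atTop (𝓝 0))
    (hr : ∃ c, c ≠ 0 ∧ ∃ᶠ n in atTop, c ≤ r n) : ∃ c, c ≠ 0 ∧ ∃ᶠ n in atTop, c ≤ s n := by
  obtain ⟨c, hc, hr⟩ := hr
  have hd : u * min c 1 ≠ 0 := mul_ne_zero hu (by simp [hc])
  have hd' : u * min c 1 ≠ ⊤ := ENNReal.mul_ne_top hu' (by simp)
  set d := u * min c 1 with hddef
  have hd2 : d / 2 ≠ 0 := (ENNReal.half_pos hd).ne'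
  refine ⟨d / 2 / (v + 1), (ENNReal.div_pos hd2 (by finiteness)).ne', ?_⟩
  refine (hr.and_eventually (he.eventually_lt_const (pos_iff_ne_zero.2 hd2))).mono ?_
  rintro n ⟨hn, hen⟩
  by_contra! hcon
  have h1 : d ≤ e n + v * s n :=
    le_trans (by rw [hddef]; gcongr; exact (min_le_left _ _).trans hn) (h n)
  have h2 : v * s n ≤ d / 2 :=
    calc v * s n ≤ (v + 1) * (d / 2 / (v + 1)) := by gcongr; exact le_self_add
      _ ≤ d / 2 := ENNReal.mul_div_le
  have h3 : e n + v * s n < d / 2 + d / 2 :=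
    ENNReal.add_lt_add_of_lt_of_le (ne_top_of_le_ne_top (by finiteness) h2) hen h2
  rw [ENNReal.add_halves] at h3
  exact absurd h1 (not_le.2 h3)

end TripleProducts

theorem prod_restrict_preimage {S : Type*} [MeasurableSpace S] {μ : Measure S} {α β : Measure ℝ}
    [IsFiniteMeasure α] [IsFiniteMeasure β] {A B : Set ℝ} {pt : ℝ → ℝ → S}
    (hpt : Measurable (uncurry pt)) (himg : ∀ E ⊆ A ×ˢ B, MeasurableSet E →
      MeasurableSet (uncurry pt '' E) ∧ μ (uncurry pt '' E) = (α.prod β) E) {X Y : Set ℝ}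
    (hX : X ⊆ A) (hY : Y ⊆ B) (hXm : MeasurableSet X) (hYm : MeasurableSet Y) {Q : Set S}
    (hQ : MeasurableSet Q) :
    ((α.restrict X).prod (β.restrict Y)) (uncurry pt ⁻¹' Q) = μ (uncurry pt '' (X ×ˢ Y) ∩ Q) := by
  rw [Measure.prod_restrict, Measure.restrict_apply (hpt hQ), inter_comm, ← image_inter_preimage]
  exact ((himg _ (inter_subset_left.trans (prod_mono hX hY))
    ((hXm.prod hYm).inter (hpt hQ))).2).symm

/-- A sequence of homeomorphisms contracts the streamlines of a comb by factors `κ k → 0`. -/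
structure Comb.Contracted {S : Type} [TopologicalSpace S] [MeasurableSpace S] {μ : Measure S}
    {T : MeasuredTurbulation μ} {A B : Set ℝ} {β : Measure ℝ} {pt : ℝ → ℝ → S}
    (C : Comb T A B β pt) (H : ℕ → S ≃ₜ S) (κ : ℕ → ℝ≥0∞) : Prop where
  image_mem : ∀ a ∈ A, ∀ k, H k '' C.line a ∈ T.lines
  unique : ∀ a ∈ A, UniqueArcs (C.line a)
  scale : ∀ a ∈ A, ∀ k K x y, IsArcIn (C.line a) K x y →
    T.ν (H k '' C.line a) (H k '' K) = κ k * T.ν (C.line a) K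
  ne_zero : ∀ k, κ k ≠ 0
  ne_top : ∀ k, κ k ≠ ⊤
  lim : Tendsto κ atTop (𝓝 0)

namespace Comb

variable {S : Type} [TopologicalSpace S] [MeasurableSpace S] {μ : Measure S}
  {T : MeasuredTurbulation μ} {A B : Set ℝ} {β : Measure ℝ} {pt : ℝ → ℝ → S}
  {C : Comb T A B β pt} {H : ℕ → S ≃ₜ S} {κ : ℕ → ℝ≥0∞}

theorem isArcIn (C : Comb T A B β pt) {a : ℝ} (ha : a ∈ A) (s t : ℝ) :
    IsArcIn (C.line a) (C.par a '' uIcc s t) (C.par a s) (C.par a t) :=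
  isArcIn_uIcc (C.par_cont a ha) (C.par_inj a ha) (C.par_range a ha) s t

theorem uIcc_subset_Icc (C : Comb T A B β pt) {a b b' : ℝ} (ha : a ∈ A) (hb : b ∈ B)
    (hb' : b' ∈ B) : uIcc (C.pos a b) (C.pos a b') ⊆ Icc (C.lo a) (C.hi a) :=
  (ordConnected_Icc).uIcc_subset (C.pos_mem a ha b hb) (C.pos_mem a ha b' hb')

theorem fiber_subset_line (C : Comb T A B β pt) {a : ℝ} (ha : a ∈ A) : C.fiber a ⊆ C.line a :=
  (image_subset_range _ _).trans (C.par_range a ha).subset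

theorem eq_of_mem_fiber (C : Comb T A B β pt) {a a' : ℝ} (ha : a ∈ A) (ha' : a' ∈ A) {z : S}
    (hz : z ∈ C.fiber a) (hz' : z ∈ C.fiber a') : a = a' := by
  by_contra h
  exact (C.disj a ha a' ha' h).notMem_of_mem_left hz hz'

theorem pt_inj (C : Comb T A B β pt) {a b b' : ℝ} (ha : a ∈ A) (hb : b ∈ B) (hb' : b' ∈ B)
    (h : pt a b = pt a b') : b = b' := by
  rw [← C.par_pos a ha b hb, ← C.par_pos a ha b' hb'] at h
  exact (C.pos_mono a ha).injOn hb hb' (C.par_inj a ha h)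

theorem pos_mem_uIcc_iff (C : Comb T A B β pt) {a b b' c : ℝ} (ha : a ∈ A) (hb : b ∈ B)
    (hb' : b' ∈ B) (hc : c ∈ B) :
    C.pos a c ∈ uIcc (C.pos a b) (C.pos a b') ↔ c ∈ uIcc b b' := by
  have h := C.pos_mono a ha
  simp only [mem_uIcc, h.le_iff_le hb hc, h.le_iff_le hc hb', h.le_iff_le hb' hc, h.le_iff_le hc hb]

theorem lines_eq_of_mem {ℓ ℓ' : Set S} (hℓ : ℓ ∈ T.lines) (hℓ' : ℓ' ∈ T.lines) {z : S}
    (hz : z ∈ ℓ) (hz' : z ∈ ℓ') : ℓ = ℓ' := by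
  by_contra h
  exact (T.lines_disjoint hℓ hℓ' h).notMem_of_mem_left hz hz'

theorem exists_par (C : Comb T A B β pt) {a a₁ : ℝ} (ha : a ∈ A) (ha₁ : a₁ ∈ A) {G : S ≃ₜ S}
    (hl : G '' C.line a = C.line a₁) (s : ℝ) : ∃ s', G (C.par a s) = C.par a₁ s' := by
  have h : G (C.par a s) ∈ C.line a₁ := by
    rw [← hl, ← C.par_range a ha]
    exact mem_image_of_mem _ (mem_range_self s)
  rw [← C.par_range a₁ ha₁] at h
  obtain ⟨s', hs'⟩ := h
  exact ⟨s', hs'.symm⟩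

namespace Contracted

theorem measure_image_le (hC : C.Contracted H κ)
    {a s t : ℝ} (ha : a ∈ A) (hs : s ∈ Icc (C.lo a) (C.hi a))
    (ht : t ∈ Icc (C.lo a) (C.hi a)) (k : ℕ) :
    T.ν (H k '' C.line a) (H k '' (C.par a '' uIcc s t)) ≤ κ k * C.bd := by
  rw [hC.scale a ha k _ _ _ (C.isArcIn ha s t)]
  gcongr
  exact (measure_mono (image_mono (ordConnected_Icc.uIcc_subset hs ht))).trans (C.measure_le a ha)

theorem lim_mul_bd (hC : C.Contracted H κ) : Tendsto (fun k => κ k * C.bd) atTop (𝓝 0) := by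
  have := ENNReal.Tendsto.mul_const (b := C.bd) hC.lim (Or.inr C.bd_lt.ne)
  rwa [zero_mul] at this

/-- A point of a tooth mapped to a point of another tooth: the streamlines match up. -/
theorem line_eq (hC : C.Contracted H κ)
    {a a₁ b c : ℝ} (ha : a ∈ A) (ha₁ : a₁ ∈ A) (hb : b ∈ B) (hc : c ∈ B) {k : ℕ}
    (h : H k (pt a b) = pt a₁ c) : H k '' C.line a = C.line a₁ :=
  lines_eq_of_mem (hC.image_mem a ha k) (C.line_mem a₁ ha₁)
    ⟨_, C.fiber_subset_line ha (C.pt_mem_fiber ha hb), h⟩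
    (C.fiber_subset_line ha₁ (C.pt_mem_fiber ha₁ hc))

theorem image_arc (hC : C.Contracted H κ)
    {a a₁ s t s' t' : ℝ} (ha : a ∈ A) (ha₁ : a₁ ∈ A) {k : ℕ}
    (hl : H k '' C.line a = C.line a₁) (hs : H k (C.par a s) = C.par a₁ s')
    (ht : H k (C.par a t) = C.par a₁ t') :
    H k '' (C.par a '' uIcc s t) = C.par a₁ '' uIcc s' t' := by
  have h := (C.isArcIn ha s t).image (H k)
  rw [hl, hs, ht] at h
  exact hC.unique a₁ ha₁ _ _ _ _ h (C.isArcIn ha₁ s' t')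

/-- A strongly contracted tooth does not slide off the tooth on which one of its points lands. -/
theorem slide (hC : C.Contracted H κ)
    {a a₁ b c : ℝ} (ha : a ∈ A) (ha₁ : a₁ ∈ A) (hb : b ∈ B) (hc : c ∈ B) {k : ℕ}
    (h : H k (pt a b) = pt a₁ c) {M₁ M₂ : Set ℝ} (hM₁ : M₁ ⊆ B) (hM₂ : M₂ ⊆ B)
    (hM₁m : MeasurableSet M₁) (hM₂m : MeasurableSet M₂) (h₁ : ∀ x ∈ M₁, x < c)
    (h₂ : ∀ x ∈ M₂, c < x) (hk₁ : κ k * C.bd < β M₁) (hk₂ : κ k * C.bd < β M₂)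
    {z : S} (hz : z ∈ C.fiber a) : H k z ∈ C.fiber a₁ := by
  have hl := hC.line_eq ha ha₁ hb hc h
  obtain ⟨t, ht, rfl⟩ := hz
  obtain ⟨t', ht'⟩ := C.exists_par ha ha₁ hl t
  have hpos : H k (C.par a (C.pos a b)) = C.par a₁ (C.pos a₁ c) := by
    rw [C.par_pos a ha b hb, C.par_pos a₁ ha₁ c hc, h]
  have harc := hC.image_arc ha ha₁ hl hpos ht'
  have hle := hC.measure_image_le ha (C.pos_mem a ha b hb) ht k
  rw [harc, hl] at hle
  have key : ∀ M ⊆ B, MeasurableSet M → κ k * C.bd < β M →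
      ∃ x ∈ M, C.pos a₁ x ∉ uIcc (C.pos a₁ c) t' := by
    intro M hM hMm hlt
    by_contra! hcon
    refine absurd hle (not_le.2 (hlt.trans_le ?_))
    rw [← C.measure_eq a₁ ha₁ M hM hMm]
    refine measure_mono ?_
    rintro _ ⟨x, hx, rfl⟩
    exact ⟨_, hcon x hx, C.par_pos a₁ ha₁ x (hM hx)⟩
  obtain ⟨x, hx, hx'⟩ := key M₁ hM₁ hM₁m hk₁
  obtain ⟨y, hy, hy'⟩ := key M₂ hM₂ hM₂m hk₂
  have hxc := C.pos_mono a₁ ha₁ (hM₁ hx) hc (h₁ x hx)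
  have hyc := C.pos_mono a₁ ha₁ hc (hM₂ hy) (h₂ y hy)
  have hx2 := C.pos_mem a₁ ha₁ x (hM₁ hx)
  have hy2 := C.pos_mem a₁ ha₁ y (hM₂ hy)
  rw [mem_uIcc, not_or, not_and_or, not_and_or, not_le, not_le, not_le, not_le] at hx' hy'
  rw [ht']
  refine mem_image_of_mem _ ⟨?_, ?_⟩
  · rcases hx'.2 with h | h
    · exact hx2.1.trans h.le
    · exact absurd h (not_lt.2 hxc.le)
  · rcases hy'.1 with h | h
    · exact absurd h (not_lt.2 hyc.le)
    · exact h.le.trans hy2.2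

/-- The image of an arc between marked points lies in the arc between the image marked points. -/
theorem image_mem_arc (hC : C.Contracted H κ)
    {a a₁ b b' c c' : ℝ} (ha : a ∈ A) (ha₁ : a₁ ∈ A) (hb : b ∈ B) (hb' : b' ∈ B)
    (hc : c ∈ B) (hc' : c' ∈ B) {k : ℕ} (h : H k (pt a b) = pt a₁ c)
    (h' : H k (pt a b') = pt a₁ c') :
    H k '' (C.par a '' uIcc (C.pos a b) (C.pos a b')) =
      C.par a₁ '' uIcc (C.pos a₁ c) (C.pos a₁ c') :=
  hC.image_arc ha ha₁ (hC.line_eq ha ha₁ hb hc h)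
    (by rw [C.par_pos a ha b hb, C.par_pos a₁ ha₁ c hc, h])
    (by rw [C.par_pos a ha b' hb', C.par_pos a₁ ha₁ c' hc', h'])

/-- Contraction preserves betweenness of marked points. -/
theorem between (hC : C.Contracted H κ)
    {a a₁ : ℝ} (ha : a ∈ A) (ha₁ : a₁ ∈ A) {x y z x' y' z' : ℝ} (hx : x ∈ B)
    (hy : y ∈ B) (hz : z ∈ B) (hx' : x' ∈ B) (hy' : y' ∈ B) (hz' : z' ∈ B) {k : ℕ}
    (h₁ : H k (pt a x) = pt a₁ x') (h₂ : H k (pt a y) = pt a₁ y') (h₃ : H k (pt a z) = pt a₁ z') :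
    y' ∈ uIcc x' z' ↔ y ∈ uIcc x z := by
  have h := hC.image_mem_arc ha ha₁ hx hz hx' hz' h₁ h₃
  rw [← C.pos_mem_uIcc_iff ha hx hz hy, ← C.pos_mem_uIcc_iff ha₁ hx' hz' hy',
    ← (C.par_inj a₁ ha₁).mem_set_image, ← h, C.par_pos a₁ ha₁ y' hy', ← h₂,
    (H k).injective.mem_set_image, ← C.par_pos a ha y hy, (C.par_inj a ha).mem_set_image]

/-- Null sets of an image streamline pull back to null sets. -/
theorem measure_eq_zero (hC : C.Contracted H κ)
    [PolishSpace S] [BorelSpace S] {a : ℝ} (ha : a ∈ A) {k : ℕ} {M : Set S}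
    (hM : M ⊆ C.line a) (h0 : T.ν (H k '' C.line a) (H k '' M) = 0) : T.ν (C.line a) M = 0 := by
  have hf := C.par_cont a ha
  have hfi := C.par_inj a ha
  have hemb : MeasurableEmbedding (C.par a) := hf.measurableEmbedding hfi
  have hemb' : MeasurableEmbedding (H k ∘ C.par a) :=
    ((H k).continuous.comp hf).measurableEmbedding ((H k).injective.comp hfi)
  have hext : Measure.comap (H k ∘ C.par a) (T.ν (H k '' C.line a)) =
      κ k • Measure.comap (C.par a) (T.ν (C.line a)) := by
    have hIcc : ∀ s t : ℝ, s ≤ t →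
        Measure.comap (H k ∘ C.par a) (T.ν (H k '' C.line a)) (Icc s t) =
          κ k * T.ν (C.line a) (C.par a '' Icc s t) := fun s t hst => by
      rw [hemb'.comap_apply, image_comp, ← uIcc_of_le hst]
      exact hC.scale a ha k _ _ _ (C.isArcIn ha s t)
    refine Measure.ext_of_Icc' _ _ (fun s t hst => ?_) (fun s t hst => ?_)
    · rw [hIcc s t hst, ← uIcc_of_le hst]
      exact ENNReal.mul_ne_top (hC.ne_top k)
        ((C.isArcIn ha s t).measure_lt_top (C.line_mem a ha)).ne
    · rw [hIcc s t hst, Measure.smul_apply, hemb.comap_apply, smul_eq_mul]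
  have hMr : C.par a '' (C.par a ⁻¹' M) = M :=
    image_preimage_eq_of_subset (hM.trans (C.par_range a ha).symm.subset)
  have h1 := congrArg (fun m => m (C.par a ⁻¹' M)) hext
  simp only [Measure.smul_apply, hemb.comap_apply, hemb'.comap_apply, smul_eq_mul, image_comp, hMr,
    h0] at h1
  exact (mul_eq_zero.1 h1.symm).resolve_left (hC.ne_zero k)

/-- Two points on the same tooth, moved by a contracting sequence, asymptotically visit every
measurable set at the same time. -/
theorem tendsto_transfer (hC : C.Contracted H κ)
    [CompactSpace S] [TopologicalSpace.MetrizableSpace S] [BorelSpace S]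
    [IsFiniteMeasure μ] (hT : T.Tame) (hH : ∀ n, MeasurePreserving (H n) μ μ) {α : Measure ℝ}
    [IsFiniteMeasure α] [IsFiniteMeasure β] (hpt : Measurable (uncurry pt)) {A' B' B'' : Set ℝ}
    (hA' : A' ⊆ A) (hB' : B' ⊆ B) (hB'' : B'' ⊆ B) (hA'm : MeasurableSet A')
    (hB'm : MeasurableSet B') (hB''m : MeasurableSet B'')
    (himg : ∀ E ⊆ A ×ˢ B, MeasurableSet E →
      MeasurableSet (uncurry pt '' E) ∧ μ (uncurry pt '' E) = (α.prod β) E)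
    {P : Set S} (hP : MeasurableSet P) :
    Tendsto (fun n => ((α.restrict A').prod ((β.restrict B').prod (β.restrict B'')))
      {x | H n (pt x.1 x.2.1) ∈ P ∧ H n (pt x.1 x.2.2) ∉ P}) atTop (𝓝 0) := by
  let _ := TopologicalSpace.metrizableSpaceMetric S
  have hmp : ∀ n, Measurable fun x : ℝ × ℝ => H n (pt x.1 x.2) := fun n =>
    (H n).continuous.measurable.comp hpt
  have hb : ∀ Y ⊆ B, MeasurableSet Y → ∀ n, ∀ Q, MeasurableSet Q →
      ((α.restrict A').prod (β.restrict Y)) {x | H n (pt x.1 x.2) ∈ Q} ≤ μ Q := by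
    intro Y hY hYm n Q hQ
    calc _ = μ (uncurry pt '' (A' ×ˢ Y) ∩ H n ⁻¹' Q) :=
          prod_restrict_preimage hpt himg hA' hY hA'm hYm ((H n).continuous.measurable hQ)
      _ ≤ μ (H n ⁻¹' Q) := measure_mono inter_subset_right
      _ = μ Q := (hH n).measure_preimage hQ.nullMeasurableSet
  refine tendsto_measure_of_asymptotic (μ := μ) (D := A' ×ˢ (B' ×ˢ B''))
    (T := fun n x => H n (pt x.1 x.2.1)) (T' := fun n x => H n (pt x.1 x.2.2))
    (C := β univ) ?_ (measure_ne_top _ _) ?_ ?_ ?_ hP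
  · rw [Measure.prod_restrict, Measure.prod_restrict]
    exact (ae_restrict_mem (hA'm.prod (hB'm.prod hB''m)))
  · intro n Q hQ
    refine (prod_prod_apply_fst (hmp n hQ)).trans_le ?_
    gcongr
    · exact Measure.restrict_le_self
    · exact hb B' hB' hB'm n Q hQ
  · intro n Q hQ
    refine (prod_prod_apply_snd (hmp n hQ)).trans_le ?_
    gcongr
    · exact Measure.restrict_le_self
    · exact hb B'' hB'' hB''m n Q hQ
  · intro ε hε
    obtain ⟨δ, hδ, h⟩ := hT _ (isCompatibleMetric_dist S) ε hε
    filter_upwards [hC.lim_mul_bd.eventually_lt_const (ENNReal.ofReal_pos.2 hδ)] with n hn x hx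
    have ha := hA' hx.1
    have hb := hB' hx.2.1
    have hb' := hB'' hx.2.2
    have harc := (C.isArcIn ha (C.pos x.1 x.2.1) (C.pos x.1 x.2.2)).image (H n)
    rw [C.par_pos _ ha _ hb, C.par_pos _ ha _ hb'] at harc
    exact h _ (hC.image_mem _ ha n) _ _ _ harc
      ((hC.measure_image_le ha (C.pos_mem _ ha _ hb) (C.pos_mem _ ha _ hb') n).trans_lt hn)

section Counting

variable [CompactSpace S] [TopologicalSpace.MetrizableSpace S] [BorelSpace S] [IsFiniteMeasure μ]
  {α : Measure ℝ} [IsFiniteMeasure α] [IsFiniteMeasure β] {X Y Y' : Set ℝ}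

/-- Frequent visits are inherited by another window on the same teeth. -/
theorem frequently_transfer (hC : C.Contracted H κ) (hT : T.Tame)
    (hH : ∀ n, MeasurePreserving (H n) μ μ) (hpt : Measurable (uncurry pt)) (hX : X ⊆ A)
    (hY : Y ⊆ B) (hY' : Y' ⊆ B) (hXm : MeasurableSet X) (hYm : MeasurableSet Y)
    (hY'm : MeasurableSet Y')
    (himg : ∀ E ⊆ A ×ˢ B, MeasurableSet E →
      MeasurableSet (uncurry pt '' E) ∧ μ (uncurry pt '' E) = (α.prod β) E)
    (hY'0 : β Y' ≠ 0) {P : Set S} (hP : MeasurableSet P)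
    (h : ∃ c, c ≠ 0 ∧ ∃ᶠ n in atTop, c ≤ μ (uncurry pt '' (X ×ˢ Y) ∩ H n ⁻¹' P)) :
    ∃ c, c ≠ 0 ∧ ∃ᶠ n in atTop, c ≤ μ (uncurry pt '' (X ×ˢ Y') ∩ H n ⁻¹' P) := by
  have hHm : ∀ n, MeasurableSet (H n ⁻¹' P) := fun n => (H n).continuous.measurable hP
  refine frequently_le_of_mul_le hY'0 (measure_ne_top _ _) (measure_ne_top β Y) (fun n => ?_)
    (hC.tendsto_transfer hT hH hpt hX hY hY' hXm hYm hY'm himg hP) h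
  have := mul_prod_le_add_mul_prod (a := α.restrict X) (b := β.restrict Y) (c := β.restrict Y')
    (hpt (hHm n)) (hpt (hHm n))
  rwa [prod_restrict_preimage hpt himg hX hY hXm hYm (hHm n),
    prod_restrict_preimage hpt himg hX hY' hXm hY'm (hHm n), Measure.restrict_apply_univ,
    Measure.restrict_apply_univ] at this

/-- Frequent visits are inherited by pairs of points on the same teeth. -/
theorem frequently_pair (hC : C.Contracted H κ) (hT : T.Tame)
    (hH : ∀ n, MeasurePreserving (H n) μ μ) (hpt : Measurable (uncurry pt)) (hX : X ⊆ A)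
    (hY : Y ⊆ B) (hY' : Y' ⊆ B) (hXm : MeasurableSet X) (hYm : MeasurableSet Y)
    (hY'm : MeasurableSet Y')
    (himg : ∀ E ⊆ A ×ˢ B, MeasurableSet E →
      MeasurableSet (uncurry pt '' E) ∧ μ (uncurry pt '' E) = (α.prod β) E)
    (hY'0 : β Y' ≠ 0) {P : Set S} (hP : MeasurableSet P)
    (h : ∃ c, c ≠ 0 ∧ ∃ᶠ n in atTop, c ≤ μ (uncurry pt '' (X ×ˢ Y) ∩ H n ⁻¹' P)) :
    ∃ c, c ≠ 0 ∧ ∃ᶠ n in atTop,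
      c ≤ ((α.restrict X).prod ((β.restrict Y).prod (β.restrict Y')))
        {x | H n (pt x.1 x.2.1) ∈ P ∧ H n (pt x.1 x.2.2) ∈ P} := by
  have hHm : ∀ n, MeasurableSet (H n ⁻¹' P) := fun n => (H n).continuous.measurable hP
  refine frequently_le_of_mul_le hY'0 (measure_ne_top _ _) ENNReal.one_ne_top (fun n => ?_)
    (hC.tendsto_transfer hT hH hpt hX hY hY' hXm hYm hY'm himg hP) h
  have := mul_prod_le_add_prod_inter (a := α.restrict X) (b := β.restrict Y) (c := β.restrict Y')
    (E' := uncurry pt ⁻¹' (H n ⁻¹' P)) (hpt (hHm n))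
  rw [one_mul]
  rwa [prod_restrict_preimage hpt himg hX hY hXm hYm (hHm n), Measure.restrict_apply_univ] at this

/-- Points of a window visiting `P` while a definite part of another window on the same tooth does
not visit `P` are asymptotically negligible. -/
theorem tendsto_exceptional (hC : C.Contracted H κ) (hT : T.Tame)
    (hH : ∀ n, MeasurePreserving (H n) μ μ) (hpt : Measurable (uncurry pt)) (hX : X ⊆ A)
    (hY : Y ⊆ B) (hY' : Y' ⊆ B) (hXm : MeasurableSet X) (hYm : MeasurableSet Y)
    (hY'm : MeasurableSet Y')
    (himg : ∀ E ⊆ A ×ˢ B, MeasurableSet E →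
      MeasurableSet (uncurry pt '' E) ∧ μ (uncurry pt '' E) = (α.prod β) E)
    {ε : ℝ≥0∞} (hε : ε ≠ 0) (hε' : ε ≠ ⊤) {P : Set S} (hP : MeasurableSet P) :
    (∀ n, MeasurableSet (uncurry pt '' ((X ×ˢ Y) ∩ {x | H n (pt x.1 x.2) ∈ P ∧
      ε ≤ (β.restrict Y') {y | H n (pt x.1 y) ∉ P}}))) ∧
    Tendsto (fun n => μ (uncurry pt '' ((X ×ˢ Y) ∩ {x | H n (pt x.1 x.2) ∈ P ∧
      ε ≤ (β.restrict Y') {y | H n (pt x.1 y) ∉ P}}))) atTop (𝓝 0) := by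
  have hHm : ∀ n, MeasurableSet (uncurry pt ⁻¹' (H n ⁻¹' P)) := fun n =>
    hpt ((H n).continuous.measurable hP)
  have hs := fun n => mul_prod_section_le (a := α.restrict X) (b := β.restrict Y)
    (c := β.restrict Y') (hHm n) (hHm n) ε
  have hi := fun n => himg _ (inter_subset_left.trans (prod_mono hX hY))
    ((hXm.prod hYm).inter (hs n).1)
  refine ⟨fun n => (hi n).1, ?_⟩
  have hlim := ENNReal.Tendsto.const_mul (a := ε⁻¹)
    (hC.tendsto_transfer hT hH hpt hX hY hY' hXm hYm hY'm himg hP)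
    (Or.inr (ENNReal.inv_ne_top.2 hε))
  rw [mul_zero] at hlim
  refine tendsto_of_tendsto_of_tendsto_of_le_of_le tendsto_const_nhds hlim (fun _ => zero_le)
    fun n => ?_
  have h2 := (hs n).2
  rw [Measure.prod_restrict (μ := α) (ν := β), Measure.restrict_apply (hs n).1, inter_comm,
    ← (hi n).2] at h2
  rw [mul_comm ε⁻¹, ← div_eq_mul_inv, ENNReal.le_div_iff_mul_le (Or.inl hε) (Or.inl hε'), mul_comm]
  exact h2

end Counting

end Contracted
end Comb

theorem Homeomorph.coe_pow_eq_iterate {S : Type*} [TopologicalSpace S] (F : S ≃ₜ S) (n : ℕ) :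
    ⇑(F ^ n) = F^[n] := by
  induction n with
  | zero => rfl
  | succ n ih =>
    rw [pow_succ, iterate_succ, ← ih]
    rfl

theorem measure_inter_symm_preimage {S : Type*} [TopologicalSpace S] [MeasurableSpace S]
    [BorelSpace S] {μ : Measure S} {G : S ≃ₜ S} (hG : MeasurePreserving G μ μ) {P Q : Set S}
    (hP : MeasurableSet P) (hQ : MeasurableSet Q) :
    μ (P ∩ G.symm ⁻¹' Q) = μ (Q ∩ G ⁻¹' P) := by
  rw [← hG.measure_preimage (hP.inter (G.symm.continuous.measurable hQ)).nullMeasurableSet,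
    preimage_inter, ← preimage_comp, inter_comm]
  simp

namespace Weave

variable {S : Type} [TopologicalSpace S] [MeasurableSpace S] {μ : Measure S}
  {Ts Tu : MeasuredTurbulation μ} {V : Set S}

attribute [instance] finite_α finite_β noAtoms_α noAtoms_β

theorem swap_image (W : Weave Ts Tu V) (X Y : Set ℝ) :
    uncurry (fun b a => W.pt a b) '' (Y ×ˢ X) = uncurry W.pt '' (X ×ˢ Y) := by
  ext z
  constructor
  · rintro ⟨x, hx, rfl⟩
    exact ⟨(x.2, x.1), ⟨hx.2, hx.1⟩, rfl⟩
  · rintro ⟨x, hx, rfl⟩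
    exact ⟨(x.2, x.1), ⟨hx.2, hx.1⟩, rfl⟩

theorem pt_meas_swap (W : Weave Ts Tu V) : Measurable (uncurry fun b a => W.pt a b) :=
  W.pt_meas.comp measurable_swap

theorem measure_image_swap (W : Weave Ts Tu V) : ∀ E ⊆ W.B ×ˢ W.A, MeasurableSet E →
    MeasurableSet (uncurry (fun b a => W.pt a b) '' E) ∧
      μ (uncurry (fun b a => W.pt a b) '' E) = (W.β.prod W.α) E := by
  intro E hE hEm
  have h1 : uncurry (fun b a => W.pt a b) '' E = uncurry W.pt '' (Prod.swap ⁻¹' E) := by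
    rw [← image_swap_eq_preimage_swap, ← image_comp]
    rfl
  have h2 := W.measure_image (Prod.swap ⁻¹' E) (fun x hx => ⟨(hE hx).2, (hE hx).1⟩)
    (measurable_swap hEm)
  rw [h1]
  refine ⟨h2.1, h2.2.trans ?_⟩
  rw [← Measure.prod_swap (μ := W.α), Measure.map_apply measurable_swap hEm]

variable [CompactSpace S] [PolishSpace S] [BorelSpace S] [IsProbabilityMeasure μ]

/-- Along arbitrarily large times there are returns of two points of a stable tooth, together with
large parts of the unstable teeth through their images. -/
theorem exists_returns (W : Weave Ts Tu V) {F : S ≃ₜ S} (hF : MeasurePreserving F μ μ)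
    (hTs : Ts.Tame) (hTu : Tu.Tame) {κ κ' : ℕ → ℝ≥0∞}
    (hs : W.cs.Contracted (fun n => F ^ n) κ) (hu : W.cu.Contracted (fun n => (F ^ n).symm) κ')
    {Al Am Au Y C : Set ℝ} {Z : Fin 3 → Set ℝ} (hAl : Al ⊆ W.A) (hAm : Am ⊆ W.A) (hAu : Au ⊆ W.A)
    (hY : Y ⊆ W.B) (hC : C ⊆ W.B) (hZ : ∀ i, Z i ⊆ W.B) (mAl : MeasurableSet Al)
    (mAm : MeasurableSet Am) (mAu : MeasurableSet Au) (mY : MeasurableSet Y)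
    (mC : MeasurableSet C) (mZ : ∀ i, MeasurableSet (Z i)) (pAl : W.α Al ≠ 0) (pAm : W.α Am ≠ 0)
    (pAu : W.α Au ≠ 0) (pY : W.β Y ≠ 0) (pC : W.β C ≠ 0) (pZ : ∀ i, W.β (Z i) ≠ 0) :
    ∃ᶠ n in atTop, ∃ a₀ ∈ Al, ∃ a₁ ∈ Au, ∃ c ∈ C, ∃ a₀' ∈ Am, ∃ a₁' ∈ Am, ∃ b₀ ∈ Y, ∃ b₁ ∈ Y,
      (F ^ n) (W.pt a₀ c) = W.pt a₀' b₀ ∧ (F ^ n) (W.pt a₁ c) = W.pt a₁' b₁ ∧ ∀ i,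
      W.β.restrict (Z i) {y | (F ^ n).symm (W.pt a₀' y) ∉ uncurry W.pt '' (Al ×ˢ C)} <
        W.β (Z i) / 3 ∧
      W.β.restrict (Z i) {y | (F ^ n).symm (W.pt a₁' y) ∉ uncurry W.pt '' (Au ×ˢ C)} <
        W.β (Z i) / 3 := by
  have hFn : ∀ n : ℕ, MeasurePreserving (⇑(F ^ n : S ≃ₜ S)) μ μ := fun n => by
    rw [F.coe_pow_eq_iterate]; exact hF.iterate n
  have hFn' : ∀ n : ℕ, MeasurePreserving (⇑(F ^ n : S ≃ₜ S).symm) μ μ := fun n =>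
    MeasurePreserving.symm (F ^ n).toMeasurableEquiv (hFn n)
  have hbox : ∀ {X Y}, X ⊆ W.A → Y ⊆ W.B → MeasurableSet X → MeasurableSet Y →
      MeasurableSet (uncurry W.pt '' (X ×ˢ Y)) := fun hX hY mX mY =>
    (W.measure_image _ (prod_mono hX hY) (mX.prod mY)).1
  have hP := hbox hAm hC mAm mC
  have hP₁ := hbox hAm hY mAm mY
  have h1 : ∃ c : ℝ≥0∞, c ≠ 0 ∧ ∃ᶠ n in atTop, c ≤ μ (uncurry W.pt '' (Am ×ˢ C) ∩
      (F ^ n).symm ⁻¹' (uncurry W.pt '' (Am ×ˢ C))) := by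
    obtain ⟨c, hc, hfr⟩ := hF.exists_frequently_le_measure_inter hP (by
      rw [(W.measure_image _ (prod_mono hAm hC) (mAm.prod mC)).2, Measure.prod_prod]
      exact mul_ne_zero pAm pC)
    refine ⟨ENNReal.ofReal c, (ENNReal.ofReal_pos.2 hc).ne', hfr.mono fun n hn => ?_⟩
    rw [measure_inter_symm_preimage (hFn n) hP hP, F.coe_pow_eq_iterate]
    exact ENNReal.ofReal_le_of_le_toReal hn
  have h2 := hu.frequently_transfer hTu hFn' W.pt_meas hAm hC hY mAm mC mY W.measure_image pY hP h1
  have h3 : ∃ c : ℝ≥0∞, c ≠ 0 ∧ ∃ᶠ n in atTop, c ≤ μ (uncurry (fun b a => W.pt a b) '' (C ×ˢ Am) ∩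
      ⇑(F ^ n) ⁻¹' (uncurry W.pt '' (Am ×ˢ Y))) := by
    obtain ⟨c, hc, hfr⟩ := h2
    refine ⟨c, hc, hfr.mono fun n hn => ?_⟩
    rwa [measure_inter_symm_preimage (hFn n) hP₁ hP, ← W.swap_image] at hn
  have h4 := hs.frequently_transfer hTs hFn W.pt_meas_swap hC hAm hAl mC mAm mAl
    W.measure_image_swap pAl hP₁ h3
  obtain ⟨c, hc, h5⟩ := hs.frequently_pair hTs hFn W.pt_meas_swap hC hAl hAu mC mAl mAu
    W.measure_image_swap pAu hP₁ h4
  set m := (W.β.restrict C).prod ((W.α.restrict Al).prod (W.α.restrict Au)) with hm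
  have hε : ∀ i, W.β (Z i) / 3 ≠ 0 := fun i => (ENNReal.div_pos (pZ i) (by simp)).ne'
  have hε' : ∀ i, W.β (Z i) / 3 ≠ ⊤ := fun i => by finiteness
  have hex : ∀ D ⊆ W.A, MeasurableSet D → ∀ i, _ := fun D hD mD i =>
    hu.tendsto_exceptional hTu hFn' W.pt_meas hAm hY (hZ i) mAm mY (mZ i) W.measure_image (hε i)
      (hε' i) (hbox hD hC mD mC)
  let N : Set ℝ → Fin 3 → ℕ → Set S := fun D i n =>
    uncurry W.pt '' ((Am ×ˢ Y) ∩ {x | (F ^ n).symm (W.pt x.1 x.2) ∈ uncurry W.pt '' (D ×ˢ C) ∧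
      W.β (Z i) / 3 ≤ (W.β.restrict (Z i)) {y | (F ^ n).symm (W.pt x.1 y) ∉
        uncurry W.pt '' (D ×ˢ C)}})
  have hN : ∀ D ⊆ W.A, MeasurableSet D → ∀ i, (∀ n, MeasurableSet (N D i n)) ∧
      Tendsto (fun n => μ (N D i n)) atTop (𝓝 0) := hex
  have hNm : ∀ D ⊆ W.A, MeasurableSet D → ∀ i n, MeasurableSet (⇑(F ^ n) ⁻¹' N D i n) :=
    fun D hD mD i n => (F ^ n).continuous.measurable ((hN D hD mD i).1 n)
  have hle : ∀ D ⊆ W.A, MeasurableSet D → ∀ E ⊆ W.A, MeasurableSet E → ∀ i n,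
      ((W.β.restrict C).prod (W.α.restrict D))
        (uncurry (fun b a => W.pt a b) ⁻¹' (⇑(F ^ n) ⁻¹' N E i n)) ≤ μ (N E i n) := by
    intro D hD mD E hE mE i n
    rw [prod_restrict_preimage W.pt_meas_swap W.measure_image_swap hC hD mC mD (hNm E hE mE i n)]
    exact (measure_mono inter_subset_right).trans_eq
      ((hFn n).measure_preimage ((hN E hE mE i).1 n).nullMeasurableSet)
  have hlim : Tendsto (fun n => ∑ i, (W.α Au * μ (N Al i n) + W.α Al * μ (N Au i n))) atTop
      (𝓝 0) := by
    have : ∀ i : Fin 3, Tendsto (fun n => W.α Au * μ (N Al i n) + W.α Al * μ (N Au i n)) atTop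
        (𝓝 0) := fun i => by
      have h1 := ENNReal.Tendsto.const_mul (a := W.α Au) (hN Al hAl mAl i).2
        (Or.inr (measure_ne_top _ _))
      have h2 := ENNReal.Tendsto.const_mul (a := W.α Al) (hN Au hAu mAu i).2
        (Or.inr (measure_ne_top _ _))
      simpa using h1.add h2
    simpa using tendsto_finsetSum Finset.univ fun i _ => this i
  refine (h5.and_eventually (hlim.eventually_lt_const (pos_iff_ne_zero.2 hc))).mono ?_
  rintro n ⟨hn, hsum⟩
  by_contra hcon
  refine absurd (hn.trans ?_) (not_le.2 hsum)
  have hsupp : m (C ×ˢ (Al ×ˢ Au))ᶜ = 0 := by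
    rw [hm, Measure.prod_restrict, Measure.prod_restrict]
    exact ae_restrict_mem (mC.prod (mAl.prod mAu))
  calc m {x | (F ^ n) (W.pt x.2.1 x.1) ∈ uncurry W.pt '' (Am ×ˢ Y) ∧
        (F ^ n) (W.pt x.2.2 x.1) ∈ uncurry W.pt '' (Am ×ˢ Y)}
      ≤ m ((C ×ˢ (Al ×ˢ Au))ᶜ ∪ ⋃ i, ({x | (x.1, x.2.1) ∈
          uncurry (fun b a => W.pt a b) ⁻¹' (⇑(F ^ n) ⁻¹' N Al i n)} ∪ {x | (x.1, x.2.2) ∈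
          uncurry (fun b a => W.pt a b) ⁻¹' (⇑(F ^ n) ⁻¹' N Au i n)})) := by
        refine measure_mono ?_
        rintro ⟨c, a₀, a₁⟩ ⟨⟨⟨a₀', b₀⟩, ⟨ha₀', hb₀⟩, h₀⟩, ⟨⟨a₁', b₁⟩, ⟨ha₁', hb₁⟩, h₁⟩⟩
        by_contra hx
        rw [mem_union, not_or, notMem_compl_iff, mem_iUnion, not_exists] at hx
        obtain ⟨⟨hc, ha₀, ha₁⟩, hx⟩ := hx
        refine hcon ⟨a₀, ha₀, a₁, ha₁, c, hc, a₀', ha₀', a₁', ha₁', b₀, hb₀, b₁, hb₁, h₀.symm,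
          h₁.symm, fun i => ?_⟩
        have hx := hx i
        rw [mem_union, not_or] at hx
        constructor
        · by_contra! hge
          refine hx.1 ⟨(a₀', b₀), ⟨⟨ha₀', hb₀⟩, ?_, hge⟩, h₀⟩
          change (F ^ n).symm (uncurry W.pt (a₀', b₀)) ∈ _
          rw [h₀]
          exact ⟨(a₀, c), ⟨ha₀, hc⟩, ((F ^ n).symm_apply_apply _).symm⟩
        · by_contra! hge
          refine hx.2 ⟨(a₁', b₁), ⟨⟨ha₁', hb₁⟩, ?_, hge⟩, h₁⟩
          change (F ^ n).symm (uncurry W.pt (a₁', b₁)) ∈ _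
          rw [h₁]
          exact ⟨(a₁, c), ⟨ha₁, hc⟩, ((F ^ n).symm_apply_apply _).symm⟩
    _ ≤ m (C ×ˢ (Al ×ˢ Au))ᶜ + ∑ i, (m {x | (x.1, x.2.1) ∈
          uncurry (fun b a => W.pt a b) ⁻¹' (⇑(F ^ n) ⁻¹' N Al i n)} + m {x | (x.1, x.2.2) ∈
          uncurry (fun b a => W.pt a b) ⁻¹' (⇑(F ^ n) ⁻¹' N Au i n)}) := by
        refine (measure_union_le _ _).trans ?_
        gcongr
        refine (measure_iUnion_fintype_le _ _).trans ?_
        gcongr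
        exact measure_union_le _ _
    _ ≤ ∑ i, (W.α Au * μ (N Al i n) + W.α Al * μ (N Au i n)) := by
        rw [hsupp, zero_add]
        refine Finset.sum_le_sum fun i _ => ?_
        rw [hm, prod_prod_apply_fst (W.pt_meas_swap (hNm Al hAl mAl i n)),
          prod_prod_apply_snd (W.pt_meas_swap (hNm Au hAu mAu i n)),
          Measure.restrict_apply_univ, Measure.restrict_apply_univ]
        gcongr
        exacts [hle Al hAl mAl Al hAl mAl i n, hle Au hAu mAu Au hAu mAu i n]

end Weave

/-- Two quadruples separated in the same way by a common point, such that overlapping entries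
coincide, have the same third entry. -/
theorem eq_of_betweenness {c p₀ p₃ p₄ q₀ q₃ q₄ : ℝ} (hp₀ : c ≠ p₀) (hp₃ : p₃ ≠ c) (hq₀ : c ≠ q₀)
    (hq₃ : q₃ ≠ c) (hpc : c ∈ uIcc p₀ p₃) (hpp : p₃ ∈ uIcc c p₄) (hqc : c ∈ uIcc q₀ q₃)
    (hqq : q₃ ∈ uIcc c q₄) (h₁ : p₃ ∈ uIcc q₀ q₄ → p₃ = q₃) (h₂ : q₃ ∈ uIcc p₀ p₄ → q₃ = p₃)
    (h₃ : q₀ ∈ uIcc p₀ p₄ → q₀ = p₀) : p₃ = q₃ := by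
  have hp : (p₀ < c ∧ c < p₃ ∧ p₃ ≤ p₄) ∨ (c < p₀ ∧ p₃ < c ∧ p₄ ≤ p₃) := by
    rw [mem_uIcc] at hpc hpp
    grind
  have hq : (q₀ < c ∧ c < q₃ ∧ q₃ ≤ q₄) ∨ (c < q₀ ∧ q₃ < c ∧ q₄ ≤ q₃) := by
    rw [mem_uIcc] at hqc hqq
    grind
  rw [mem_uIcc] at h₁ h₂ h₃
  clear hpc hpp hqc hqq
  rcases hp with hp | hp <;> rcases hq with hq | hq
  · rcases le_total p₃ q₄ with h | h
    · exact h₁ (Or.inl ⟨by linarith, h⟩)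
    · exact (h₂ (Or.inl ⟨by linarith, by linarith⟩)).symm
  · rcases le_total p₃ q₀ with h | h
    · exact h₁ (Or.inr ⟨by linarith, h⟩)
    · have := h₃ (Or.inl ⟨by linarith, by linarith⟩)
      linarith
  · rcases le_total q₀ p₃ with h | h
    · exact h₁ (Or.inl ⟨h, by linarith⟩)
    · have := h₃ (Or.inr ⟨by linarith, by linarith⟩)
      linarith
  · rcases le_total q₄ p₃ with h | h
    · exact h₁ (Or.inr ⟨h, by linarith⟩)
    · exact (h₂ (Or.inr ⟨by linarith, by linarith⟩)).symm

/-- Null sets of labels pull back to null sets along a map between teeth. -/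
theorem Comb.Contracted.measure_preimage_eq_zero {S : Type} [TopologicalSpace S]
    [MeasurableSpace S] [PolishSpace S] [BorelSpace S] {μ : Measure S}
    {T : MeasuredTurbulation μ} {A B : Set ℝ} {β : Measure ℝ} {pt : ℝ → ℝ → S}
    {C : Comb T A B β pt} {H : ℕ → S ≃ₜ S} {κ : ℕ → ℝ≥0∞} (hC : C.Contracted H κ)
    (hpt : Measurable (uncurry pt)) (hB : MeasurableSet B) {a a₁ b c : ℝ} (ha : a ∈ A)
    (ha₁ : a₁ ∈ A) (hb : b ∈ B) (hc : c ∈ B) {k : ℕ} (h : H k (pt a b) = pt a₁ c) {X : Set ℝ}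
    (hX : X ⊆ B) (hXm : MeasurableSet X) (hX0 : β X = 0) :
    β {y | y ∈ B ∧ H k (pt a y) ∈ pt a₁ '' X} = 0 := by
  have hpa : ∀ a, Measurable (pt a) := fun a => hpt.of_uncurry_left
  have hl := hC.line_eq ha ha₁ hb hc h
  have hXi : MeasurableSet (pt a₁ '' X) := hXm.image_of_measurable_injOn (hpa a₁)
    fun x hx y hy hxy => C.pt_inj ha₁ (hX hx) (hX hy) hxy
  have hsub : ∀ a ∈ A, ∀ X ⊆ B, pt a '' X ⊆ C.line a := by
    rintro a ha X hX _ ⟨x, hx, rfl⟩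
    exact C.fiber_subset_line ha (C.pt_mem_fiber ha (hX hx))
  set Y := {y | y ∈ B ∧ H k (pt a y) ∈ pt a₁ '' X} with hY
  have hYm : MeasurableSet Y :=
    hB.inter ((H k).continuous.measurable.comp (hpa a) hXi)
  have hYB : Y ⊆ B := fun y hy => hy.1
  rw [← C.measure_eq a ha Y hYB hYm]
  refine hC.measure_eq_zero ha (hsub a ha Y hYB) (k := k) (measure_mono_null ?_ (?_ :
    T.ν (H k '' C.line a) (pt a₁ '' X) = 0))
  · rintro _ ⟨_, ⟨y, hy, rfl⟩, rfl⟩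
    exact hy.2
  · rw [hl, C.measure_eq a₁ ha₁ X hX hXm, hX0]

namespace Weave

variable {S : Type} [TopologicalSpace S] [MeasurableSpace S] {μ : Measure S}
  {Ts Tu : MeasuredTurbulation μ} {V : Set S}

/-- A rectangle of a weave, formed by the teeth `a₀, a₁` and `c₀, c₁`, which `G` maps across
itself, to the rectangle formed by the teeth `a₀', a₁'` and `b₀, b₁`. -/
structure Cell (W : Weave Ts Tu V) (G : S ≃ₜ S) (Q : Set S) where
  a₀ : ℝ
  a₁ : ℝ
  a₀' : ℝ
  a₁' : ℝ
  b₀ : ℝ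
  b₁ : ℝ
  c₀ : ℝ
  c₁ : ℝ
  a₀_mem : a₀ ∈ W.A
  a₁_mem : a₁ ∈ W.A
  a₀'_mem : a₀' ∈ W.A
  a₁'_mem : a₁' ∈ W.A
  b₀_mem : b₀ ∈ W.B
  b₁_mem : b₁ ∈ W.B
  c₀_mem : c₀ ∈ W.B
  c₁_mem : c₁ ∈ W.B
  a_lt : a₀ < a₀' ∧ a₀ < a₁' ∧ a₀' < a₁ ∧ a₁' < a₁
  c₀_ne : c₀ ≠ c₁
  map₀₀ : G (W.pt a₀ c₀) = W.pt a₀' b₀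
  map₁₀ : G (W.pt a₁ c₀) = W.pt a₁' b₀
  map₀₁ : G (W.pt a₀ c₁) = W.pt a₀' b₁
  map₁₁ : G (W.pt a₁ c₁) = W.pt a₁' b₁
  pt_mem : W.pt a₁' c₁ ∈ Q

section Coincidence

variable {G : ℕ → S ≃ₜ S} {κ κ' : ℕ → ℝ≥0∞} (W : Weave Ts Tu V)

theorem coincide (hs : W.cs.Contracted G κ) (hu : W.cu.Contracted (fun n => (G n).symm) κ')
    {a₀ a₁ a₀' a₁' p q q' q'' w w' w'' : ℝ} {Al Au : Set ℝ} {n : ℕ} (hAl : Al ⊆ W.A)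
    (hAu : Au ⊆ W.A) (mAl : MeasurableSet Al) (mAu : MeasurableSet Au)
    (hl : ∀ x ∈ Al, x < a₀') (hr : ∀ x ∈ Au, a₀' < x) (hκl : κ n * W.cs.bd < W.α Al)
    (hκr : κ n * W.cs.bd < W.α Au) (ha₀ : a₀ ∈ W.A) (ha₁ : a₁ ∈ W.A) (ha₀' : a₀' ∈ W.A)
    (ha₁' : a₁' ∈ W.A) (hp : p ∈ W.B) (hq : q ∈ W.B) (hq' : q' ∈ W.B) (hq'' : q'' ∈ W.B)
    (hw : w ∈ W.B) (hw' : w' ∈ W.B) (hw'' : w'' ∈ W.B) (h₀ : G n (W.pt a₀ p) = W.pt a₀' w)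
    (h : G n (W.pt a₁ q) = W.pt a₁' w) (h' : G n (W.pt a₁ q') = W.pt a₁' w')
    (h'' : G n (W.pt a₁ q'') = W.pt a₁' w'') (hpq : p ∈ uIcc q' q'') : p = q := by
  have hmem : W.pt a₁ p ∈ W.cu.par a₁ '' uIcc (W.cu.pos a₁ q') (W.cu.pos a₁ q'') :=
    ⟨_, (W.cu.pos_mem_uIcc_iff ha₁ hq' hq'' hp).2 hpq, W.cu.par_pos a₁ ha₁ p hp⟩
  rw [← hu.image_mem_arc ha₁' ha₁ hw' hw'' hq' hq'' (k := n)
    ((G n).symm_apply_eq.2 h'.symm) ((G n).symm_apply_eq.2 h''.symm)] at hmem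
  obtain ⟨z, hz, hzp⟩ := hmem
  have hzG : z = G n (W.pt a₁ p) := (G n).symm_apply_eq.1 hzp
  have hz1 : z ∈ W.cu.fiber a₁' := image_mono (W.cu.uIcc_subset_Icc ha₁' hw' hw'') hz
  have hz2 : z ∈ W.cs.fiber w := hzG ▸ hs.slide hp hw ha₀ ha₀' h₀ hAl hAu mAl mAu hl hr hκl hκr
    (W.cs.pt_mem_fiber hp ha₁)
  have hzw := W.inter a₁' ha₁' w hw z hz1 hz2
  rw [hzG, ← h] at hzw
  exact W.cu.pt_inj ha₁ hp hq ((G n).injective hzw)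

end Coincidence

variable [CompactSpace S] [PolishSpace S] [BorelSpace S] [IsProbabilityMeasure μ]

theorem exists_cell (W : Weave Ts Tu V) {F : S ≃ₜ S} (hF : MeasurePreserving F μ μ)
    (hTs : Ts.Tame) (hTu : Tu.Tame) {κ κ' : ℕ → ℝ≥0∞}
    (hs : W.cs.Contracted (fun n => F ^ n) κ) (hu : W.cu.Contracted (fun n => (F ^ n).symm) κ')
    {Q : Set S} (hQ : MeasurableSet Q) (htr : ∀ a ∈ W.A, W.β {b | b ∈ W.B ∧ W.pt a b ∉ Q} = 0)
    {Al Am Au : Set ℝ} {Y : Fin 5 → Set ℝ} (hAl : Al ⊆ W.A) (hAm : Am ⊆ W.A) (hAu : Au ⊆ W.A)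
    (hY : ∀ i, Y i ⊆ W.B) (mAl : MeasurableSet Al) (mAm : MeasurableSet Am)
    (mAu : MeasurableSet Au) (mY : ∀ i, MeasurableSet (Y i)) (pAl : W.α Al ≠ 0)
    (pAm : W.α Am ≠ 0) (pAu : W.α Au ≠ 0) (pY : ∀ i, W.β (Y i) ≠ 0)
    (hlm : ∀ x ∈ Al, ∀ y ∈ Am, x < y) (hmu : ∀ x ∈ Am, ∀ y ∈ Au, x < y)
    (hord : (∀ i j, i < j → ∀ x ∈ Y i, ∀ y ∈ Y j, x < y) ∨
      ∀ i j, i < j → ∀ x ∈ Y i, ∀ y ∈ Y j, y < x) :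
    ∃ n : ℕ, 1 ≤ n ∧ ∃ C : W.Cell (F ^ n) Q,
      C.b₀ ∈ Y 1 ∧ C.c₀ ∈ Y 2 ∧ C.c₁ ∈ Y 2 ∧ C.b₁ ∈ Y 3 := by
  have hsep : ∀ i j, i ≠ j → ∀ x ∈ Y i, ∀ y ∈ Y j, x ≠ y := by
    intro i j hij x hx y hy
    rcases lt_or_gt_of_ne hij with h | h <;> rcases hord with ho | ho
    exacts [(ho i j h x hx y hy).ne, (ho i j h x hx y hy).ne', (ho j i h y hy x hx).ne',
      (ho j i h y hy x hx).ne]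
  have hbtw : ∀ i j k, i < j → j < k → ∀ x ∈ Y i, ∀ y ∈ Y j, ∀ z ∈ Y k, y ∈ uIcc x z := by
    intro i j k hij hjk x hx y hy z hz
    rw [mem_uIcc]
    rcases hord with ho | ho
    exacts [Or.inl ⟨(ho i j hij x hx y hy).le, (ho j k hjk y hy z hz).le⟩,
      Or.inr ⟨(ho j k hjk y hy z hz).le, (ho i j hij x hx y hy).le⟩]
  have hev := (((hs.lim_mul_bd.eventually_lt_const (pos_iff_ne_zero.2 pAl)).and
    (hs.lim_mul_bd.eventually_lt_const (pos_iff_ne_zero.2 pAu))).and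
    ((hu.lim_mul_bd.eventually_lt_const (pos_iff_ne_zero.2 (pY 1))).and
    (hu.lim_mul_bd.eventually_lt_const (pos_iff_ne_zero.2 (pY 3))))).and (eventually_ge_atTop 1)
  obtain ⟨n, ⟨a₀, ha₀, a₁, ha₁, c, hc, a₀', ha₀', a₁', ha₁', b₀, hb₀, b₁, hb₁, h₀, h₁, hbad⟩,
    ⟨⟨hκl, hκu⟩, hκ1, hκ3⟩, hn⟩ := ((W.exists_returns hF hTs hTu hs hu (Z := ![Y 0, Y 3, Y 4]) hAl
      hAm hAu (hY 1) (hY 2) (by intro i; fin_cases i; exacts [hY 0, hY 3, hY 4]) mAl mAm mAu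
      (mY 1) (mY 2) (by intro i; fin_cases i; exacts [mY 0, mY 3, mY 4]) pAl pAm pAu (pY 1) (pY 2)
      (by intro i; fin_cases i; exacts [pY 0, pY 3, pY 4])).and_eventually hev).exists
  have mem₀ := hAl ha₀
  have mem₁ := hAu ha₁
  have mem₀' := hAm ha₀'
  have mem₁' := hAm ha₁'
  have memc := hY 2 hc
  have memb := hY 1 hb₀
  have hslide : ∀ {x x' p w}, x ∈ W.A → x' ∈ Am → p ∈ W.B → w ∈ W.B →
      (F ^ n) (W.pt x p) = W.pt x' w → ∀ z ∈ W.cs.fiber p, (F ^ n) z ∈ W.cs.fiber w :=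
    fun hx hx' hp hw h z hz => hs.slide hp hw hx (hAm hx') h hAl hAu mAl mAu
      (fun y hy => hlm y hy _ hx') (fun y hy => hmu _ hx' y hy) hκl hκu hz
  obtain rfl : b₀ = b₁ := by
    have h2 := hslide mem₀ ha₀' memc memb h₀ _ (W.cs.pt_mem_fiber memc mem₁)
    rw [h₁] at h2
    exact W.cs.eq_of_mem_fiber memb (hY 1 hb₁) h2 (W.cs.pt_mem_fiber (hY 1 hb₁) mem₁')
  have hinv : ∀ {x y}, (F ^ n) x = y → (F ^ n).symm y = x := fun h =>
    (F ^ n).symm_apply_eq.2 h.symm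
  have huslide : ∀ {x x'}, x ∈ W.A → x' ∈ W.A → (F ^ n) (W.pt x c) = W.pt x' b₀ →
      ∀ z ∈ W.cu.fiber x', (F ^ n).symm z ∈ W.cu.fiber x := by
    intro x x' hx hx' h z hz
    rcases hord with ho | ho
    · exact hu.slide hx' hx memb memc (hinv h) (hY 1) (hY 3) (mY 1) (mY 3)
        (fun y hy => ho 1 2 (by decide) y hy c hc) (fun y hy => ho 2 3 (by decide) c hc y hy)
        hκ1 hκ3 hz
    · exact hu.slide hx' hx memb memc (hinv h) (hY 3) (hY 1) (mY 3) (mY 1)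
        (fun y hy => ho 2 3 (by decide) c hc y hy) (fun y hy => ho 1 2 (by decide) y hy c hc)
        hκ3 hκ1 hz
  set X := {b | b ∈ W.B ∧ W.pt a₁' b ∉ Q} with hX
  have hXm : MeasurableSet X :=
    W.measurableSet_B.inter (W.pt_meas.of_uncurry_left hQ).compl
  have hnull := hu.measure_preimage_eq_zero W.pt_meas W.measurableSet_B mem₁' mem₁ memb memc
    (k := n) (hinv h₁) (fun x hx => hx.1) hXm (htr a₁' mem₁')
  have hpick : ∀ i, ∃ w ∈ (![Y 0, Y 3, Y 4] : Fin 3 → Set ℝ) i, ∃ p ∈ Y 2, ∃ q ∈ Y 2,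
      (F ^ n) (W.pt a₀ p) = W.pt a₀' w ∧ (F ^ n) (W.pt a₁ q) = W.pt a₁' w ∧ W.pt a₁' q ∈ Q := by
    intro i
    have hZ : (![Y 0, Y 3, Y 4] : Fin 3 → Set ℝ) i ⊆ W.B := by
      fin_cases i; exacts [hY 0, hY 3, hY 4]
    have hZm : MeasurableSet ((![Y 0, Y 3, Y 4] : Fin 3 → Set ℝ) i) := by
      fin_cases i; exacts [mY 0, mY 3, mY 4]
    have hb := hbad i
    set Z := (![Y 0, Y 3, Y 4] : Fin 3 → Set ℝ) i
    have hlt : W.β.restrict Z ({y | (F ^ n).symm (W.pt a₀' y) ∉ uncurry W.pt '' (Al ×ˢ Y 2)} ∪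
        {y | (F ^ n).symm (W.pt a₁' y) ∉ uncurry W.pt '' (Au ×ˢ Y 2)} ∪
        {y | y ∈ W.B ∧ (F ^ n).symm (W.pt a₁' y) ∈ W.pt a₁ '' X}) < W.β Z := by
      refine (measure_union_le _ _).trans_lt ?_
      rw [nonpos_iff_eq_zero.1 ((Measure.restrict_apply_le _ _).trans hnull.le), add_zero]
      refine (measure_union_le _ _).trans_lt ((ENNReal.add_lt_add hb.1 hb.2).trans_le ?_)
      calc W.β Z / 3 + W.β Z / 3 ≤ W.β Z / 3 + W.β Z / 3 + W.β Z / 3 := le_self_add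
        _ = W.β Z := ENNReal.add_thirds _
    obtain ⟨w, hw, hwbad⟩ : ∃ w ∈ Z, w ∉ {y | (F ^ n).symm (W.pt a₀' y) ∉
        uncurry W.pt '' (Al ×ˢ Y 2)} ∪
        {y | (F ^ n).symm (W.pt a₁' y) ∉ uncurry W.pt '' (Au ×ˢ Y 2)} ∪
        {y | y ∈ W.B ∧ (F ^ n).symm (W.pt a₁' y) ∈ W.pt a₁ '' X} := by
      by_contra! hcon
      refine absurd hlt (not_lt.2 ?_)
      rw [← Measure.restrict_apply_self W.β Z]
      exact measure_mono hcon
    simp only [mem_union, mem_ofPred_eq, not_or, not_not, not_and] at hwbad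
    obtain ⟨⟨⟨⟨x, p⟩, ⟨hx, hp⟩, hxp⟩, ⟨y, q⟩, ⟨hy, hq⟩, hyq⟩, hX'⟩ := hwbad
    simp only [uncurry_apply_pair] at hxp hyq
    obtain rfl : x = a₀ := W.cu.eq_of_mem_fiber (hAl hx) mem₀
      (W.cu.pt_mem_fiber (hAl hx) (hY 2 hp))
      (hxp ▸ huslide mem₀ mem₀' h₀ _ (W.cu.pt_mem_fiber mem₀' (hZ hw)))
    obtain rfl : y = a₁ := W.cu.eq_of_mem_fiber (hAu hy) mem₁
      (W.cu.pt_mem_fiber (hAu hy) (hY 2 hq))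
      (hyq ▸ huslide mem₁ mem₁' h₁ _ (W.cu.pt_mem_fiber mem₁' (hZ hw)))
    refine ⟨w, hw, p, hp, q, hq, ((F ^ n).symm_apply_eq.1 hxp.symm).symm,
      ((F ^ n).symm_apply_eq.1 hyq.symm).symm, ?_⟩
    by_contra hqQ
    exact hX' (hZ hw) ⟨q, ⟨hY 2 hq, hqQ⟩, hyq⟩
  obtain ⟨w₀, hw₀, p₀, hp₀, q₀, hq₀, hp₀w, hq₀w, -⟩ := hpick 0
  obtain ⟨w₃, hw₃, p₃, hp₃, q₃, hq₃, hp₃w, hq₃w, hq₃Q⟩ := hpick 1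
  obtain ⟨w₄, hw₄, p₄, hp₄, q₄, hq₄, hp₄w, hq₄w, -⟩ := hpick 2
  replace hw₀ : w₀ ∈ Y 0 := hw₀
  replace hw₃ : w₃ ∈ Y 3 := hw₃
  replace hw₄ : w₄ ∈ Y 4 := hw₄
  have hpt_ne : ∀ {x x' p q w w'}, x ∈ W.A → x' ∈ W.A → w ∈ W.B → w' ∈ W.B →
      (F ^ n) (W.pt x p) = W.pt x' w → (F ^ n) (W.pt x q) = W.pt x' w' → w ≠ w' → p ≠ q := by
    rintro x x' p q w w' - hx' hw hw' h h' hne rfl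
    exact hne (W.cu.pt_inj hx' hw hw' (h.symm.trans h'))
  have hb : ∀ {x x' p q r u v w}, x ∈ W.A → x' ∈ W.A → p ∈ W.B → q ∈ W.B → r ∈ W.B →
      u ∈ W.B → v ∈ W.B → w ∈ W.B → (F ^ n) (W.pt x p) = W.pt x' u →
      (F ^ n) (W.pt x q) = W.pt x' v → (F ^ n) (W.pt x r) = W.pt x' w → v ∈ uIcc u w →
      q ∈ uIcc p r := fun hx hx' hp hq hr hu' hv hw h h' h'' hm =>
    (hu.between hx' hx hu' hv hw hp hq hr (k := n) (hinv h) (hinv h') (hinv h'')).2 hm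
  have hB2 : ∀ {x}, x ∈ Y 2 → x ∈ W.B := fun h => hY 2 h
  have hbw₀ := hbtw 0 1 3 (by decide) (by decide) _ hw₀ _ hb₀ _ hw₃
  have hbw₃ := hbtw 1 3 4 (by decide) (by decide) _ hb₀ _ hw₃ _ hw₄
  have hco := fun {x y x' y' p q q' q'' w w' w''} => W.coincide hs hu (a₀ := x) (a₁ := y)
    (a₀' := x') (a₁' := y') (p := p) (q := q) (q' := q') (q'' := q'') (w := w) (w' := w')
    (w'' := w'') (n := n) hAl hAu mAl mAu
  have hl₀ := fun y hy => hlm y hy _ ha₀'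
  have hl₁ := fun y hy => hlm y hy _ ha₁'
  have hr₀ := fun y hy => hmu _ ha₀' y hy
  have hr₁ := fun y hy => hmu _ ha₁' y hy
  obtain rfl : p₃ = q₃ := eq_of_betweenness (c := c) (p₀ := p₀) (p₄ := p₄) (q₀ := q₀) (q₄ := q₄)
    (hpt_ne mem₀ mem₀' memb (hY 0 hw₀) h₀ hp₀w (hsep 1 0 (by decide) _ hb₀ _ hw₀))
    (hpt_ne mem₀ mem₀' (hY 3 hw₃) memb hp₃w h₀ (hsep 3 1 (by decide) _ hw₃ _ hb₀))
    (hpt_ne mem₁ mem₁' memb (hY 0 hw₀) h₁ hq₀w (hsep 1 0 (by decide) _ hb₀ _ hw₀))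
    (hpt_ne mem₁ mem₁' (hY 3 hw₃) memb hq₃w h₁ (hsep 3 1 (by decide) _ hw₃ _ hb₀))
    (hb mem₀ mem₀' (hB2 hp₀) memc (hB2 hp₃) (hY 0 hw₀) memb (hY 3 hw₃) hp₀w h₀ hp₃w hbw₀)
    (hb mem₀ mem₀' memc (hB2 hp₃) (hB2 hp₄) memb (hY 3 hw₃) (hY 4 hw₄) h₀ hp₃w hp₄w hbw₃)
    (hb mem₁ mem₁' (hB2 hq₀) memc (hB2 hq₃) (hY 0 hw₀) memb (hY 3 hw₃) hq₀w h₁ hq₃w hbw₀)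
    (hb mem₁ mem₁' memc (hB2 hq₃) (hB2 hq₄) memb (hY 3 hw₃) (hY 4 hw₄) h₁ hq₃w hq₄w hbw₃)
    (hco hl₀ hr₀ hκl hκu mem₀ mem₁ mem₀' mem₁' (hB2 hp₃) (hB2 hq₃) (hB2 hq₀) (hB2 hq₄) (hY 3 hw₃)
      (hY 0 hw₀) (hY 4 hw₄) hp₃w hq₃w hq₀w hq₄w)
    (hco hl₁ hr₁ hκl hκu mem₁ mem₀ mem₁' mem₀' (hB2 hq₃) (hB2 hp₃) (hB2 hp₀) (hB2 hp₄) (hY 3 hw₃)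
      (hY 0 hw₀) (hY 4 hw₄) hq₃w hp₃w hp₀w hp₄w)
    (hco hl₁ hr₁ hκl hκu mem₁ mem₀ mem₁' mem₀' (hB2 hq₀) (hB2 hp₀) (hB2 hp₀) (hB2 hp₄) (hY 0 hw₀)
      (hY 0 hw₀) (hY 4 hw₄) hq₀w hp₀w hp₀w hp₄w)
  exact ⟨n, hn, ⟨a₀, a₁, a₀', a₁', b₀, w₃, c, p₃, mem₀, mem₁, mem₀', mem₁', memb, hY 3 hw₃, memc,
    hB2 hp₃, ⟨hlm _ ha₀ _ ha₀', hlm _ ha₀ _ ha₁', hmu _ ha₀' _ ha₁, hmu _ ha₁' _ ha₁⟩,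
    hpt_ne mem₀ mem₀' memb (hY 3 hw₃) h₀ hp₃w (hsep 1 3 (by decide) _ hb₀ _ hw₃), h₀, h₁, hp₃w,
    hq₃w, hq₃Q⟩, hb₀, hc, hp₃, hw₃⟩

end Weave

section Transversality

variable {S : Type} [TopologicalSpace S] [T2Space S]

/-- An injective path inside an arc that sits at `x` at an interior time passes `x` in the
interior of the arc, and the arc contains a neighbourhood of `x` in the line. -/
theorem UniqueArcs.eventually_mem {ℓ α : Set S} (hℓ : UniqueArcs ℓ) (hα : IsArc ℓ α) {σ : ℝ → S}
    (hσ : Continuous σ) (hσi : Injective σ) (hσα : ∀ u, σ u ∈ α) {g : ℝ → S} (hg : Continuous g)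
    (hgi : Injective g) (hgr : range g = ℓ) {t₀ u₀ : ℝ} (h : g t₀ = σ u₀) :
    ∀ᶠ t in 𝓝 t₀, g t ∈ α := by
  obtain ⟨-, -, f, hf, hfi, hfr, a, b, hab, -, -, rfl⟩ := hα
  have hemb : IsEmbedding (fun s : Icc a b => f s) :=
    ((hf.comp continuous_subtype_val).isClosedEmbedding
      (hfi.comp Subtype.val_injective)).isEmbedding
  choose τ hτ hτσ using hσα
  have hτc : Continuous τ := by
    have : Continuous fun u => (⟨τ u, hτ u⟩ : Icc a b) := by
      rw [hemb.continuous_iff]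
      refine hσ.congr fun u => (hτσ u).symm
    exact continuous_subtype_val.comp this
  have hτi : Injective τ := fun u v huv => hσi (by rw [← hτσ, ← hτσ, huv])
  obtain ⟨hu, hv⟩ : τ u₀ ∈ Ioo a b := by
    rcases hτc.strictMono_of_inj hτi with hm | hm
    · exact ⟨(hτ (u₀ - 1)).1.trans_lt (hm (by linarith)),
        (hm (by linarith : u₀ < u₀ + 1)).trans_le (hτ (u₀ + 1)).2⟩
    · exact ⟨(hτ (u₀ + 1)).1.trans_lt (hm (by linarith)),
        (hm (by linarith : u₀ - 1 < u₀)).trans_le (hτ (u₀ - 1)).2⟩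
  have hpar : ∀ s, ∃ t, g t = f s := fun s => by
    have : f s ∈ range g := by rw [hgr, ← hfr]; exact mem_range_self s
    exact this
  obtain ⟨ta, hta⟩ := hpar a
  obtain ⟨tb, htb⟩ := hpar b
  have harc : g '' uIcc ta tb = f '' Icc a b := by
    have h1 := isArcIn_uIcc hg hgi hgr ta tb
    have h2 := isArcIn_uIcc hf hfi hfr a b
    rw [hta, htb] at h1
    rw [← uIcc_of_le hab]
    exact hℓ _ _ _ _ h1 h2
  have ht₀ : t₀ ∈ uIcc ta tb := by
    rw [← hgi.mem_set_image, harc, h, ← hτσ]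
    exact mem_image_of_mem _ (hτ u₀)
  have hne : ∀ {s t}, g t = f s → s ≠ τ u₀ → t ≠ t₀ := by
    rintro s t hst hs rfl
    exact hs (hfi (by rw [← hst, h, hτσ]))
  have hta' := hne hta hu.ne
  have htb' := hne htb hv.ne'
  have hnhds : uIcc ta tb ∈ 𝓝 t₀ := by
    rw [mem_uIcc] at ht₀
    rcases ht₀ with ht | ht
    · rw [uIcc_of_le (ht.1.trans ht.2)]
      exact Icc_mem_nhds (lt_of_le_of_ne ht.1 hta') (lt_of_le_of_ne ht.2 htb'.symm)
    · rw [uIcc_of_ge (ht.1.trans ht.2)]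
      exact Icc_mem_nhds (lt_of_le_of_ne ht.1 htb') (lt_of_le_of_ne ht.2 hta'.symm)
  filter_upwards [hnhds] with t ht
  rw [← harc]
  exact mem_image_of_mem g ht

/-- Two parametrized lines crossing transversely are the coordinate axes of a chart. -/
theorem TransverseAt.exists_chart {ℓ ℓ' : Set S} {x : S} (hx : TransverseAt ℓ ℓ' x)
    (hℓ : UniqueArcs ℓ) (hℓ' : UniqueArcs ℓ') {p q : ℝ → S} (hp : Continuous p)
    (hpi : Injective p) (hpr : range p = ℓ) (hq : Continuous q) (hqi : Injective q)
    (hqr : range q = ℓ') {t₀ s₀ : ℝ} (ht₀ : p t₀ = x) (hs₀ : q s₀ = x) :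
    ∃ φ : ℝ × ℝ → S, ∃ ρ₁ ρ₂ : ℝ → ℝ, ∃ I₁ ∈ 𝓝 t₀, ∃ I₂ ∈ 𝓝 s₀, IsOpenEmbedding φ ∧
      φ (0, 0) = x ∧ ContinuousOn ρ₁ I₁ ∧ ContinuousOn ρ₂ I₂ ∧ ρ₁ t₀ = 0 ∧ ρ₂ s₀ = 0 ∧
      (∀ t ∈ I₁, p t = φ (ρ₁ t, 0)) ∧ ∀ s ∈ I₂, q s = φ (0, ρ₂ s) := by
  obtain ⟨α, β, hxα, hxβ, hα, hβ, U, hU, hxU, e, heα, heβ⟩ := hx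
  set φ : ℝ × ℝ → S := fun z => e.symm z with hφ
  have hφe : IsOpenEmbedding φ := hU.isOpenEmbedding_subtypeVal.comp e.symm.isOpenEmbedding
  have hrange : ∀ y (hy : y ∈ U), φ (e ⟨y, hy⟩) = y := fun y hy => by simp [hφ]
  have hφU : ∀ z, φ z ∈ U := fun z => (e.symm z).2
  have heφ : ∀ z, e ⟨φ z, hφU z⟩ = z := fun z => by simp [hφ]
  have hα2 : ∀ y (hy : y ∈ U), y ∈ α ↔ (e ⟨y, hy⟩).2 = 0 := fun y hy => by
    constructor
    · intro h
      have : y ∈ α ∩ U := ⟨h, hy⟩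
      rw [← heα] at this
      obtain ⟨z, hz, rfl⟩ := this
      exact hz
    · intro h
      have : y ∈ α ∩ U := by
        rw [← heα]
        exact ⟨⟨y, hy⟩, h, rfl⟩
      exact this.1
  have hβ2 : ∀ y (hy : y ∈ U), y ∈ β ↔ (e ⟨y, hy⟩).1 = 0 := fun y hy => by
    constructor
    · intro h
      have : y ∈ β ∩ U := ⟨h, hy⟩
      rw [← heβ] at this
      obtain ⟨z, hz, rfl⟩ := this
      exact hz
    · intro h
      have : y ∈ β ∩ U := by
        rw [← heβ]
        exact ⟨⟨y, hy⟩, h, rfl⟩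
      exact this.1
  have hx0 : e ⟨x, hxU⟩ = (0, 0) := Prod.ext ((hβ2 x hxU).1 hxβ) ((hα2 x hxU).1 hxα)
  have hφ0 : φ (0, 0) = x := by rw [← hx0, hrange]
  have hp1 : ∀ᶠ t in 𝓝 t₀, p t ∈ α := hℓ.eventually_mem hα (σ := fun u => φ (u, 0))
    (hφe.continuous.comp (by fun_prop)) (hφe.injective.comp (Prod.mk_left_injective 0))
    (fun u => (hα2 _ (hφU _)).2 (by rw [heφ])) hp hpi hpr (u₀ := 0) (ht₀.trans hφ0.symm)
  have hq1 : ∀ᶠ s in 𝓝 s₀, q s ∈ β := hℓ'.eventually_mem hβ (σ := fun u => φ (0, u))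
    (hφe.continuous.comp (by fun_prop)) (hφe.injective.comp (Prod.mk_right_injective 0))
    (fun u => (hβ2 _ (hφU _)).2 (by rw [heφ])) hq hqi hqr (u₀ := 0) (hs₀.trans hφ0.symm)
  have hpU : ∀ᶠ t in 𝓝 t₀, p t ∈ U := hp.continuousAt.eventually (ht₀ ▸ hU.mem_nhds hxU)
  have hqU : ∀ᶠ s in 𝓝 s₀, q s ∈ U := hq.continuousAt.eventually (hs₀ ▸ hU.mem_nhds hxU)
  let ψ := (hφe.toOpenPartialHomeomorph φ).symm
  have hψφ : ∀ z, ψ (φ z) = z := fun z =>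
    (hφe.toOpenPartialHomeomorph φ).left_inv (mem_univ _)
  have hψe : ∀ y (hy : y ∈ U), ψ y = e ⟨y, hy⟩ := fun y hy => by
    conv_lhs => rw [← hrange y hy]
    exact hψφ _
  have hψc : ContinuousOn ψ U := by
    refine (hφe.toOpenPartialHomeomorph φ).continuousOn_symm.mono fun y hy => ?_
    rw [IsOpenEmbedding.toOpenPartialHomeomorph_target]
    exact ⟨_, hrange y hy⟩
  refine ⟨φ, fun t => (ψ (p t)).1, fun s => (ψ (q s)).2, {t | p t ∈ α ∧ p t ∈ U}, hp1.and hpU,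
    {s | q s ∈ β ∧ q s ∈ U}, hq1.and hqU, hφe, hφ0, ?_, ?_, ?_, ?_, ?_, ?_⟩
  · exact continuous_fst.comp_continuousOn (hψc.comp hp.continuousOn fun t ht => ht.2)
  · exact continuous_snd.comp_continuousOn (hψc.comp hq.continuousOn fun t ht => ht.2)
  · simp only [ht₀]
    rw [hψe x hxU, hx0]
  · simp only [hs₀]
    rw [hψe x hxU, hx0]
  · rintro t ⟨htα, htU⟩
    beta_reduce
    rw [hψe _ htU, ← (hα2 _ htU).1 htα, hrange]
  · rintro s ⟨hsβ, hsU⟩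
    beta_reduce
    rw [hψe _ hsU, ← (hβ2 _ hsU).1 hsβ, hrange]

/-- Two lines crossing transversely exactly once have non-zero boundary increment in a planar
coordinate. -/
theorem TransverseAt.boundaryInc_ne_zero {ℓ ℓ' : Set S} {x : S} (hx : TransverseAt ℓ ℓ' x)
    (hℓ : UniqueArcs ℓ) (hℓ' : UniqueArcs ℓ') {p q : ℝ → S} (hp : Continuous p)
    (hpi : Injective p) (hpr : range p = ℓ) (hq : Continuous q) (hqi : Injective q)
    (hqr : range q = ℓ') {t₀ s₀ : ℝ} (ht₀ : p t₀ = x) (hs₀ : q s₀ = x) (ht : t₀ ∈ Ioo (0 : ℝ) 1)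
    (hs : s₀ ∈ Ioo (0 : ℝ) 1)
    (hpq : ∀ t ∈ Icc (0 : ℝ) 1, ∀ s ∈ Icc (0 : ℝ) 1, q s = p t → t = t₀ ∧ s = s₀) {O : Set S}
    (hO : IsOpen O) {κ : S → ℂ} (hκ : ContinuousOn κ O) (hκi : InjOn κ O)
    (hκo : ∀ y ∈ O, ∀ N ∈ 𝓝 y, κ '' N ∈ 𝓝 (κ y)) (hpO : MapsTo p (Icc 0 1) O)
    (hqO : MapsTo q (Icc 0 1) O) :
    boundaryInc (fun z => κ (q z.2) - κ (p z.1)) 0 1 0 1 ≠ 0 := by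
  obtain ⟨φ, ρ₁, ρ₂, I₁, hI₁, I₂, hI₂, hφ, hφ0, hρ₁, hρ₂, h₁, h₂, hpφ, hqφ⟩ :=
    hx.exists_chart hℓ hℓ' hp hpi hpr hq hqi hqr ht₀ hs₀
  have hxO : x ∈ O := ht₀ ▸ hpO (Ioo_subset_Icc_self ht)
  have hN : φ ⁻¹' O ∈ 𝓝 ((0, 0) : ℝ × ℝ) :=
    hφ.continuous.continuousAt.preimage_mem_nhds (hφ0 ▸ hO.mem_nhds hxO)
  obtain ⟨r, hr, hrO⟩ := Metric.nhds_basis_closedBall.mem_iff.1 hN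
  have hsq : Icc (-r) r ×ˢ Icc (-r) r ⊆ φ ⁻¹' O := by
    refine Subset.trans ?_ hrO
    rintro ⟨u, v⟩ ⟨hu, hv⟩
    rw [Metric.mem_closedBall, Prod.dist_eq, max_le_iff, dist_zero_right, dist_zero_right]
    exact ⟨abs_le.2 hu, abs_le.2 hv⟩
  refine boundaryInc_ne_zero_of_crossing (p := fun t => κ (p t)) (q := fun s => κ (q s))
    (t₀ := t₀) (s₀ := s₀)
    (hκ.comp hp.continuousOn hpO) (hκ.comp hq.continuousOn hqO) ht hs
    (fun t ht s hs h => hpq t ht s hs (hκi (hqO hs) (hpO ht) h)) (h := κ ∘ φ) hr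
    (hκ.comp hφ.continuous.continuousOn hsq)
    (fun y hy z hz h => hφ.injective (hκi (hsq hy) (hsq hz) h)) (fun N hN => ?_) hI₁ hI₂ hρ₁ hρ₂
    (fun t ht t' ht' h => hpi (by rw [hpφ t ht, hpφ t' ht', h]))
    (fun s hs s' hs' h => hqi (by rw [hqφ s hs, hqφ s' hs', h])) h₁ h₂
    (fun t ht => by rw [hpφ t ht]; rfl) (fun s hs => by rw [hqφ s hs]; rfl)
  rw [image_comp]
  exact hκo _ (hφ0 ▸ hxO) _ (hφ.isOpenMap.image_mem_nhds hN)

end Transversality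

theorem escapes_or_escapes {X Y : Set ℂ} (hX : IsCompact X) (hY : IsCompact Y)
    (hXn : X.Nonempty) (hXY : Disjoint X Y) : (∃ d ∈ Y, Escapes X d) ∨ ∃ d ∈ X, Escapes Y d := by
  obtain ⟨m, hm, hmax⟩ := (hX.union hY).exists_isMaxOn (hXn.mono subset_union_left)
    (continuous_norm (E := ℂ)).continuousOn
  by_cases hm0 : m = 0
  · refine Or.inr ?_
    obtain ⟨x, hx⟩ := hXn
    have hz : ∀ y ∈ X ∪ Y, y = 0 := fun y hy => by
      have : ‖y‖ ≤ ‖m‖ := hmax hy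
      simpa [hm0] using this
    have hYe : Y = ∅ := eq_empty_of_forall_notMem fun y hy => hXY.notMem_of_mem_left hx
      (by rwa [hz x (Or.inl hx), ← hz y (Or.inr hy)])
    exact ⟨x, hx, univ, isPreconnected_univ, mem_univ _, by simp [hYe],
      NormedSpace.unbounded_univ ℝ ℂ⟩
  have key : ∀ Q ⊆ X ∪ Y, m ∉ Q → Escapes Q m := fun Q hQ hmQ => by
    refine escapes_of_ray (z₀ := 0) hm0 fun t ht htQ => ?_
    have h1 : ‖(0 : ℂ) + t * (m - 0)‖ ≤ ‖m‖ := hmax (hQ htQ)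
    rw [zero_add, sub_zero, norm_mul, Complex.norm_real, Real.norm_of_nonneg (by linarith)] at h1
    have h2 : 0 < ‖m‖ := norm_pos_iff.2 hm0
    have h3 : t = 1 := by nlinarith
    rw [h3] at htQ
    exact hmQ (by simpa using htQ)
  rcases hm with hm | hm
  · exact Or.inr ⟨m, hm, key Y subset_union_right (hXY.notMem_of_mem_left hm)⟩
  · exact Or.inl ⟨m, hm, key X subset_union_left (hXY.notMem_of_mem_right hm)⟩

namespace Comb

variable {S : Type} [TopologicalSpace S] [MeasurableSpace S] {μ : Measure S}
  {T : MeasuredTurbulation μ} {A B : Set ℝ} {β : Measure ℝ} {pt : ℝ → ℝ → S}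

/-- The part of a fiber between two of its marked points. -/
def arc (C : Comb T A B β pt) (a b b' : ℝ) : Set S := C.par a '' uIcc (C.pos a b) (C.pos a b')

/-- The affine parametrization over `[0, 1]` of the part of a fiber between two marked points. -/
def side (C : Comb T A B β pt) (a b b' : ℝ) (t : ℝ) : S :=
  C.par a (AffineMap.lineMap (C.pos a b) (C.pos a b') t)

variable (C : Comb T A B β pt) {a b b' c : ℝ}

theorem side_image : (C.side a b b') '' Icc 0 1 = C.arc a b b' := by
  rw [arc, ← segment_eq_uIcc, segment_eq_image_lineMap, image_image]
  rfl

theorem side_zero (ha : a ∈ A) (hb : b ∈ B) : C.side a b b' 0 = pt a b := by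
  rw [side, AffineMap.lineMap_apply_zero, C.par_pos a ha b hb]

theorem side_one (ha : a ∈ A) (hb' : b' ∈ B) : C.side a b b' 1 = pt a b' := by
  rw [side, AffineMap.lineMap_apply_one, C.par_pos a ha b' hb']

theorem continuous_side (ha : a ∈ A) : Continuous (C.side a b b') :=
  (C.par_cont a ha).comp AffineMap.lineMap_continuous

theorem injective_side (ha : a ∈ A) (hb : b ∈ B) (hb' : b' ∈ B) (h : b ≠ b') :
    Injective (C.side a b b') :=
  (C.par_inj a ha).comp (AffineMap.lineMap_injective ℝ ((C.pos_mono a ha).injOn.ne hb hb' h))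

theorem range_side (ha : a ∈ A) (hb : b ∈ B) (hb' : b' ∈ B) (h : b ≠ b') :
    range (C.side a b b') = C.line a := by
  have hs : Surjective (AffineMap.lineMap (k := ℝ) (C.pos a b) (C.pos a b')) := fun y => by
    have hne : C.pos a b' - C.pos a b ≠ 0 :=
      sub_ne_zero.2 ((C.pos_mono a ha).injOn.ne hb' hb h.symm)
    refine ⟨(y - C.pos a b) / (C.pos a b' - C.pos a b), ?_⟩
    rw [AffineMap.lineMap_apply_ring', div_mul_cancel₀ _ hne, sub_add_cancel]
  rw [← C.par_range a ha]
  exact hs.range_comp (C.par a)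

theorem arc_subset_fiber (ha : a ∈ A) (hb : b ∈ B) (hb' : b' ∈ B) : C.arc a b b' ⊆ C.fiber a :=
  image_mono (C.uIcc_subset_Icc ha hb hb')

theorem pt_mem_arc (ha : a ∈ A) (hb : b ∈ B) (hb' : b' ∈ B) (hc : c ∈ B) :
    pt a c ∈ C.arc a b b' ↔ c ∈ uIcc b b' := by
  rw [← C.pos_mem_uIcc_iff ha hb hb' hc, arc, ← C.par_pos a ha c hc, (C.par_inj a ha).mem_set_image]

theorem isCompact_arc (ha : a ∈ A) : IsCompact (C.arc a b b') :=
  isCompact_uIcc.image (C.par_cont a ha)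

theorem isCompact_fiber (ha : a ∈ A) : IsCompact (C.fiber a) :=
  isCompact_Icc.image (C.par_cont a ha)

theorem isPreconnected_arc (ha : a ∈ A) : IsPreconnected (C.arc a b b') :=
  isPreconnected_uIcc.image _ (C.par_cont a ha).continuousOn

theorem isPreconnected_fiber (ha : a ∈ A) : IsPreconnected (C.fiber a) :=
  isPreconnected_Icc.image _ (C.par_cont a ha).continuousOn

theorem image_arc (C : Comb T A B β pt) {a a₁ b b' c c' : ℝ} (ha : a ∈ A) (ha₁ : a₁ ∈ A)
    (hb : b ∈ B) (hb' : b' ∈ B) (hc : c ∈ B) (hc' : c' ∈ B) (hun : UniqueArcs (C.line a₁))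
    {G : S ≃ₜ S} (hl : G '' C.line a = C.line a₁) (h : G (pt a b) = pt a₁ c)
    (h' : G (pt a b') = pt a₁ c') : G '' C.arc a b b' = C.arc a₁ c c' := by
  have h1 := (C.isArcIn ha (C.pos a b) (C.pos a b')).image G
  have h2 := C.isArcIn ha₁ (C.pos a₁ c) (C.pos a₁ c')
  rw [hl, C.par_pos a ha b hb, C.par_pos a ha b' hb', h, h'] at h1
  rw [C.par_pos a₁ ha₁ c hc, C.par_pos a₁ ha₁ c' hc'] at h2
  exact hun _ _ _ _ h1 h2

end Comb

namespace Weave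

variable {S : Type} [TopologicalSpace S] [MeasurableSpace S] {μ : Measure S}
  {Ts Tu : MeasuredTurbulation μ} {V : Set S} (W : Weave Ts Tu V)

theorem mem_uIcc_of_mem_cu_arc {a b b' c : ℝ} (ha : a ∈ W.A) (hb : b ∈ W.B) (hb' : b' ∈ W.B)
    (hc : c ∈ W.B) {z : S} (h : z ∈ W.cu.arc a b b') (hz : z ∈ W.cs.fiber c) : c ∈ uIcc b b' := by
  have := W.inter a ha c hc z (W.cu.arc_subset_fiber ha hb hb' h) hz
  rwa [this, W.cu.pt_mem_arc ha hb hb' hc] at h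

theorem mem_uIcc_of_mem_cs_arc {a a' b c : ℝ} (ha : a ∈ W.A) (ha' : a' ∈ W.A) (hb : b ∈ W.B)
    (hc : c ∈ W.A) {z : S} (h : z ∈ W.cs.arc b a a') (hz : z ∈ W.cu.fiber c) : c ∈ uIcc a a' := by
  have := W.inter c hc b hb z hz (W.cs.arc_subset_fiber hb ha ha' h)
  rwa [this, W.cs.pt_mem_arc hb ha ha' hc] at h

/-- The grid formed by some stable fibers and the parts of some unstable fibers between the stable
fibers `b` and `b'`. -/
def hull (A' B' : Set ℝ) (b b' : ℝ) : Set S :=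
  (⋃ y ∈ B', W.cs.fiber y) ∪ ⋃ x ∈ A', W.cu.arc x b b'

variable {A' B' A'' B'' : Set ℝ} {b b' d d' : ℝ}

theorem isCompact_hull (hA : A' ⊆ W.A) (hB : B' ⊆ W.B) (fA : A'.Finite) (fB : B'.Finite) :
    IsCompact (W.hull A' B' b b') :=
  (fB.isCompact_biUnion fun _ hy => W.cs.isCompact_fiber (hB hy)).union
    (fA.isCompact_biUnion fun _ hx => W.cu.isCompact_arc (hA hx))

theorem fiber_subset_hull {y : ℝ} (hy : y ∈ B') : W.cs.fiber y ⊆ W.hull A' B' b b' :=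
  (subset_biUnion_of_mem (u := fun y => W.cs.fiber y) hy).trans subset_union_left

theorem arc_subset_hull {x : ℝ} (hx : x ∈ A') : W.cu.arc x b b' ⊆ W.hull A' B' b b' :=
  (subset_biUnion_of_mem (u := fun x => W.cu.arc x b b') hx).trans subset_union_right

theorem isPreconnected_hull (hA : A' ⊆ W.A) (hB : B' ⊆ W.B) {a : ℝ} (ha : a ∈ A') (hb : b ∈ B')
    (hb' : b' ∈ W.B) (hBb : B' ⊆ uIcc b b') : IsPreconnected (W.hull A' B' b b') := by
  have hpt : ∀ x ∈ A', ∀ y ∈ B', W.pt x y ∈ W.cu.arc x b b' := fun x hx y hy =>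
    (W.cu.pt_mem_arc (hA hx) (hB hb) hb' (hB hy)).2 (hBb hy)
  have hpt' : ∀ x ∈ A', ∀ y ∈ B', W.pt x y ∈ W.cs.fiber y := fun x hx y hy =>
    W.cs.pt_mem_fiber (hB hy) (hA hx)
  refine isPreconnected_of_forall (W.pt a b) fun z hz => ?_
  rcases hz with hz | hz
  · obtain ⟨y, hy, hzy⟩ := mem_iUnion₂.1 hz
    exact ⟨W.cu.arc a b b' ∪ W.cs.fiber y,
      union_subset (W.arc_subset_hull ha) (W.fiber_subset_hull hy), Or.inl (hpt a ha b hb),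
      Or.inr hzy, (W.cu.isPreconnected_arc (hA ha)).union _ (hpt a ha y hy) (hpt' a ha y hy)
        (W.cs.isPreconnected_fiber (hB hy))⟩
  · obtain ⟨x, hx, hzx⟩ := mem_iUnion₂.1 hz
    exact ⟨W.cu.arc x b b' ∪ W.cs.fiber b,
      union_subset (W.arc_subset_hull hx) (W.fiber_subset_hull hb), Or.inr (hpt' a ha b hb),
      Or.inl hzx, (W.cu.isPreconnected_arc (hA hx)).union _ (hpt x hx b hb) (hpt' x hx b hb)
        (W.cs.isPreconnected_fiber (hB hb))⟩

theorem disjoint_hull (hA : A' ⊆ W.A) (hA' : A'' ⊆ W.A) (hB : B' ⊆ W.B) (hB' : B'' ⊆ W.B)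
    (hb : b ∈ B') (hb' : b' ∈ B') (hd : d ∈ B'') (hd' : d' ∈ B'') (hBb : B' ⊆ uIcc b b')
    (hBd : B'' ⊆ uIcc d d') (h : Disjoint (uIcc b b') (uIcc d d')) :
    Disjoint (W.hull A' B' b b') (W.hull A'' B'' d d') := by
  have hmix : ∀ {A' A'' B' B'' : Set ℝ} {b b' d d' : ℝ} {z : S}, A'' ⊆ W.A → B' ⊆ W.B → B'' ⊆ W.B →
      d ∈ B'' → d' ∈ B'' → B' ⊆ uIcc b b' → Disjoint (uIcc b b') (uIcc d d') →
      z ∈ ⋃ y ∈ B', W.cs.fiber y → z ∉ ⋃ x ∈ A'', W.cu.arc x d d' := by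
    intro A' A'' B' B'' b b' d d' z hA' hB hB' hd hd' hBb h hz hz'
    obtain ⟨y, hy, hzy⟩ := mem_iUnion₂.1 hz
    obtain ⟨x, hx, hzx⟩ := mem_iUnion₂.1 hz'
    exact h.notMem_of_mem_left (hBb hy)
      (W.mem_uIcc_of_mem_cu_arc (hA' hx) (hB' hd) (hB' hd') (hB hy) hzx hzy)
  refine Set.disjoint_left.2 fun z hz hz' => ?_
  rcases hz with hz | hz <;> rcases hz' with hz' | hz'
  · obtain ⟨y, hy, hzy⟩ := mem_iUnion₂.1 hz
    obtain ⟨y', hy', hzy'⟩ := mem_iUnion₂.1 hz'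
    have := W.cs.eq_of_mem_fiber (hB hy) (hB' hy') hzy hzy'
    exact h.notMem_of_mem_left (hBb hy) (this ▸ hBd hy')
  · exact hmix (A' := A') hA' hB hB' hd hd' hBb h hz hz'
  · exact hmix (A' := A') hA hB' hB hb hb' hBd h.symm hz' hz
  · obtain ⟨x, hx, u, hu, rfl⟩ := mem_iUnion₂.1 hz
    obtain ⟨x', hx', hzx'⟩ := mem_iUnion₂.1 hz'
    obtain rfl := W.cu.eq_of_mem_fiber (hA hx) (hA' hx')
      (W.cu.arc_subset_fiber (hA hx) (hB hb) (hB hb') ⟨u, hu, rfl⟩)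
      (W.cu.arc_subset_fiber (hA' hx') (hB' hd) (hB' hd') hzx')
    have hu' : u ∈ uIcc (W.cu.pos x d) (W.cu.pos x d') := by
      rwa [Comb.arc, (W.cu.par_inj x (hA hx)).mem_set_image] at hzx'
    have key : W.cu.pos x b ∈ uIcc (W.cu.pos x d) (W.cu.pos x d') ∨
        W.cu.pos x b' ∈ uIcc (W.cu.pos x d) (W.cu.pos x d') ∨
        W.cu.pos x d ∈ uIcc (W.cu.pos x b) (W.cu.pos x b') := by
      simp only [mem_uIcc] at hu hu' ⊢
      grind
    rw [W.cu.pos_mem_uIcc_iff (hA hx) (hB' hd) (hB' hd') (hB hb),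
      W.cu.pos_mem_uIcc_iff (hA hx) (hB' hd) (hB' hd') (hB hb'),
      W.cu.pos_mem_uIcc_iff (hA hx) (hB hb) (hB hb') (hB' hd)] at key
    rcases key with key | key | key
    · exact h.notMem_of_mem_left left_mem_uIcc key
    · exact h.notMem_of_mem_left right_mem_uIcc key
    · exact h.notMem_of_mem_left key left_mem_uIcc

end Weave

namespace Weave

variable {S : Type} [TopologicalSpace S] [MeasurableSpace S] {μ : Measure S}
  {Ts Tu : MeasuredTurbulation μ} {V : Set S} {W : Weave Ts Tu V}

namespace Cell

variable {G : S ≃ₜ S} {Q : Set S} (C : W.Cell G Q)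

/-- The grid formed by the cell and its image. -/
def hull : Set S := W.hull {C.a₀, C.a₁, C.a₀', C.a₁'} {C.b₀, C.b₁, C.c₀, C.c₁} C.b₀ C.b₁

/-- The sides of the cell. -/
def sides : Fin 4 → ℝ → S := ![W.cs.side C.c₀ C.a₀ C.a₁, W.cu.side C.a₁ C.c₀ C.c₁,
  W.cs.side C.c₁ C.a₁ C.a₀, W.cu.side C.a₀ C.c₁ C.c₀]

/-- The arcs bounding the cell. -/
def arcs : Fin 4 → Set S := ![W.cs.arc C.c₀ C.a₀ C.a₁, W.cu.arc C.a₁ C.c₀ C.c₁,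
  W.cs.arc C.c₁ C.a₁ C.a₀, W.cu.arc C.a₀ C.c₁ C.c₀]

/-- The arcs bounding the image of the cell. -/
def imageArcs : Fin 4 → Set S := ![W.cs.arc C.b₀ C.a₀' C.a₁', W.cu.arc C.a₁' C.b₀ C.b₁,
  W.cs.arc C.b₁ C.a₁' C.a₀', W.cu.arc C.a₀' C.b₁ C.b₀]

theorem sides_image (k : Fin 4) : C.sides k '' Icc 0 1 = C.arcs k := by
  fin_cases k
  · exact W.cs.side_image
  · exact W.cu.side_image
  · exact W.cs.side_image
  · exact W.cu.side_image

theorem continuous_sides (k : Fin 4) : Continuous (C.sides k) := by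
  fin_cases k
  · exact W.cs.continuous_side C.c₀_mem
  · exact W.cu.continuous_side C.a₁_mem
  · exact W.cs.continuous_side C.c₁_mem
  · exact W.cu.continuous_side C.a₀_mem

theorem sides_one (k : Fin 4) : C.sides k 1 = C.sides (k + 1) 0 := by
  fin_cases k
  · exact (W.cs.side_one C.c₀_mem C.a₁_mem).trans (W.cu.side_zero C.a₁_mem C.c₀_mem).symm
  · exact (W.cu.side_one C.a₁_mem C.c₁_mem).trans (W.cs.side_zero C.c₁_mem C.a₁_mem).symm
  · exact (W.cs.side_one C.c₁_mem C.a₀_mem).trans (W.cu.side_zero C.a₀_mem C.c₁_mem).symm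
  · exact (W.cu.side_one C.a₀_mem C.c₀_mem).trans (W.cs.side_zero C.c₀_mem C.a₀_mem).symm

theorem image_line_s (hs : ∀ b ∈ W.B, G '' W.cs.line b ∈ Ts.lines) {a a' b b' : ℝ} (ha : a ∈ W.A)
    (ha' : a' ∈ W.A) (hb : b ∈ W.B) (hb' : b' ∈ W.B) (h : G (W.pt a b) = W.pt a' b') :
    G '' W.cs.line b = W.cs.line b' :=
  Comb.lines_eq_of_mem (hs b hb) (W.cs.line_mem b' hb')
    ⟨_, W.cs.fiber_subset_line hb (W.cs.pt_mem_fiber hb ha), h⟩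
    (W.cs.fiber_subset_line hb' (W.cs.pt_mem_fiber hb' ha'))

theorem image_line_u (hu : ∀ a ∈ W.A, G '' W.cu.line a ∈ Tu.lines) {a a' b b' : ℝ} (ha : a ∈ W.A)
    (ha' : a' ∈ W.A) (hb : b ∈ W.B) (hb' : b' ∈ W.B) (h : G (W.pt a b) = W.pt a' b') :
    G '' W.cu.line a = W.cu.line a' :=
  Comb.lines_eq_of_mem (hu a ha) (W.cu.line_mem a' ha')
    ⟨_, W.cu.fiber_subset_line ha (W.cu.pt_mem_fiber ha hb), h⟩
    (W.cu.fiber_subset_line ha' (W.cu.pt_mem_fiber ha' hb'))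

theorem arcs_image (hs : ∀ b ∈ W.B, G '' W.cs.line b ∈ Ts.lines)
    (hu : ∀ a ∈ W.A, G '' W.cu.line a ∈ Tu.lines) (us : ∀ b ∈ W.B, UniqueArcs (W.cs.line b))
    (uu : ∀ a ∈ W.A, UniqueArcs (W.cu.line a)) (k : Fin 4) :
    G '' C.arcs k = C.imageArcs k := by
  fin_cases k
  · exact W.cs.image_arc C.c₀_mem C.b₀_mem C.a₀_mem C.a₁_mem C.a₀'_mem C.a₁'_mem
      (us _ C.b₀_mem) (image_line_s hs C.a₀_mem C.a₀'_mem C.c₀_mem C.b₀_mem C.map₀₀) C.map₀₀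
      C.map₁₀
  · exact W.cu.image_arc C.a₁_mem C.a₁'_mem C.c₀_mem C.c₁_mem C.b₀_mem C.b₁_mem
      (uu _ C.a₁'_mem) (image_line_u hu C.a₁_mem C.a₁'_mem C.c₀_mem C.b₀_mem C.map₁₀) C.map₁₀
      C.map₁₁
  · exact W.cs.image_arc C.c₁_mem C.b₁_mem C.a₁_mem C.a₀_mem C.a₁'_mem C.a₀'_mem
      (us _ C.b₁_mem) (image_line_s hs C.a₀_mem C.a₀'_mem C.c₁_mem C.b₁_mem C.map₀₁) C.map₁₁
      C.map₀₁
  · exact W.cu.image_arc C.a₀_mem C.a₀'_mem C.c₁_mem C.c₀_mem C.b₁_mem C.b₀_mem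
      (uu _ C.a₀'_mem) (image_line_u hu C.a₀_mem C.a₀'_mem C.c₀_mem C.b₀_mem C.map₀₀) C.map₀₁
      C.map₀₀

theorem cu_cu {a a' b b' d d' : ℝ} (ha : a ∈ W.A) (ha' : a' ∈ W.A) (hb : b ∈ W.B)
    (hb' : b' ∈ W.B) (hd : d ∈ W.B) (hd' : d' ∈ W.B) (h : a ≠ a') :
    Disjoint (W.cu.arc a b b') (W.cu.arc a' d d') :=
  (W.cu.disj a ha a' ha' h).mono (W.cu.arc_subset_fiber ha hb hb')
    (W.cu.arc_subset_fiber ha' hd hd')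

theorem cs_cs {a a' b b' d d' : ℝ} (ha : a ∈ W.A) (ha' : a' ∈ W.A) (hb : b ∈ W.B)
    (hb' : b' ∈ W.B) (hd : d ∈ W.A) (hd' : d' ∈ W.A) (h : b ≠ b') :
    Disjoint (W.cs.arc b a a') (W.cs.arc b' d d') :=
  (W.cs.disj b hb b' hb' h).mono (W.cs.arc_subset_fiber hb ha ha')
    (W.cs.arc_subset_fiber hb' hd hd')

theorem cs_cu {a a' b x d d' : ℝ} (ha : a ∈ W.A) (ha' : a' ∈ W.A) (hb : b ∈ W.B)
    (hx : x ∈ W.A) (hd : d ∈ W.B) (hd' : d' ∈ W.B) (h : b ∉ uIcc d d') :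
    Disjoint (W.cs.arc b a a') (W.cu.arc x d d') :=
  Set.disjoint_left.2 fun _ hz hz' =>
    h (W.mem_uIcc_of_mem_cu_arc hx hd hd' hb hz' (W.cs.arc_subset_fiber hb ha ha' hz))

variable {e : ℝ}

/-- The stable fibers of a cell and of its image, and a further fiber `e`, are in order. -/
def Ordered (e : ℝ) : Prop :=
  (e < C.b₀ ∧ C.b₀ < C.c₀ ∧ C.b₀ < C.c₁ ∧ C.c₀ < C.b₁ ∧ C.c₁ < C.b₁) ∨
    (C.b₀ < e ∧ C.c₀ < C.b₀ ∧ C.c₁ < C.b₀ ∧ C.b₁ < C.c₀ ∧ C.b₁ < C.c₁)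

theorem disjoint_arcs (he : C.Ordered e) (k l : Fin 4) (hlk : l ≤ k) (h : ¬ (k = 2 ∧ l = 1)) :
    Disjoint (C.imageArcs l) (C.arcs k) := by
  have h1 : C.b₀ ∉ uIcc C.c₀ C.c₁ := by rw [mem_uIcc]; rcases he with he | he <;> grind
  have h2 : C.b₁ ∉ uIcc C.c₀ C.c₁ := by rw [mem_uIcc]; rcases he with he | he <;> grind
  have n1 : C.b₀ ≠ C.c₀ := fun h => h1 (h ▸ left_mem_uIcc)
  have n2 : C.b₀ ≠ C.c₁ := fun h => h1 (h ▸ right_mem_uIcc)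
  have n3 : C.b₁ ≠ C.c₁ := fun h => h2 (h ▸ right_mem_uIcc)
  obtain ⟨l1, l2, l3, l4⟩ := C.a_lt
  fin_cases k <;> fin_cases l <;> try (exfalso; revert hlk; decide)
  · exact cs_cs C.a₀'_mem C.a₁'_mem C.b₀_mem C.c₀_mem C.a₀_mem C.a₁_mem n1
  · exact cs_cu C.a₀'_mem C.a₁'_mem C.b₀_mem C.a₁_mem C.c₀_mem C.c₁_mem h1
  · exact cu_cu C.a₁'_mem C.a₁_mem C.b₀_mem C.b₁_mem C.c₀_mem C.c₁_mem l4.ne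
  · exact cs_cs C.a₀'_mem C.a₁'_mem C.b₀_mem C.c₁_mem C.a₁_mem C.a₀_mem n2
  · exact absurd ⟨rfl, rfl⟩ h
  · exact cs_cs C.a₁'_mem C.a₀'_mem C.b₁_mem C.c₁_mem C.a₁_mem C.a₀_mem n3
  · exact cs_cu C.a₀'_mem C.a₁'_mem C.b₀_mem C.a₀_mem C.c₁_mem C.c₀_mem (uIcc_comm C.c₁ _ ▸ h1)
  · exact cu_cu C.a₁'_mem C.a₀_mem C.b₀_mem C.b₁_mem C.c₁_mem C.c₀_mem l2.ne'
  · exact cs_cu C.a₁'_mem C.a₀'_mem C.b₁_mem C.a₀_mem C.c₁_mem C.c₀_mem (uIcc_comm C.c₁ _ ▸ h2)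
  · exact cu_cu C.a₀'_mem C.a₀_mem C.b₁_mem C.b₀_mem C.c₁_mem C.c₀_mem l1.ne'

theorem arcs_subset_hull (he : C.Ordered e) (k : Fin 4) : C.arcs k ⊆ C.hull := by
  have hs : ∀ b ∈ ({C.b₀, C.b₁, C.c₀, C.c₁} : Set ℝ), b ∈ W.B → ∀ a ∈ W.A, ∀ a' ∈ W.A,
      W.cs.arc b a a' ⊆ C.hull := fun b hb hbB a ha a' ha' =>
    (W.cs.arc_subset_fiber hbB ha ha').trans (W.fiber_subset_hull hb)
  have hu : ∀ a ∈ ({C.a₀, C.a₁, C.a₀', C.a₁'} : Set ℝ), a ∈ W.A → ∀ b ∈ W.B, ∀ b' ∈ W.B,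
      b ∈ uIcc C.b₀ C.b₁ → b' ∈ uIcc C.b₀ C.b₁ → W.cu.arc a b b' ⊆ C.hull :=
    fun a ha haA b hb b' hb' h h' => Subset.trans (image_mono (uIcc_subset_uIcc
      ((W.cu.pos_mem_uIcc_iff haA C.b₀_mem C.b₁_mem hb).2 h)
      ((W.cu.pos_mem_uIcc_iff haA C.b₀_mem C.b₁_mem hb').2 h'))) (W.arc_subset_hull ha)
  have h1 : C.c₀ ∈ uIcc C.b₀ C.b₁ := by rw [mem_uIcc]; rcases he with he | he <;> grind
  have h2 : C.c₁ ∈ uIcc C.b₀ C.b₁ := by rw [mem_uIcc]; rcases he with he | he <;> grind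
  fin_cases k
  · exact hs _ (by simp) C.c₀_mem _ C.a₀_mem _ C.a₁_mem
  · exact hu _ (by simp) C.a₁_mem _ C.c₀_mem _ C.c₁_mem h1 h2
  · exact hs _ (by simp) C.c₁_mem _ C.a₁_mem _ C.a₀_mem
  · exact hu _ (by simp) C.a₀_mem _ C.c₁_mem _ C.c₀_mem h2 h1

theorem imageArcs_subset_hull (k : Fin 4) : C.imageArcs k ⊆ C.hull := by
  have hs : ∀ b ∈ ({C.b₀, C.b₁, C.c₀, C.c₁} : Set ℝ), b ∈ W.B → ∀ a ∈ W.A, ∀ a' ∈ W.A,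
      W.cs.arc b a a' ⊆ C.hull := fun b hb hbB a ha a' ha' =>
    (W.cs.arc_subset_fiber hbB ha ha').trans (W.fiber_subset_hull hb)
  fin_cases k
  · exact hs _ (by simp) C.b₀_mem _ C.a₀'_mem _ C.a₁'_mem
  · exact W.arc_subset_hull (by simp)
  · exact hs _ (by simp) C.b₁_mem _ C.a₁'_mem _ C.a₀'_mem
  · refine Subset.trans ?_ (W.arc_subset_hull (x := C.a₀') (b := C.b₀) (b' := C.b₁) (by simp))
    exact (image_mono (uIcc_comm _ _).subset :
      W.cu.arc C.a₀' C.b₁ C.b₀ ⊆ W.cu.arc C.a₀' C.b₀ C.b₁)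

theorem disjoint_path_arcs (he : C.Ordered e) (heB : e ∈ W.B) (k : Fin 4) :
    Disjoint (W.cu.arc C.a₀' C.b₀ e ∪ W.cs.fiber e) (C.arcs k) := by
  have h1 : C.c₀ ∉ uIcc C.b₀ e := by rw [mem_uIcc]; rcases he with he | he <;> grind
  have h2 : C.c₁ ∉ uIcc C.b₀ e := by rw [mem_uIcc]; rcases he with he | he <;> grind
  have h3 : e ∉ uIcc C.c₀ C.c₁ := by rw [mem_uIcc]; rcases he with he | he <;> grind
  have n1 : e ≠ C.c₀ := fun h => h3 (h ▸ left_mem_uIcc)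
  have n2 : e ≠ C.c₁ := fun h => h3 (h ▸ right_mem_uIcc)
  obtain ⟨l1, l2, l3, l4⟩ := C.a_lt
  have hfs : ∀ {b a a' : ℝ}, b ∈ W.B → a ∈ W.A → a' ∈ W.A → e ≠ b →
      Disjoint (W.cs.fiber e) (W.cs.arc b a a') := fun hb ha ha' h =>
    (W.cs.disj e heB _ hb h).mono_right (W.cs.arc_subset_fiber hb ha ha')
  have hfu : ∀ {a b b' : ℝ}, a ∈ W.A → b ∈ W.B → b' ∈ W.B → e ∉ uIcc b b' →
      Disjoint (W.cs.fiber e) (W.cu.arc a b b') := fun ha hb hb' h =>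
    Set.disjoint_left.2 fun z hz hz' => h (W.mem_uIcc_of_mem_cu_arc ha hb hb' heB hz' hz)
  fin_cases k
  · exact ((cs_cu C.a₀_mem C.a₁_mem C.c₀_mem C.a₀'_mem C.b₀_mem heB h1).symm).union_left
      (hfs C.c₀_mem C.a₀_mem C.a₁_mem n1)
  · exact (cu_cu C.a₀'_mem C.a₁_mem C.b₀_mem heB C.c₀_mem C.c₁_mem l3.ne).union_left
      (hfu C.a₁_mem C.c₀_mem C.c₁_mem h3)
  · exact ((cs_cu C.a₁_mem C.a₀_mem C.c₁_mem C.a₀'_mem C.b₀_mem heB h2).symm).union_left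
      (hfs C.c₁_mem C.a₁_mem C.a₀_mem n2)
  · exact (cu_cu C.a₀'_mem C.a₀_mem C.b₀_mem heB C.c₁_mem C.c₀_mem l1.ne').union_left
      (hfu C.a₀_mem C.c₁_mem C.c₀_mem (uIcc_comm C.c₁ _ ▸ h3))

theorem disjoint_path_imageArcs (he : C.Ordered e) (heB : e ∈ W.B) (k : Fin 4) :
    Disjoint (W.cu.arc C.a₀ C.c₀ e ∪ W.cs.fiber e) (C.imageArcs k) := by
  have h3 : e ∉ uIcc C.b₀ C.b₁ := by rw [mem_uIcc]; rcases he with he | he <;> grind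
  have n1 : e ≠ C.b₀ := fun h => h3 (h ▸ left_mem_uIcc)
  have n2 : e ≠ C.b₁ := fun h => h3 (h ▸ right_mem_uIcc)
  obtain ⟨l1, l2, l3, l4⟩ := C.a_lt
  have h4 : C.a₀ ∉ uIcc C.a₀' C.a₁' := by rw [mem_uIcc]; grind
  have hfs : ∀ {b a a' : ℝ}, b ∈ W.B → a ∈ W.A → a' ∈ W.A → e ≠ b → C.a₀ ∉ uIcc a a' →
      Disjoint (W.cu.arc C.a₀ C.c₀ e ∪ W.cs.fiber e) (W.cs.arc b a a') :=
    fun hb ha ha' h h' => Disjoint.union_left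
      (Set.disjoint_left.2 fun z hz hz' => h' (W.mem_uIcc_of_mem_cs_arc ha ha' hb C.a₀_mem hz'
        (W.cu.arc_subset_fiber C.a₀_mem C.c₀_mem heB hz)))
      ((W.cs.disj e heB _ hb h).mono_right (W.cs.arc_subset_fiber hb ha ha'))
  have hfu : ∀ {a b b' : ℝ}, a ∈ W.A → b ∈ W.B → b' ∈ W.B → e ∉ uIcc b b' →
      Disjoint (W.cs.fiber e) (W.cu.arc a b b') := fun ha hb hb' h =>
    Set.disjoint_left.2 fun z hz hz' => h (W.mem_uIcc_of_mem_cu_arc ha hb hb' heB hz' hz)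
  fin_cases k
  · exact hfs C.b₀_mem C.a₀'_mem C.a₁'_mem n1 h4
  · exact (cu_cu C.a₀_mem C.a₁'_mem C.c₀_mem heB C.b₀_mem C.b₁_mem l2.ne).union_left
      (hfu C.a₁'_mem C.b₀_mem C.b₁_mem h3)
  · exact hfs C.b₁_mem C.a₁'_mem C.a₀'_mem n2 (uIcc_comm C.a₁' _ ▸ h4)
  · exact (cu_cu C.a₀_mem C.a₀'_mem C.c₀_mem heB C.b₁_mem C.b₀_mem l1.ne).union_left
      (hfu C.a₀'_mem C.b₁_mem C.b₀_mem (uIcc_comm C.b₁ _ ▸ h3))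

end Cell

end Weave

namespace Weave

variable {S : Type} [TopologicalSpace S] [MeasurableSpace S] {μ : Measure S}
  {Ts Tu : MeasuredTurbulation μ} {V : Set S} {W : Weave Ts Tu V}

namespace Cell

variable {G : S ≃ₜ S} {Q : Set S} (C : W.Cell G Q)

theorem arcs_subset (k : Fin 4) : C.arcs k ⊆ V := by
  fin_cases k
  · exact (W.cs.arc_subset_fiber C.c₀_mem C.a₀_mem C.a₁_mem).trans (W.cs_sub _ C.c₀_mem)
  · exact (W.cu.arc_subset_fiber C.a₁_mem C.c₀_mem C.c₁_mem).trans (W.cu_sub _ C.a₁_mem)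
  · exact (W.cs.arc_subset_fiber C.c₁_mem C.a₁_mem C.a₀_mem).trans (W.cs_sub _ C.c₁_mem)
  · exact (W.cu.arc_subset_fiber C.a₀_mem C.c₁_mem C.c₀_mem).trans (W.cu_sub _ C.a₀_mem)

theorem imageArcs_subset (k : Fin 4) : C.imageArcs k ⊆ V := by
  fin_cases k
  · exact (W.cs.arc_subset_fiber C.b₀_mem C.a₀'_mem C.a₁'_mem).trans (W.cs_sub _ C.b₀_mem)
  · exact (W.cu.arc_subset_fiber C.a₁'_mem C.b₀_mem C.b₁_mem).trans (W.cu_sub _ C.a₁'_mem)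
  · exact (W.cs.arc_subset_fiber C.b₁_mem C.a₁'_mem C.a₀'_mem).trans (W.cs_sub _ C.b₁_mem)
  · exact (W.cu.arc_subset_fiber C.a₀'_mem C.b₁_mem C.b₀_mem).trans (W.cu_sub _ C.a₀'_mem)

/-- The top side of a cell crosses the right side of its image exactly once. -/
theorem crossing {e : ℝ} (he : C.Ordered e) (hs : ∀ b ∈ W.B, G '' W.cs.line b ∈ Ts.lines)
    (hu : ∀ a ∈ W.A, G '' W.cu.line a ∈ Tu.lines) (us : ∀ b ∈ W.B, UniqueArcs (W.cs.line b))
    (uu : ∀ a ∈ W.A, UniqueArcs (W.cu.line a)) :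
    ∃ t₀ ∈ Ioo (0 : ℝ) 1, ∃ s₀ ∈ Ioo (0 : ℝ) 1, C.sides 2 t₀ = W.pt C.a₁' C.c₁ ∧
      G (C.sides 1 s₀) = W.pt C.a₁' C.c₁ ∧ ∀ t ∈ Icc (0 : ℝ) 1, ∀ s ∈ Icc (0 : ℝ) 1,
        G (C.sides 1 s) = C.sides 2 t → t = t₀ ∧ s = s₀ := by
  obtain ⟨l1, l2, l3, l4⟩ := C.a_lt
  have hp : ∀ t ∈ Icc (0 : ℝ) 1, C.sides 2 t ∈ W.cs.arc C.c₁ C.a₁ C.a₀ := fun t ht =>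
    (C.sides_image 2).subset (mem_image_of_mem _ ht)
  have hG : (fun s => G (C.sides 1 s)) '' Icc 0 1 = W.cu.arc C.a₁' C.b₀ C.b₁ := by
    rw [← image_image (g := G) (f := C.sides 1), C.sides_image, C.arcs_image hs hu us uu]
    rfl
  have hpi : Injective (C.sides 2) :=
    W.cs.injective_side C.c₁_mem C.a₁_mem C.a₀_mem (l1.trans l3).ne'
  have hqi : Injective fun s => G (C.sides 1 s) :=
    G.injective.comp (W.cu.injective_side C.a₁_mem C.c₀_mem C.c₁_mem C.c₀_ne)
  obtain ⟨t₀, ht₀, ht⟩ : W.pt C.a₁' C.c₁ ∈ C.sides 2 '' Icc 0 1 := by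
    rw [C.sides_image]
    refine (W.cs.pt_mem_arc C.c₁_mem C.a₁_mem C.a₀_mem C.a₁'_mem).2 ?_
    rw [mem_uIcc]
    exact Or.inr ⟨l2.le, l4.le⟩
  obtain ⟨s₀, hs₀, hs'⟩ : W.pt C.a₁' C.c₁ ∈ (fun s => G (C.sides 1 s)) '' Icc 0 1 := by
    rw [hG]
    refine (W.cu.pt_mem_arc C.a₁'_mem C.b₀_mem C.b₁_mem C.c₁_mem).2 ?_
    rw [mem_uIcc]
    rcases he with he | he <;> grind
  refine ⟨t₀, ⟨ht₀.1.lt_of_ne fun h => ?_, ht₀.2.lt_of_ne fun h => ?_⟩, s₀,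
    ⟨hs₀.1.lt_of_ne fun h => ?_, hs₀.2.lt_of_ne fun h => ?_⟩, ht, hs', fun t htI s hsI h => ?_⟩
  · rw [← h] at ht
    have h1 := (W.cs.side_zero C.c₁_mem C.a₁_mem).symm.trans ht
    exact l4.ne' (W.cs.pt_inj C.c₁_mem C.a₁_mem C.a₁'_mem h1)
  · rw [h] at ht
    have h1 := (W.cs.side_one C.c₁_mem C.a₀_mem).symm.trans ht
    exact l2.ne (W.cs.pt_inj C.c₁_mem C.a₀_mem C.a₁'_mem h1)
  · simp only [← h] at hs'
    have h1 := (congrArg G (W.cu.side_zero C.a₁_mem C.c₀_mem)).symm.trans hs'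
    rw [C.map₁₀] at h1
    have := W.cu.pt_inj C.a₁'_mem C.b₀_mem C.c₁_mem h1
    rcases he with he | he <;> grind
  · simp only [h] at hs'
    have h1 := (congrArg G (W.cu.side_one C.a₁_mem C.c₁_mem)).symm.trans hs'
    rw [C.map₁₁] at h1
    have := W.cu.pt_inj C.a₁'_mem C.b₁_mem C.c₁_mem h1
    rcases he with he | he <;> grind
  · have h1 : G (C.sides 1 s) ∈ W.cu.fiber C.a₁' :=
      W.cu.arc_subset_fiber C.a₁'_mem C.b₀_mem C.b₁_mem (hG.subset (mem_image_of_mem _ hsI))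
    have h2 : C.sides 2 t ∈ W.cs.fiber C.c₁ :=
      W.cs.arc_subset_fiber C.c₁_mem C.a₁_mem C.a₀_mem (hp t htI)
    have h3 := W.inter _ C.a₁'_mem _ C.c₁_mem _ h1 (h ▸ h2)
    exact ⟨hpi ((h.symm.trans h3).trans ht.symm), hqi (h3.trans hs'.symm)⟩

theorem exists_fixedPoint [T2Space S] [PreconnectedSpace S] [BorelSpace S] {j : ℂ → S}
    (hj : IsOpenEmbedding j) {r : ℝ} (hr : 0 < r)
    (hμ : μ (j '' Metric.ball 0 r) < μ (j '' Metric.ball 0 r)ᶜ) (hV : V ⊆ j '' Metric.ball 0 r)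
    (hG : MeasurePreserving G μ μ) (hs : ∀ b ∈ W.B, G '' W.cs.line b ∈ Ts.lines)
    (hu : ∀ a ∈ W.A, G '' W.cu.line a ∈ Tu.lines) (us : ∀ b ∈ W.B, UniqueArcs (W.cs.line b))
    (uu : ∀ a ∈ W.A, UniqueArcs (W.cu.line a))
    (hQ : ∀ x ∈ Q, ∃ ℓ ∈ Ts.lines, ∃ ℓ' ∈ Tu.lines, x ∈ ℓ ∧ x ∈ ℓ' ∧ TransverseAt ℓ ℓ' x) {e : ℝ}
    (he : C.Ordered e) (heB : e ∈ W.B)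
    (hesc : ∃ z, j z ∈ W.cs.fiber e ∧ Escapes (j ⁻¹' C.hull) z) :
    ∃ z ∈ Metric.ball (0 : ℂ) r, G (j z) = j z := by
  let κ := (hj.toOpenPartialHomeomorph j).symm
  have hκj : ∀ z, κ (j z) = z := fun z => (hj.toOpenPartialHomeomorph j).left_inv (mem_univ _)
  have hVj : V ⊆ range j := hV.trans (image_subset_range _ _)
  have hjκ : ∀ y ∈ range j, j (κ y) = y := by
    rintro _ ⟨z, rfl⟩
    rw [hκj]
  have hκc : ContinuousOn κ (range j) := by
    have := (hj.toOpenPartialHomeomorph j).continuousOn_symm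
    rwa [IsOpenEmbedding.toOpenPartialHomeomorph_target] at this
  have hκr : ∀ y ∈ V, κ y ∈ Metric.ball (0 : ℂ) r := fun y hy => by
    obtain ⟨z, hz, rfl⟩ := hV hy
    rwa [hκj]
  have hP : ∀ k, ∀ t ∈ Icc (0 : ℝ) 1, C.sides k t ∈ C.arcs k := fun k t ht =>
    (C.sides_image k).subset (mem_image_of_mem _ ht)
  have hGP : ∀ k, ∀ t ∈ Icc (0 : ℝ) 1, G (C.sides k t) ∈ C.imageArcs k := fun k t ht =>
    (C.arcs_image hs hu us uu k).subset (mem_image_of_mem _ (hP k t ht))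
  have hPV : ∀ k, ∀ t ∈ Icc (0 : ℝ) 1, C.sides k t ∈ V := fun k t ht => C.arcs_subset k (hP k t ht)
  have hGPV : ∀ k, ∀ t ∈ Icc (0 : ℝ) 1, G (C.sides k t) ∈ V := fun k t ht =>
    C.imageArcs_subset k (hGP k t ht)
  have hpath : ∀ {x b : ℝ} {K : Set ℂ}, x ∈ W.A → b ∈ W.B → K ⊆ j ⁻¹' C.hull →
      Disjoint (j ⁻¹' (W.cu.arc x b e ∪ W.cs.fiber e)) K → Escapes K (κ (W.pt x b)) := by
    intro x b K hx hb hK hd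
    obtain ⟨z, hz, hzE⟩ := hesc
    have hsub : W.cu.arc x b e ∪ W.cs.fiber e ⊆ range j :=
      (union_subset ((W.cu.arc_subset_fiber hx hb heB).trans (W.cu_sub x hx))
        (W.cs_sub e heB)).trans hVj
    have hmem : W.pt x b ∈ W.cu.arc x b e :=
      (W.cu.pt_mem_arc hx hb heB hb).2 left_mem_uIcc
    refine (hzE.mono hK).trans (Z := j ⁻¹' (W.cu.arc x b e ∪ W.cs.fiber e)) ?_ (Or.inr hz) ?_ hd
    · exact ((W.cu.isPreconnected_arc hx).union (W.pt x e)
        ((W.cu.pt_mem_arc hx hb heB heB).2 right_mem_uIcc) (W.cs.pt_mem_fiber heB hx)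
        (W.cs.isPreconnected_fiber heB)).preimage_of_isOpenMap hj.injective hj.isOpenMap hsub
    · rw [mem_preimage, hjκ _ (hsub (Or.inl hmem))]
      exact Or.inl hmem
  refine exists_fixedPoint_of_quadrilaterals hj hr hμ G hG (γ := fun k t => κ (C.sides k t))
    (Γ := fun k t => κ (G (C.sides k t)))
    (fun k => hκc.comp (C.continuous_sides k).continuousOn fun t ht => hVj (hPV k t ht))
    (fun k => hκc.comp (G.continuous.comp (C.continuous_sides k)).continuousOn
      fun t ht => hVj (hGPV k t ht))
    (fun k t ht => hκr _ (hPV k t ht)) (fun k t ht => hκr _ (hGPV k t ht))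
    (fun k => by rw [C.sides_one]) (fun k => by rw [C.sides_one])
    (fun k t ht => by rw [hjκ _ (hVj (hPV k t ht)), hjκ _ (hVj (hGPV k t ht))])
    (fun k l hlk h t ht s hs' heq => ?_) ?_ ?_ ?_
  · have h1 := congrArg j heq
    rw [hjκ _ (hVj (hPV k t ht)), hjκ _ (hVj (hGPV l s hs'))] at h1
    exact (C.disjoint_arcs he k l hlk h).notMem_of_mem_left (hGP l s hs') (h1 ▸ hP k t ht)
  · have hsub : ⋃ k, (fun t => κ (C.sides k t)) '' Icc 0 1 ⊆ ⋃ k, j ⁻¹' C.arcs k :=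
      iUnion_mono fun k => by
        rintro _ ⟨t, ht, rfl⟩
        rw [mem_preimage, hjκ _ (hVj (hPV k t ht))]
        exact hP k t ht
    have h00 : G (C.sides 0 0) = W.pt C.a₀' C.b₀ :=
      (congrArg G (W.cs.side_zero C.c₀_mem C.a₀_mem)).trans C.map₀₀
    rw [h00]
    refine hpath C.a₀'_mem C.b₀_mem (hsub.trans (iUnion_subset fun k =>
      preimage_mono (C.arcs_subset_hull he k))) (Disjoint.mono_right hsub ?_)
    rw [disjoint_iUnion_right]
    exact fun k => (C.disjoint_path_arcs he heB k).preimage j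
  · have hsub : ⋃ k, (fun t => κ (G (C.sides k t))) '' Icc 0 1 ⊆ ⋃ k, j ⁻¹' C.imageArcs k :=
      iUnion_mono fun k => by
        rintro _ ⟨t, ht, rfl⟩
        rw [mem_preimage, hjκ _ (hVj (hGPV k t ht))]
        exact hGP k t ht
    have h00 : C.sides 0 0 = W.pt C.a₀ C.c₀ := W.cs.side_zero C.c₀_mem C.a₀_mem
    rw [h00]
    refine hpath C.a₀_mem C.c₀_mem (hsub.trans (iUnion_subset fun k =>
      preimage_mono (C.imageArcs_subset_hull k))) (Disjoint.mono_right hsub ?_)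
    rw [disjoint_iUnion_right]
    exact fun k => (C.disjoint_path_imageArcs he heB k).preimage j
  · obtain ⟨l1, l2, l3, l4⟩ := C.a_lt
    obtain ⟨t₀, ht₀, s₀, hs₀, ht, hs', huniq⟩ := C.crossing he hs hu us uu
    obtain ⟨ℓ, hℓ, ℓ', hℓ', hxℓ, hxℓ', htr⟩ := hQ _ C.pt_mem
    rw [Comb.lines_eq_of_mem hℓ (W.cs.line_mem _ C.c₁_mem) hxℓ (W.cs.fiber_subset_line C.c₁_mem
      (W.cs.pt_mem_fiber C.c₁_mem C.a₁'_mem)), Comb.lines_eq_of_mem hℓ'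
      (W.cu.line_mem _ C.a₁'_mem) hxℓ' (W.cu.fiber_subset_line C.a₁'_mem
      (W.cu.pt_mem_fiber C.a₁'_mem C.c₁_mem))] at htr
    have hlu : G '' W.cu.line C.a₁ = W.cu.line C.a₁' :=
      image_line_u hu C.a₁_mem C.a₁'_mem C.c₀_mem C.b₀_mem C.map₁₀
    have hqr : range (fun s => G (C.sides 1 s)) = W.cu.line C.a₁' := by
      rw [← hlu, ← W.cu.range_side C.a₁_mem C.c₀_mem C.c₁_mem C.c₀_ne, ← range_comp]
      rfl
    refine htr.boundaryInc_ne_zero (us _ C.c₁_mem) (uu _ C.a₁'_mem) (C.continuous_sides 2)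
      (W.cs.injective_side C.c₁_mem C.a₁_mem C.a₀_mem (l1.trans l3).ne')
      (W.cs.range_side C.c₁_mem C.a₁_mem C.a₀_mem (l1.trans l3).ne')
      (G.continuous.comp (C.continuous_sides 1))
      (G.injective.comp (W.cu.injective_side C.a₁_mem C.c₀_mem C.c₁_mem C.c₀_ne)) hqr ht hs' ht₀ hs₀
      huniq hj.isOpen_range hκc ?_ ?_ (fun t ht => hVj (hPV 2 t ht))
      (fun s hs => hVj (hGPV 1 s hs))
    · intro y hy y' hy' h
      rw [← hjκ y hy, ← hjκ y' hy', h]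
    · rintro _ ⟨z, rfl⟩ N hN
      rw [hκj]
      filter_upwards [hj.continuous.continuousAt.preimage_mem_nhds hN] with w hw
      exact ⟨j w, hw, hκj w⟩

end Cell

end Weave

theorem Homeomorph.image_pow_succ {S : Type*} [TopologicalSpace S] (F : S ≃ₜ S) (n : ℕ)
    (M : Set S) :
    (F ^ (n + 1)) '' M = F '' ((F ^ n) '' M) := by
  rw [F.coe_pow_eq_iterate, F.coe_pow_eq_iterate, iterate_succ', image_comp]

section Scaling

variable {S : Type} [TopologicalSpace S] [MeasurableSpace S] {μ : Measure S}
  {T : MeasuredTurbulation μ} {F : S ≃ₜ S} {c : ℝ≥0∞}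

theorem image_pow_mem_lines (hi : ∀ ℓ ∈ T.lines, F '' ℓ ∈ T.lines) (n : ℕ) {ℓ : Set S}
    (hℓ : ℓ ∈ T.lines) : (F ^ n) '' ℓ ∈ T.lines := by
  induction n with
  | zero => rwa [F.coe_pow_eq_iterate, iterate_zero, image_id]
  | succ n ih => rw [F.image_pow_succ]; exact hi _ ih

theorem measure_image_pow (hi : ∀ ℓ ∈ T.lines, F '' ℓ ∈ T.lines)
    (hc : ∀ ℓ ∈ T.lines, ∀ K x y, IsArcIn ℓ K x y → T.ν (F '' ℓ) (F '' K) = c * T.ν ℓ K) (n : ℕ)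
    {ℓ K : Set S} {x y : S} (hℓ : ℓ ∈ T.lines) (hK : IsArcIn ℓ K x y) :
    T.ν ((F ^ n) '' ℓ) ((F ^ n) '' K) = c ^ n * T.ν ℓ K := by
  induction n with
  | zero => rw [F.coe_pow_eq_iterate, iterate_zero, image_id, image_id, pow_zero, one_mul]
  | succ n ih =>
    rw [F.image_pow_succ, F.image_pow_succ,
      hc _ (image_pow_mem_lines hi n hℓ) _ _ _ (hK.image (F ^ n)), ih, pow_succ', mul_assoc]

theorem measure_image_pow_symm (hi : ∀ ℓ ∈ T.lines, F '' ℓ ∈ T.lines)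
    (hc : ∀ ℓ ∈ T.lines, ∀ K x y, IsArcIn ℓ K x y → T.ν (F '' ℓ) (F '' K) = c * T.ν ℓ K)
    (h0 : c ≠ 0) (ht : c ≠ ⊤) (n : ℕ) {ℓ K : Set S} {x y : S}
    (hℓ : (F ^ n).symm '' ℓ ∈ T.lines) (hK : IsArcIn ℓ K x y) :
    T.ν ((F ^ n).symm '' ℓ) ((F ^ n).symm '' K) = c⁻¹ ^ n * T.ν ℓ K := by
  have h := measure_image_pow hi hc n hℓ (hK.image (F ^ n).symm)
  rw [← image_comp, ← image_comp, (F ^ n).self_comp_symm, image_id, image_id] at h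
  rw [h, ← mul_assoc, ← mul_pow, ENNReal.inv_mul_cancel h0 ht, one_pow, one_mul]

theorem Comb.contracted [T2Space S] [CompactSpace S] [ChartedSpace (EuclideanHalfSpace 2) S]
    {A B : Set ℝ} {β : Measure ℝ} {pt : ℝ → ℝ → S} (C : Comb T A B β pt) (hT : T.Tame)
    (hd : T.DenseStreamlines) (hne : ∀ ℓ ∈ T.lines, ∃ ℓ' ∈ T.lines, ℓ' ≠ ℓ) (hc0 : c ≠ 0)
    (hc1 : c < 1) (H : ℕ → S ≃ₜ S) (hH : ∀ a ∈ A, ∀ k, H k '' C.line a ∈ T.lines)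
    (hs : ∀ a ∈ A, ∀ k K x y, IsArcIn (C.line a) K x y →
      T.ν (H k '' C.line a) (H k '' K) = c ^ k * T.ν (C.line a) K) :
    C.Contracted H (fun k => c ^ k) where
  image_mem := hH
  unique a ha := uniqueArcs_of_contracting T hT hd hne H (hH a ha) fun K x y hK => by
    simp only [fun k => hs a ha k K x y hK]
    have h1 := ENNReal.Tendsto.mul_const (b := T.ν (C.line a) K)
      (ENNReal.tendsto_pow_atTop_nhds_zero_of_lt_one hc1)
      (Or.inr (T.ν_arc_finite _ (C.line_mem a ha) K x y hK).ne)
    rwa [zero_mul] at h1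
  scale := hs
  ne_zero k := pow_ne_zero k hc0
  ne_top k := ENNReal.pow_ne_top (hc1.trans ENNReal.one_lt_top).ne
  lim := ENNReal.tendsto_pow_atTop_nhds_zero_of_lt_one hc1

end Scaling

namespace Weave

variable {S : Type} [TopologicalSpace S] [MeasurableSpace S] {μ : Measure S}
  {Ts Tu : MeasuredTurbulation μ} {V : Set S}

/-- The weave obtained by discarding some of the unstable fibers. -/
def restrict (W : Weave Ts Tu V) {A' : Set ℝ} (hA : A' ⊆ W.A) (hm : MeasurableSet A')
    (hne : W.α A' ≠ 0) : Weave Ts Tu V where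
  A := A'
  B := W.B
  α := W.α
  β := W.β
  pt := W.pt
  cu :=
    { W.cu with
      line_mem := fun a ha => W.cu.line_mem a (hA ha)
      par_cont := fun a ha => W.cu.par_cont a (hA ha)
      par_inj := fun a ha => W.cu.par_inj a (hA ha)
      par_range := fun a ha => W.cu.par_range a (hA ha)
      pos_mem := fun a ha => W.cu.pos_mem a (hA ha)
      pos_mono := fun a ha => W.cu.pos_mono a (hA ha)
      par_pos := fun a ha => W.cu.par_pos a (hA ha)
      measure_eq := fun a ha => W.cu.measure_eq a (hA ha)
      measure_le := fun a ha => W.cu.measure_le a (hA ha)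
      disj := fun a ha a' ha' => W.cu.disj a (hA ha) a' (hA ha') }
  cs :=
    { W.cs with
      pos_mem := fun b hb a ha => W.cs.pos_mem b hb a (hA ha)
      pos_mono := fun b hb => (W.cs.pos_mono b hb).mono hA
      par_pos := fun b hb a ha => W.cs.par_pos b hb a (hA ha)
      measure_eq := fun b hb M hM => W.cs.measure_eq b hb M (hM.trans hA) }
  measurableSet_A := hm
  measurableSet_B := W.measurableSet_B
  finite_α := W.finite_α
  finite_β := W.finite_β
  noAtoms_α := W.noAtoms_α
  noAtoms_β := W.noAtoms_β
  α_ne := hne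
  β_ne := W.β_ne
  pt_meas := W.pt_meas
  inter a ha := W.inter a (hA ha)
  cu_sub a ha := W.cu_sub a (hA ha)
  cs_sub := W.cs_sub
  measure_image E hE := W.measure_image E (hE.trans (prod_mono hA Subset.rfl))

theorem exists_restrict (W : Weave Ts Tu V) {Q : Set S} (hQ : MeasurableSet Q) (hQ0 : μ Qᶜ = 0) :
    ∃ W' : Weave Ts Tu V, ∀ a ∈ W'.A, W'.β {b | b ∈ W'.B ∧ W'.pt a b ∉ Q} = 0 := by
  let E : Set (ℝ × ℝ) := (W.A ×ˢ W.B) ∩ uncurry W.pt ⁻¹' Qᶜ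
  have hE : MeasurableSet E :=
    (W.measurableSet_A.prod W.measurableSet_B).inter (W.pt_meas hQ.compl)
  have hE0 : (W.α.prod W.β) E = 0 := by
    rw [← (W.measure_image E inter_subset_left hE).2]
    refine measure_mono_null ?_ hQ0
    rintro _ ⟨z, hz, rfl⟩
    exact hz.2
  have hm : MeasurableSet {a | W.β (Prod.mk a ⁻¹' E) = 0} :=
    measurable_measure_prodMk_left hE (measurableSet_singleton 0)
  have hae : W.α {a | W.β (Prod.mk a ⁻¹' E) = 0}ᶜ = 0 := (Measure.measure_prod_null hE).1 hE0
  have hne : W.α (W.A ∩ {a | W.β (Prod.mk a ⁻¹' E) = 0}) ≠ 0 := by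
    rw [measure_inter_conull hae]
    exact W.α_ne
  refine ⟨W.restrict inter_subset_left (W.measurableSet_A.inter hm) hne, fun a ha => ?_⟩
  have h1 : W.β (Prod.mk a ⁻¹' E) = 0 := ha.2
  refine measure_mono_null ?_ h1
  rintro b ⟨hb, hbQ⟩
  exact ⟨⟨ha.1, hb⟩, hbQ⟩

/-- If the backward orbit of a point of an unstable fiber consists of points of streamlines, then
the backward images of its streamline are streamlines. -/
theorem image_pow_symm_mem {T : MeasuredTurbulation μ} {F : S ≃ₜ S}
    (hi : ∀ ℓ ∈ T.lines, F '' ℓ ∈ T.lines) (n : ℕ) {ℓ : Set S} (hℓ : ℓ ∈ T.lines) {x : S}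
    (hx : x ∈ ℓ) (h : (F ^ n).symm x ∈ ⋃₀ T.lines) : (F ^ n).symm '' ℓ ∈ T.lines := by
  obtain ⟨ℓ', hℓ', hxℓ'⟩ := h
  have h1 : (F ^ n) '' ℓ' = ℓ := Comb.lines_eq_of_mem (image_pow_mem_lines hi n hℓ') hℓ
    ⟨_, hxℓ', (F ^ n).apply_symm_apply x⟩ hx
  rwa [← h1, ← image_comp, (F ^ n).symm_comp_self, image_id]

end Weave

section Periodic

variable {S : Type} [TopologicalSpace S]

theorem exists_isOpenEmbedding_complex {x : S} (hx : x ∉ ManifoldBdry S) :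
    ∃ j : ℂ → S, IsOpenEmbedding j ∧ j 0 = x := by
  obtain ⟨N, hN, hxN, ⟨e⟩⟩ := not_not.1 hx
  let h : ℂ ≃ₜ N := ((Homeomorph.addRight (Complex.equivRealProdCLM.symm (e ⟨x, hxN⟩))).trans
    Complex.equivRealProdCLM.toHomeomorph).trans e.symm
  refine ⟨fun z => h z, hN.isOpenEmbedding_subtypeVal.comp h.isOpenEmbedding, ?_⟩
  have h0 : h 0 = ⟨x, hxN⟩ := by simp [h]
  exact congrArg Subtype.val h0

theorem Topology.IsOpenEmbedding.exists_measure_image_ball_lt [MeasurableSpace S]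
    {μ : Measure S} [μ.OuterRegular] {j : ℂ → S} (hj : IsOpenEmbedding j) (h0 : μ {j 0} = 0)
    {U : Set S} (hU : IsOpen U) (hjU : j 0 ∈ U) {ε : ℝ≥0∞} (hε : 0 < ε) :
    ∃ r : ℝ, 0 < r ∧ j '' Metric.ball 0 r ⊆ U ∧ μ (j '' Metric.ball 0 r) < ε := by
  obtain ⟨N, hjN, hN, hμN⟩ := ({j 0} : Set S).exists_isOpen_lt_of_lt ε (h0.trans_lt hε)
  obtain ⟨r, hr, hb⟩ := Metric.isOpen_iff.1 ((hU.inter hN).preimage hj.continuous) 0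
    ⟨hjU, hjN rfl⟩
  have hb' := image_subset_iff.2 hb
  exact ⟨r, hr, hb'.trans inter_subset_left,
    (measure_mono (hb'.trans inter_subset_right)).trans_lt hμN⟩

variable [MeasurableSpace S] {μ : Measure S} {Ts Tu : MeasuredTurbulation μ}

theorem MeasuredTurbulation.DenseStreamlines.preconnectedSpace (hd : Ts.DenseStreamlines) :
    PreconnectedSpace S := by
  obtain ⟨ℓ, hℓ⟩ : Ts.lines.Nonempty := nonempty_iff_ne_empty.2 fun h => by
    simpa [h] using Ts.domain_full
  refine ⟨?_⟩
  rw [← (hd ℓ hℓ).closure_eq]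
  exact (Ts.lines_immersed ℓ hℓ).isPreconnected.closure

namespace Weave

variable {V Q : Set S} {W : Weave Ts Tu V}

namespace Cell

variable {G G' : S ≃ₜ S}

theorem hull_subset (C : W.Cell G Q) : C.hull ⊆ V := by
  have hA : ({C.a₀, C.a₁, C.a₀', C.a₁'} : Set ℝ) ⊆ W.A := by
    rintro x (rfl | rfl | rfl | rfl)
    exacts [C.a₀_mem, C.a₁_mem, C.a₀'_mem, C.a₁'_mem]
  have hB : ({C.b₀, C.b₁, C.c₀, C.c₁} : Set ℝ) ⊆ W.B := by
    rintro x (rfl | rfl | rfl | rfl)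
    exacts [C.b₀_mem, C.b₁_mem, C.c₀_mem, C.c₁_mem]
  exact union_subset (iUnion₂_subset fun y hy => W.cs_sub y (hB hy))
    (iUnion₂_subset fun x hx => (W.cu.arc_subset_fiber (hA hx) C.b₀_mem C.b₁_mem).trans
      (W.cu_sub x (hA hx)))

/-- Of two cells lying over disjoint intervals, at least one can be connected to infinity without
meeting the other one. -/
theorem exists_escapes [T2Space S] (C : W.Cell G Q) (D : W.Cell G' Q) {j : ℂ → S}
    (hj : IsOpenEmbedding j) (hV : V ⊆ range j) (hC₀ : C.c₀ ∈ uIcc C.b₀ C.b₁)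
    (hC₁ : C.c₁ ∈ uIcc C.b₀ C.b₁) (hD₀ : D.c₀ ∈ uIcc D.b₀ D.b₁) (hD₁ : D.c₁ ∈ uIcc D.b₀ D.b₁)
    (h : Disjoint (uIcc C.b₀ C.b₁) (uIcc D.b₀ D.b₁)) :
    (∃ z, j z ∈ W.cs.fiber D.b₀ ∧ Escapes (j ⁻¹' C.hull) z) ∨
      ∃ z, j z ∈ W.cs.fiber C.b₀ ∧ Escapes (j ⁻¹' D.hull) z := by
  have hA : ∀ {G : S ≃ₜ S} (C : W.Cell G Q), ({C.a₀, C.a₁, C.a₀', C.a₁'} : Set ℝ) ⊆ W.A := by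
    rintro G C x (rfl | rfl | rfl | rfl)
    exacts [C.a₀_mem, C.a₁_mem, C.a₀'_mem, C.a₁'_mem]
  have hB : ∀ {G : S ≃ₜ S} (C : W.Cell G Q), ({C.b₀, C.b₁, C.c₀, C.c₁} : Set ℝ) ⊆ W.B := by
    rintro G C x (rfl | rfl | rfl | rfl)
    exacts [C.b₀_mem, C.b₁_mem, C.c₀_mem, C.c₁_mem]
  have hI : ∀ {b b' c c' : ℝ}, c ∈ uIcc b b' → c' ∈ uIcc b b' →
      ({b, b', c, c'} : Set ℝ) ⊆ uIcc b b' := by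
    rintro b b' c c' hc hc' x (rfl | rfl | rfl | rfl)
    exacts [left_mem_uIcc, right_mem_uIcc, hc, hc']
  have hK : ∀ {G : S ≃ₜ S} (C : W.Cell G Q), IsCompact (j ⁻¹' C.hull) := fun C =>
    hj.isInducing.isCompact_preimage' (W.isCompact_hull (hA C) (hB C) (toFinite _) (toFinite _))
      (C.hull_subset.trans hV)
  have hP : ∀ {G : S ≃ₜ S} (C : W.Cell G Q), C.c₀ ∈ uIcc C.b₀ C.b₁ → C.c₁ ∈ uIcc C.b₀ C.b₁ →
      IsPreconnected (j ⁻¹' C.hull) := fun C h₀ h₁ =>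
    (W.isPreconnected_hull (hA C) (hB C) (mem_insert _ _) (mem_insert _ _) C.b₁_mem
      (hI h₀ h₁)).preimage_of_isOpenMap hj.injective hj.isOpenMap (C.hull_subset.trans hV)
  have hN : ∀ {G : S ≃ₜ S} (C : W.Cell G Q), ∃ z, j z ∈ W.cs.fiber C.b₀ ∧ z ∈ j ⁻¹' C.hull := by
    intro G C
    have h1 : W.pt C.a₀ C.b₀ ∈ W.cs.fiber C.b₀ := W.cs.pt_mem_fiber C.b₀_mem C.a₀_mem
    obtain ⟨z, hz⟩ := hV (W.cs_sub _ C.b₀_mem h1)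
    rw [← hz] at h1
    exact ⟨z, h1, W.fiber_subset_hull (mem_insert _ _) h1⟩
  have hd : Disjoint (j ⁻¹' C.hull) (j ⁻¹' D.hull) := (W.disjoint_hull (hA C) (hA D) (hB C) (hB D)
    (by simp) (by simp) (by simp) (by simp) (hI hC₀ hC₁) (hI hD₀ hD₁) h).preimage j
  obtain ⟨z, hz, hzC⟩ := hN C
  obtain ⟨w, hw, hwD⟩ := hN D
  rcases escapes_or_escapes (hK C) (hK D) ⟨z, hzC⟩ hd with ⟨d, hdD, hE⟩ | ⟨d, hdC, hE⟩
  · exact Or.inl ⟨w, hw, hE.trans (hP D hD₀ hD₁) hdD hwD hd.symm⟩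
  · exact Or.inr ⟨z, hz, hE.trans (hP C hC₀ hC₁) hdC hzC hd⟩

end Cell

theorem exists_isPeriodicPt [T2Space S] [CompactSpace S] [PolishSpace S] [BorelSpace S]
    [PreconnectedSpace S] [IsProbabilityMeasure μ] (W : Weave Ts Tu V) {F : S ≃ₜ S}
    {κ κ' : ℕ → ℝ≥0∞} (hF : MeasurePreserving F μ μ) (hTs : Ts.Tame) (hTu : Tu.Tame)
    (hFs : ∀ ℓ ∈ Ts.lines, F '' ℓ ∈ Ts.lines) (hFu : ∀ ℓ ∈ Tu.lines, F '' ℓ ∈ Tu.lines)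
    (hs : W.cs.Contracted (fun n => F ^ n) κ) (hu : W.cu.Contracted (fun n => (F ^ n).symm) κ')
    (hQ : MeasurableSet Q) (htr : ∀ a ∈ W.A, W.β {b | b ∈ W.B ∧ W.pt a b ∉ Q} = 0)
    (hQt : ∀ x ∈ Q, ∃ ℓ ∈ Ts.lines, ∃ ℓ' ∈ Tu.lines, x ∈ ℓ ∧ x ∈ ℓ' ∧ TransverseAt ℓ ℓ' x)
    {j : ℂ → S} (hj : IsOpenEmbedding j) {r : ℝ} (hr : 0 < r)
    (hμ : μ (j '' Metric.ball 0 r) < μ (j '' Metric.ball 0 r)ᶜ)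
    (hV : V ⊆ j '' Metric.ball 0 r) :
    ∃ x ∈ j '' Metric.ball 0 r, ∃ n : ℕ, 1 ≤ n ∧ F^[n] x = x := by
  have := W.noAtoms_α
  have := W.noAtoms_β
  obtain ⟨X, hX, hXlt⟩ := exists_windows W.measurableSet_A W.α_ne
  obtain ⟨Y, hY, hYlt⟩ := exists_windows W.measurableSet_B W.β_ne
  have hcell : ∀ f : Fin 5 → ℕ, ((∀ i k, i < k → f i < f k) ∨ ∀ i k, i < k → f k < f i) →
      ∃ n : ℕ, 1 ≤ n ∧ ∃ C : W.Cell (F ^ n) Q, C.b₀ ∈ Y (f 1) ∧ C.c₀ ∈ Y (f 2) ∧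
        C.c₁ ∈ Y (f 2) ∧ C.b₁ ∈ Y (f 3) := fun f hf =>
    W.exists_cell hF hTs hTu hs hu hQ htr (hX 0).1 (hX 1).1 (hX 2).1 (fun i => (hY (f i)).1)
      (hX 0).2.1 (hX 1).2.1 (hX 2).2.1 (fun i => (hY (f i)).2.1) (hX 0).2.2 (hX 1).2.2 (hX 2).2.2
      (fun i => (hY (f i)).2.2) (hXlt 0 1 (by simp)) (hXlt 1 2 (by simp))
      (hf.imp (fun h i k hik => hYlt _ _ (h i k hik))
        fun h i k hik x hx y hy => hYlt _ _ (h i k hik) y hy x hx)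
  have hfix : ∀ n : ℕ, 1 ≤ n → ∀ C : W.Cell (F ^ n) Q, ∀ e ∈ W.B, C.Ordered e →
      (∃ z, j z ∈ W.cs.fiber e ∧ Escapes (j ⁻¹' C.hull) z) →
      ∃ x ∈ j '' Metric.ball 0 r, ∃ n : ℕ, 1 ≤ n ∧ F^[n] x = x := by
    intro n hn C e he hC hesc
    obtain ⟨z, hz, hfz⟩ := C.exists_fixedPoint hj hr hμ hV
      (by rw [F.coe_pow_eq_iterate]; exact hF.iterate n)
      (fun b hb => image_pow_mem_lines hFs n (W.cs.line_mem b hb))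
      (fun a ha => image_pow_mem_lines hFu n (W.cu.line_mem a ha)) hs.unique hu.unique hQt hC he hesc
    exact ⟨j z, mem_image_of_mem j hz, n, hn, by rwa [← F.coe_pow_eq_iterate]⟩
  obtain ⟨m, hm, C, hC1, hC2, hC3, hC4⟩ := hcell (fun i => 4 - i) (Or.inr (by decide))
  obtain ⟨n, hn, D, hD1, hD2, hD3, hD4⟩ := hcell (fun i => 5 + i) (Or.inl (by decide))
  have c1 := hYlt 1 2 (by simp) _ hC4 _ hC2
  have c2 := hYlt 1 2 (by simp) _ hC4 _ hC3
  have c3 := hYlt 2 3 (by simp) _ hC2 _ hC1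
  have c4 := hYlt 2 3 (by simp) _ hC3 _ hC1
  have cd := hYlt 3 6 (by simp) _ hC1 _ hD1
  have d1 := hYlt 6 7 (by simp) _ hD1 _ hD2
  have d2 := hYlt 6 7 (by simp) _ hD1 _ hD3
  have d3 := hYlt 7 8 (by simp) _ hD2 _ hD4
  have d4 := hYlt 7 8 (by simp) _ hD3 _ hD4
  rcases C.exists_escapes D hj (hV.trans (image_subset_range _ _))
    (mem_uIcc.2 (Or.inr ⟨c1.le, c3.le⟩)) (mem_uIcc.2 (Or.inr ⟨c2.le, c4.le⟩))
    (mem_uIcc.2 (Or.inl ⟨d1.le, d3.le⟩)) (mem_uIcc.2 (Or.inl ⟨d2.le, d4.le⟩))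
    (Set.disjoint_left.2 fun x hx hx' => by
      rw [mem_uIcc] at hx hx'
      grind) with h | h
  · exact hfix m hm C _ D.b₀_mem (Or.inr ⟨cd, c3, c4, c1, c2⟩) h
  · exact hfix n hn D _ C.b₀_mem (Or.inl ⟨cd, d1, d2, d3, d4⟩) h

end Weave

end Periodic

/-- every measurable pseudo-Anosov homeomorphism has dense periodic
points. -/
theorem mpa_dense_periodic_points
    {S : Type} [TopologicalSpace S] [T2Space S] [CompactSpace S]
    [ChartedSpace (EuclideanHalfSpace 2) S] [MeasurableSpace S] [BorelSpace S]
    (μ : Measure S) [IsProbabilityMeasure μ] (hμ : IsOUMeasure μ)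
    (Ts Tu : MeasuredTurbulation μ) (F : S ≃ₜ S) (lam : ℝ)
    (hF : IsMPA μ F Ts Tu lam) :
    ∀ U : Set S, IsOpen U → U.Nonempty →
      ∃ x ∈ U, ∃ n : ℕ, 1 ≤ n ∧ (⇑F)^[n] x = x := by
  intro U hU hUne
  have := metrizableSpace_of_halfSpace (S := S)
  have : PolishSpace S := by
    let := TopologicalSpace.metrizableSpaceMetric S
    infer_instance
  obtain ⟨⟨Z, hZ, hZ1, htr⟩, hTs, hTu, hfull, hds, hdu⟩ := hF.turbulations
  have := hds.preconnectedSpace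
  obtain ⟨x, hxU, hx⟩ : (U \ ManifoldBdry S).Nonempty := nonempty_of_measure_ne_zero (μ := μ) <| by
    rw [measure_sdiff_null hμ.boundaryNull]
    exact (hμ.openPos U hU hUne).ne'
  obtain ⟨j, hj, rfl⟩ := exists_isOpenEmbedding_complex hx
  obtain ⟨r, hr, hrU, hrμ⟩ := hj.exists_measure_image_ball_lt (hμ.noAtoms _) hU hxU
    (ε := 2⁻¹) (by simp)
  have hO : IsOpen (j '' Metric.ball 0 r) := hj.isOpenMap _ Metric.isOpen_ball
  have hμr : μ (j '' Metric.ball 0 r) < μ (j '' Metric.ball 0 r)ᶜ := by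
    rw [prob_compl_eq_one_sub hO.measurableSet]
    refine lt_tsub_iff_right.2 ?_
    rw [← ENNReal.inv_two_add_inv_two]
    exact ENNReal.add_lt_add hrμ hrμ
  obtain ⟨R, hRc, hRpos, hRV⟩ := hfull.2 _ hO ((Metric.nonempty_ball.2 hr).image j)
  obtain ⟨W₀⟩ := R.exists_weave hRc hRpos hRV
  have hmp : ∀ k, MeasurePreserving (F ^ k).symm μ μ := fun k => by
    have h : MeasurePreserving (F ^ k) μ μ := by
      rw [F.coe_pow_eq_iterate]
      exact hF.measurePreserving.iterate k
    exact h.symm (F ^ k).toMeasurableEquiv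
  let Q : Set S := Z ∩ ⋂ k : ℕ, (F ^ k).symm ⁻¹' ⋃₀ Tu.lines
  have hQ : MeasurableSet Q := hZ.inter
    (MeasurableSet.iInter fun k => (hmp k).measurable Tu.domain_borel)
  have hQ0 : μ Qᶜ = 0 := by
    rw [compl_inter, compl_iInter]
    refine measure_union_null ((prob_compl_eq_zero_iff hZ).2 hZ1) (measure_iUnion_null fun k => ?_)
    rw [← preimage_compl, (hmp k).measure_preimage Tu.domain_borel.compl.nullMeasurableSet]
    exact (prob_compl_eq_zero_iff Tu.domain_borel).2 Tu.domain_full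
  obtain ⟨W, hW⟩ := W₀.exists_restrict hQ hQ0
  have := W.noAtoms_α
  have := W.noAtoms_β
  have hl0 : ENNReal.ofReal lam ≠ 0 := by
    simpa using zero_lt_one.trans hF.one_lt_lam
  have hl1 : (ENNReal.ofReal lam)⁻¹ < 1 := by
    simpa [ENNReal.inv_lt_one] using hF.one_lt_lam
  have hi0 : (ENNReal.ofReal lam)⁻¹ ≠ 0 := by simp
  have hback : ∀ a ∈ W.A, ∀ k, (F ^ k).symm '' W.cu.line a ∈ Tu.lines := fun a ha k => by
    obtain ⟨b, hb, hbQ⟩ : ∃ b ∈ W.B, W.pt a b ∈ Q := by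
      by_contra! hcon
      refine W.β_ne (measure_mono_null ?_ (hW a ha))
      exact fun b hb => ⟨hb, hcon b hb⟩
    exact Weave.image_pow_symm_mem hF.unstable_image k (W.cu.line_mem a ha)
      (W.cu.fiber_subset_line ha (W.cu.pt_mem_fiber ha hb)) (mem_iInter.1 hbQ.2 k)
  have hs := W.cs.contracted hTs hds
    (fun ℓ hℓ => W.cs.exists_ne_line W.β_ne W.α_ne W.measurableSet_A hℓ) hi0 hl1 (fun n => F ^ n)
    (fun b hb k => image_pow_mem_lines hF.stable_image k (W.cs.line_mem b hb))
    fun b hb k K x y hK => measure_image_pow hF.stable_image hF.stable_contract k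
      (W.cs.line_mem b hb) hK
  have hu := W.cu.contracted hTu hdu
    (fun ℓ hℓ => W.cu.exists_ne_line W.α_ne W.β_ne W.measurableSet_B hℓ) hi0 hl1
    (fun n => (F ^ n).symm) hback fun a ha k K x y hK => measure_image_pow_symm hF.unstable_image
      hF.unstable_expand hl0 ENNReal.ofReal_ne_top k (hback a ha k) hK
  obtain ⟨x, hx, hn⟩ := W.exists_isPeriodicPt hF.measurePreserving hTs hTu hF.stable_image
    hF.unstable_image hs hu hQ hW (fun x hx => htr x hx.1) hj hr hμr Subset.rfl
  exact ⟨x, hrU hx, hn⟩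

end
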